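/- For every ε > 0 there is a constant K(ε) with the following property. Let F be a normalized holomorphic Hecke eigenform of even weight k ≥ 12 for SL(2, ℤ) with normalized Hecke eigenvalues λ. Let X, Z ≥ 1, let G : ℝ → ℂ be smooth, supported on [X, 2X], with |G^{(ν)}| ≤ K_ν (X/Z)^{−ν} for all ν ∈ ℕ₀, and let a, q ∈ ℕ. Then | Σ_{n ≡ a (mod q)} G(n) λ(n) | ≤ K(ε) (qkZ)^{ε} (Z² + k²) q^{1/2}. -/

import Mathlib

/-- Normalized Hecke eigenvalues: `λ(n) = a(n) n^{−(k−1)/2}` for `n ≥ 1`, `λ(m) = 0` for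
`m ≤ 0`. -/
noncomputable def heckeLambda (k : ℕ) (a : ℕ → ℂ) (m : ℤ) : ℂ :=
  if 0 < m then a m.toNat * ((m.toNat : ℝ) ^ (-(((k : ℝ) - 1) / 2)) : ℝ) else 0

/-- `a : ℕ → ℂ` is the sequence of Fourier coefficients of a normalized holomorphic Hecke
eigenform of even weight `k ≥ 12` for `SL(2, ℤ)`. -/
def IsNormalizedHeckeEigenform (k : ℕ) (a : ℕ → ℂ) : Prop :=
  Even k ∧ 12 ≤ k ∧
  (∃ F : CuspForm (CongruenceSubgroup.Gamma 1) k, F ≠ 0 ∧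
    ∀ z : UpperHalfPlane, F z = ∑' n : ℕ,
      a (n + 1) * Complex.exp (2 * Real.pi * Complex.I * (n + 1) * (z : ℂ))) ∧
  a 1 = 1 ∧
  ∀ m n : ℕ, 1 ≤ m → 1 ≤ n →
    a m * a n = ∑ d ∈ (Nat.gcd m n).divisors, (d : ℂ) ^ (k - 1) * a (m * n / d ^ 2)

set_option autoImplicit false
set_option linter.all false

section Parts
open Finset

section Stepanov
variable {K : Type} [Field K] (p : ℕ) [hp : Fact p.Prime] [CharP K p] (a b τ : K)

def StPt : Type := {P : K × K // P.1 ≠ 0 ∧ P.2 ^ p - P.2 = a * P.1 + b / P.1 - τ}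

def stE (n : ℕ) : StPt p a b τ → K := fun P => P.1.1 ^ (n / p) * P.1.2 ^ (n % p)

def stI (n : ℕ) : Prop := n = 0 ∨ p ≤ n

theorem stI_add {n m : ℕ} (hn : stI p n) (hm : stI p m) : stI p (n + m) := by
  unfold stI at *; omega

def stG (n : ℕ) : Submodule K (StPt p a b τ → K) :=
  Submodule.span K (stE p a b τ '' {m | stI p m ∧ m < n})

def stLead (n : ℕ) (f : StPt p a b τ → K) : Prop :=
  ∃ c : K, c ≠ 0 ∧ f - c • stE p a b τ n ∈ stG p a b τ n

theorem stG_mono {n m : ℕ} (h : n ≤ m) : stG p a b τ n ≤ stG p a b τ m :=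
  Submodule.span_mono (Set.image_mono fun x hx => ⟨hx.1, lt_of_lt_of_le hx.2 h⟩)

theorem stE_mem {n m : ℕ} (hn : stI p n) (h : n < m) : stE p a b τ n ∈ stG p a b τ m :=
  Submodule.subset_span ⟨n, ⟨hn, h⟩, rfl⟩

theorem stE_zero : stE p a b τ 0 = 1 := by ext P; simp [stE]

variable {a} in
theorem stE_mul (ha : a ≠ 0) {n m : ℕ} (hn : stI p n) (hm : stI p m) :
    stLead p a b τ (n + m) (stE p a b τ n * stE p a b τ m) := by
  have hp0 : 0 < p := hp.out.pos
  rcases hn with rfl | hn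
  · exact ⟨1, one_ne_zero, by simp [stE_zero]⟩
  rcases hm with rfl | hm
  · exact ⟨1, one_ne_zero, by simp [stE_zero]⟩
  obtain ⟨k, i, hi, rfl⟩ : ∃ k i, i < p ∧ n = p * k + i :=
    ⟨n / p, n % p, Nat.mod_lt _ hp0, (Nat.div_add_mod n p).symm⟩
  obtain ⟨k', i', hi', rfl⟩ : ∃ k i, i < p ∧ m = p * k + i :=
    ⟨m / p, m % p, Nat.mod_lt _ hp0, (Nat.div_add_mod m p).symm⟩
  have hE : ∀ k i, i < p → ∀ P, stE p a b τ (p * k + i) P = P.1.1 ^ k * P.1.2 ^ i := by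
    intro k i hi P
    simp [stE, Nat.mul_add_div hp0, Nat.div_eq_of_lt hi, Nat.mod_eq_of_lt hi]
  have hk : 1 ≤ k := by
    by_contra h
    have : k = 0 := by omega
    subst this; omega
  have hk' : 1 ≤ k' := by
    by_contra h
    have : k' = 0 := by omega
    subst this; omega
  by_cases hj : i + i' < p
  · refine ⟨1, one_ne_zero, ?_⟩
    convert Submodule.zero_mem _
    rw [sub_eq_zero]
    have : p * k + i + (p * k' + i') = p * (k + k') + (i + i') := by ring
    rw [this]
    ext P
    simp only [Pi.mul_apply, one_smul, hE _ _ hi, hE _ _ hi', hE _ _ hj]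
    ring
  · obtain ⟨r, hr⟩ : ∃ r, i + i' = p + r := ⟨i + i' - p, by omega⟩
    obtain ⟨s, hs⟩ : ∃ s, k + k' = s + 1 + 1 := ⟨k + k' - 2, by omega⟩
    refine ⟨a, ha, ?_⟩
    have e1 : p * k + i + (p * k' + i') = p * (s + 3) + r := by
      have : p * k + i + (p * k' + i') = p * (k + k') + (i + i') := by ring
      rw [this, hs, hr]; ring
    have hps : p * (s + 3) = p * s + 3 * p := by ring
    have hps2 : p * (s + 2) = p * s + 2 * p := by ring
    have hps1 : p * (s + 1) = p * s + p := by ring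
    have key : stE p a b τ (p * k + i) * stE p a b τ (p * k' + i')
        - a • stE p a b τ (p * k + i + (p * k' + i')) =
        stE p a b τ (p * (s + 2) + (r + 1)) + b • stE p a b τ (p * (s + 1) + r)
          - τ • stE p a b τ (p * (s + 2) + r) := by
      rw [e1]
      ext P
      have hx := P.2.1
      have hy : P.1.2 ^ p = P.1.2 + a * P.1.1 + b / P.1.1 - τ := by
        have := P.2.2
        linear_combination this
      simp only [Pi.sub_apply, Pi.add_apply, Pi.mul_apply, Pi.smul_apply, smul_eq_mul,
        hE _ _ hi, hE _ _ hi', hE _ r (by omega), hE _ (r+1) (by omega)]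
      have : P.1.1 ^ k * P.1.2 ^ i * (P.1.1 ^ k' * P.1.2 ^ i') =
        P.1.1 ^ (s + 2) * (P.1.2 ^ p * P.1.2 ^ r) := by
        rw [← pow_add, ← hr, show s + 2 = k + k' by omega]; ring
      rw [this, hy]
      field_simp
      ring
    rw [key]
    refine Submodule.sub_mem _ (Submodule.add_mem _ ?_ (Submodule.smul_mem _ _ ?_))
      (Submodule.smul_mem _ _ ?_) <;> refine stE_mem p a b τ (Or.inr ?_) ?_ <;> omega

variable {a} in
theorem stG_emul (ha : a ≠ 0) {n m : ℕ} (hn : stI p n) {g : StPt p a b τ → K}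
    (hg : g ∈ stG p a b τ m) : stE p a b τ n * g ∈ stG p a b τ (n + m) := by
  unfold stG at hg
  induction hg using Submodule.span_induction with
  | mem x h =>
    obtain ⟨m', ⟨h1, h2⟩, rfl⟩ := h
    obtain ⟨c, hc, h⟩ := stE_mul p b τ ha hn h1
    have := Submodule.add_mem _ (stG_mono p a b τ (show n + m' ≤ n + m by omega) h)
      (Submodule.smul_mem _ c (stE_mem p a b τ (stI_add p hn h1) (show n + m' < n + m by omega)))
    simpa using this
  | zero => simp
  | add x y _ _ h1 h2 => rw [mul_add]; exact Submodule.add_mem _ h1 h2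
  | smul c x _ h => rw [mul_smul_comm]; exact Submodule.smul_mem _ _ h

variable {a} in
theorem stG_mul (ha : a ≠ 0) {n m : ℕ} {f g : StPt p a b τ → K} (hf : f ∈ stG p a b τ n)
    (hg : g ∈ stG p a b τ m) : f * g ∈ stG p a b τ (n + m) := by
  unfold stG at hf
  induction hf using Submodule.span_induction with
  | mem x h =>
    obtain ⟨m', ⟨h1, h2⟩, rfl⟩ := h
    exact stG_mono p a b τ (by omega) (stG_emul p b τ ha h1 hg)
  | zero => simp
  | add x y _ _ h1 h2 => rw [add_mul]; exact Submodule.add_mem _ h1 h2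
  | smul c x _ h => rw [smul_mul_assoc]; exact Submodule.smul_mem _ _ h

variable {a} in
theorem stLead_mul (ha : a ≠ 0) {n m : ℕ} (hn : stI p n) (hm : stI p m) {f g : StPt p a b τ → K}
    (hf : stLead p a b τ n f) (hg : stLead p a b τ m g) : stLead p a b τ (n + m) (f * g) := by
  obtain ⟨c, hc, hf⟩ := hf
  obtain ⟨d, hd, hg⟩ := hg
  obtain ⟨e, he, h⟩ := stE_mul p b τ ha hn hm
  refine ⟨c * d * e, by simp [*], ?_⟩
  set f0 := f - c • stE p a b τ n with hf0
  set g0 := g - d • stE p a b τ m with hg0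
  have : f * g - (c * d * e) • stE p a b τ (n + m) =
      (c * d) • (stE p a b τ n * stE p a b τ m - e • stE p a b τ (n + m))
      + c • (stE p a b τ n * g0) + d • (stE p a b τ m * f0) + f0 * g0 := by
    ext P; simp [hf0, hg0]; ring
  rw [this]
  refine Submodule.add_mem _ (Submodule.add_mem _ (Submodule.add_mem _ (Submodule.smul_mem _ _ h)
    (Submodule.smul_mem _ _ (stG_emul p b τ ha hn hg))) (Submodule.smul_mem _ _ ?_))
    (stG_mul p b τ ha hf hg)
  rw [add_comm n m]; exact stG_emul p b τ ha hm hf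

theorem stLead_e (n : ℕ) : stLead p a b τ n (stE p a b τ n) := ⟨1, one_ne_zero, by simp⟩

theorem stI_mul {n : ℕ} (hn : stI p n) (Q : ℕ) : stI p (Q * n) := by
  rcases hn with rfl | h
  · left; simp
  · rcases Nat.eq_zero_or_pos Q with rfl | hQ
    · left; simp
    · right; nlinarith

variable {a} in
theorem stLead_pow (ha : a ≠ 0) {n : ℕ} (hn : stI p n) (Q : ℕ) :
    stLead p a b τ (Q * n) (stE p a b τ n ^ Q) := by
  induction Q with
  | zero => simpa [stE_zero] using stLead_e p a b τ 0
  | succ Q ih =>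
    rw [pow_succ, add_mul, one_mul]
    exact stLead_mul p b τ ha (stI_mul p hn Q) hn ih (stLead_e p a b τ n)

theorem stLead_mem {n m : ℕ} (hn : stI p n) (h : n < m) {f : StPt p a b τ → K}
    (hf : stLead p a b τ n f) : f ∈ stG p a b τ m := by
  obtain ⟨c, -, hf⟩ := hf
  have := Submodule.add_mem _ (stG_mono p a b τ h.le hf)
    (Submodule.smul_mem _ c (stE_mem p a b τ hn h))
  simpa using this

theorem stLead_sum {ι : Type} [Fintype ι] (N : ι → ℕ) (hN : Function.Injective N)
    (hI : ∀ i, stI p (N i)) (g : ι → StPt p a b τ → K) (hg : ∀ i, stLead p a b τ (N i) (g i))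
    (c : ι → K) (hc : ∃ i, c i ≠ 0) :
    ∃ i, stLead p a b τ (N i) (∑ i, c i • g i) := by
  classical
  obtain ⟨i0, h0⟩ := hc
  obtain ⟨i, hi, hmax⟩ := Finset.exists_max_image (univ.filter fun i => c i ≠ 0) N
    ⟨i0, by simp [h0]⟩
  simp only [mem_filter, mem_univ, true_and] at hi hmax
  refine ⟨i, ?_⟩
  obtain ⟨d, hd, h⟩ := hg i
  refine ⟨c i * d, mul_ne_zero hi hd, ?_⟩
  rw [← Finset.add_sum_erase _ _ (mem_univ i)]
  have : c i • g i + ∑ x ∈ univ.erase i, c x • g x - (c i * d) • stE p a b τ (N i)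
    = c i • (g i - d • stE p a b τ (N i)) + ∑ x ∈ univ.erase i, c x • g x := by
    rw [smul_sub, smul_smul]; abel
  rw [this]
  refine Submodule.add_mem _ (Submodule.smul_mem _ _ h) (Submodule.sum_mem _ fun j hj => ?_)
  by_cases hcj : c j = 0
  · simp [hcj]
  · refine Submodule.smul_mem _ _ (stLead_mem p a b τ (hI j) ?_ (hg j))
    exact lt_of_le_of_ne (hmax j hcj) fun e => (Finset.ne_of_mem_erase hj) (hN e)

open Classical in
theorem stZero [Fintype K] {w : ℕ} (h : stLead p a b τ w 0) :
    p * #{x : K | x ≠ 0 ∧ ∃ y : K, y ^ p - y = a * x + b / x - τ} ≤ w := by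
  have hp0 : 0 < p := hp.out.pos
  obtain ⟨c, hc, h⟩ := h
  rw [zero_sub, neg_mem_iff, Submodule.smul_mem_iff _ hc] at h
  have hco : ∀ f ∈ stG p a b τ w, ∃ co : ℕ → K, f = ∑ m ∈ range w, co m • stE p a b τ m := by
    intro f hf
    unfold stG at hf
    induction hf using Submodule.span_induction with
    | mem x h =>
      obtain ⟨m, ⟨-, h2⟩, rfl⟩ := h
      exact ⟨fun j => if j = m then 1 else 0, by simp [h2]⟩
    | zero => exact ⟨0, by simp⟩
    | add x y _ _ h1 h2 =>
      obtain ⟨c1, rfl⟩ := h1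
      obtain ⟨c2, rfl⟩ := h2
      exact ⟨c1 + c2, by simp [add_smul, Finset.sum_add_distrib]⟩
    | smul c x _ h =>
      obtain ⟨c1, rfl⟩ := h
      exact ⟨c • c1, by simp [Finset.smul_sum, smul_smul]⟩
  obtain ⟨co, hco⟩ := hco _ h
  set S : Finset K := {x : K | x ≠ 0 ∧ ∃ y : K, y ^ p - y = a * x + b / x - τ} with hS
  set co' : ℕ → K := fun m => if m = w then 1 else - co m with hco'
  have hsum : ∀ P, ∑ m ∈ range (w + 1), co' m * stE p a b τ m P = 0 := by
    intro P
    rw [Finset.sum_range_succ]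
    have h1 := congrFun hco P
    simp only [Finset.sum_apply, Pi.smul_apply, smul_eq_mul] at h1
    rw [h1]
    simp only [hco', if_true, one_mul]
    rw [← Finset.sum_add_distrib]
    refine Finset.sum_eq_zero fun m hm => ?_
    rw [if_neg (by simp at hm; omega)]; ring
  let A : Polynomial K := ∑ m ∈ (range (w + 1)).filter (fun m => m % p = w % p),
    Polynomial.monomial (m / p) (co' m)
  have hAc : A.coeff (w / p) ≠ 0 := by
    simp only [A, Polynomial.finsetSum_coeff, Polynomial.coeff_monomial]
    rw [Finset.sum_eq_single w]
    · simp [hco']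
    · intro m hm hmw
      rw [if_neg]
      intro h
      simp only [mem_filter] at hm
      exact hmw (by rw [← Nat.div_add_mod m p, ← Nat.div_add_mod w p, h, hm.2])
    · simp
  have hA0 : A ≠ 0 := fun h => hAc (by simp [h])
  have hAd : A.natDegree ≤ w / p := by
    refine Polynomial.natDegree_sum_le_of_forall_le _ _ fun m hm => ?_
    refine (Polynomial.natDegree_monomial_le _).trans (Nat.div_le_div_right ?_)
    simp at hm; omega
  have hroot : S ⊆ A.roots.toFinset := by
    intro x hx
    rw [hS, mem_filter] at hx
    obtain ⟨-, hx0, y, hy⟩ := hx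
    let B : Polynomial K := ∑ m ∈ range (w + 1), Polynomial.monomial (m % p) (co' m * x ^ (m / p))
    have hB : B = 0 := by
      have hinj : Set.InjOn (fun t : ℕ => y + (t : K)) (range p : Set ℕ) := by
        intro s hs t ht h
        simp only [add_right_inj] at h
        exact CharP.natCast_injOn_Iio K p (by simpa using hs) (by simpa using ht) h
      refine Polynomial.eq_zero_of_natDegree_lt_card_of_eval_eq_zero' B
        ((range p).image fun t : ℕ => y + (t : K)) ?_ ?_
      · intro z hz
        obtain ⟨t, -, rfl⟩ := Finset.mem_image.1 hz
        have ht : (t : K) ^ p = t := by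
          have := map_natCast (frobenius K p) t
          rwa [frobenius_def] at this
        have := hsum ⟨(x, y + t), hx0, by
          simp only; rw [← hy, add_pow_char, ht]; ring⟩
        simp only [B, Polynomial.eval_finsetSum, Polynomial.eval_monomial]
        rw [← this]
        refine Finset.sum_congr rfl fun m _ => ?_
        simp only [stE]; ring
      · rw [Finset.card_image_of_injOn hinj, card_range]
        refine lt_of_le_of_lt (Polynomial.natDegree_sum_le_of_forall_le (n := p - 1) _ _
          fun m hm => (Polynomial.natDegree_monomial_le _).trans ?_) (by omega)
        have := Nat.mod_lt m hp0
        omega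
    have hc := congrArg (fun q => Polynomial.coeff q (w % p)) hB
    simp only [B, Polynomial.finsetSum_coeff, Polynomial.coeff_monomial, Polynomial.coeff_zero] at hc
    rw [Multiset.mem_toFinset, Polynomial.mem_roots hA0]
    simp only [Polynomial.IsRoot, A, Polynomial.eval_finsetSum, Polynomial.eval_monomial]
    rw [Finset.sum_filter]; exact hc
  have : #S ≤ w / p := (Finset.card_le_card hroot).trans
    ((Multiset.toFinset_card_le _).trans ((Polynomial.card_roots' _).trans hAd))
  calc p * #S ≤ p * (w / p) := Nat.mul_le_mul_left _ this
    _ ≤ w := Nat.mul_div_le _ _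

variable {a} in
open Classical in
theorem stepanov [Fintype K] (ha : a ≠ 0) (μ : ℕ) (hq : Fintype.card K = p ^ μ * p ^ μ)
    (hμ : 3 ≤ μ) :
    p * #{x : K | x ≠ 0 ∧ ∃ y : K, y ^ p - y = a * x + b / x - τ} ≤
      p ^ μ * p ^ μ + (2 * p + 1) * p ^ μ := by
  have hp2 : 2 ≤ p := hp.out.two_le
  set Q := p ^ μ with hQ
  have hQp : p * p * 2 ≤ Q := by
    calc p * p * 2 ≤ p * p * p := Nat.mul_le_mul_left _ hp2
      _ = p ^ 3 := by ring
      _ ≤ Q := Nat.pow_le_pow_right (by omega) hμ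
  have hppp : 2 * p ≤ p * p := Nat.mul_le_mul_right _ hp2
  set H := Q + 2 * p with hH
  let ι := {u : ℕ // u ∈ insert 0 (Finset.Ico p Q)} × {l : ℕ // l ∈ insert 0 (Finset.Ico p (H + 1))}
  have hI0 : ∀ n m, n ∈ insert 0 (Finset.Ico p m) → stI p n := by
    intro n m h
    simp only [Finset.mem_insert, Finset.mem_Ico] at h
    unfold stI; tauto
  have hcard : ∀ m, p ≤ m → #(insert 0 (Finset.Ico p m)) = m - p + 1 := by
    intro m hm
    rw [Finset.card_insert_of_notMem (by simp; omega), Nat.card_Ico]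
  let v : ι → StPt p a b τ → K := fun i => stE p a b τ i.1.1 ^ Q * stE p a b τ i.2.1
  set D := (Q - 1) * Q + H + 1 with hD
  have hv : ∀ i, v i ∈ stG p a b τ D := by
    intro i
    have hu := hI0 _ _ i.1.2
    have hl := hI0 _ _ i.2.2
    refine stLead_mem p a b τ (stI_add p (stI_mul p hu Q) hl) ?_
      (stLead_mul p b τ ha (stI_mul p hu Q) hl (stLead_pow p b τ ha hu Q) (stLead_e p a b τ _))
    have h1 : i.1.1 ≤ Q - 1 := by
      have := i.1.2; simp only [Finset.mem_insert, Finset.mem_Ico] at this; omega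
    have h2 : i.2.1 ≤ H := by
      have := i.2.2; simp only [Finset.mem_insert, Finset.mem_Ico] at this; omega
    have := Nat.mul_le_mul_left Q h1
    rw [hD, mul_comm (Q - 1)]; omega
  have hdep : ¬ LinearIndependent K v := by
    intro hli
    have hspan : stG p a b τ D = Submodule.span K
        (((insert 0 (Finset.Ico p D)).image (stE p a b τ) : Finset _) : Set (StPt p a b τ → K)) := by
      unfold stG
      congr 1
      ext f
      simp only [Set.mem_image, Set.mem_ofPred_eq, Finset.coe_image, Finset.coe_insert, stI,
        Set.mem_insert_iff, Finset.mem_coe, Finset.mem_Ico]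
      refine exists_congr fun x => and_congr_left fun _ => ?_
      constructor
      · rintro ⟨h | h, h'⟩
        · exact Or.inl h
        · exact Or.inr ⟨h, h'⟩
      · rintro (h | h)
        · exact ⟨Or.inl h, by omega⟩
        · exact ⟨Or.inr h.1, h.2⟩
    haveI : FiniteDimensional K (stG p a b τ D) := by
      rw [hspan]; infer_instance
    have hfr : Module.finrank K (stG p a b τ D) ≤ D - p + 1 := by
      rw [hspan]
      refine (finrank_span_finset_le_card _).trans (Finset.card_image_le.trans ?_)
      rw [hcard _ (by omega)]
    have hli' : LinearIndependent K (fun i => (⟨v i, hv i⟩ : stG p a b τ D)) :=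
      LinearIndependent.of_comp (stG p a b τ D).subtype hli
    have hc := hli'.fintype_card_le_finrank
    rw [Fintype.card_prod, Fintype.card_coe, Fintype.card_coe, hcard _ (by omega),
      hcard _ (by omega)] at hc
    have h3 := hc.trans hfr
    obtain ⟨r, hr⟩ : ∃ r, Q = p + r := ⟨Q - p, by omega⟩
    obtain ⟨s, hs⟩ : ∃ s, Q = s + 1 := ⟨Q - 1, by omega⟩
    have e1 : Q - p + 1 = r + 1 := by omega
    have e2 : H + 1 - p + 1 = r + 2 * p + 2 := by omega
    have e3 : D - p + 1 = (Q - 1) * Q + H + 2 - p := by omega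
    have e4 : (Q - 1) * Q = Q * Q - Q := by rw [Nat.sub_mul, one_mul]
    rw [e1, e2, e3, e4] at h3
    have hQQ : Q * Q = p * p + 2 * (p * r) + r * r := by rw [hr]; ring
    have e5 : (r + 1) * (r + 2 * p + 2) = r * r + 2 * (p * r) + 3 * r + 2 * p + 2 := by ring
    have : Q ≤ Q * Q := Nat.le_mul_self Q
    rw [e5] at h3
    omega
  rw [Fintype.not_linearIndependent_iff] at hdep
  obtain ⟨d, hd, i0, hi0⟩ := hdep
  have hQ0 : 0 < Q := by positivity
  let N : ι → ℕ := fun i => i.1.1 + Q * i.2.1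
  have hlt : ∀ i : ι, i.1.1 < Q := fun i => by
    have := i.1.2; simp only [Finset.mem_insert, Finset.mem_Ico] at this; omega
  have hN : Function.Injective N := by
    intro i j h
    simp only [N] at h
    have h1 : i.1.1 = j.1.1 := by
      have := congrArg (· % Q) h
      simpa [Nat.mod_eq_of_lt (hlt _)] using this
    have h2 : i.2.1 = j.2.1 := by
      rw [h1] at h
      exact Nat.eq_of_mul_eq_mul_left hQ0 (by omega)
    exact Prod.ext (Subtype.ext h1) (Subtype.ext h2)
  have hNI : ∀ i, stI p (N i) := fun i => stI_add p (hI0 _ _ i.1.2) (stI_mul p (hI0 _ _ i.2.2) Q)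
  obtain ⟨i, hi⟩ := stLead_sum p a b τ N hN hNI
    (fun i => stE p a b τ i.1.1 * stE p a b τ i.2.1 ^ Q)
    (fun i => stLead_mul p b τ ha (hI0 _ _ i.1.2) (stI_mul p (hI0 _ _ i.2.2) Q)
      (stLead_e p a b τ _) (stLead_pow p b τ ha (hI0 _ _ i.2.2) Q))
    (fun i => d i ^ Q) ⟨i0, pow_ne_zero _ hi0⟩
  have hz : ∑ i, d i ^ Q • (stE p a b τ i.1.1 * stE p a b τ i.2.1 ^ Q) = 0 := by
    ext P
    have hP := congrFun hd P
    simp only [Finset.sum_apply, Pi.smul_apply, smul_eq_mul, Pi.mul_apply, Pi.pow_apply,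
      Pi.zero_apply, v] at hP ⊢
    have hQQ : ∀ x : K, (x ^ Q) ^ Q = x := fun x => by
      rw [← pow_mul, ← hq, FiniteField.pow_card]
    refine eq_zero_of_pow_eq_zero (n := Q) ?_
    have hfr : ∀ g : ι → K, (∑ i, g i) ^ Q = ∑ i, g i ^ Q := fun g => sum_pow_char_pow _ _ _ _
    rw [hfr, ← hP]
    refine Finset.sum_congr rfl fun i _ => ?_
    rw [mul_pow, mul_pow, hQQ, hQQ]
  rw [hz] at hi
  refine (stZero p a b τ hi).trans ?_
  have h1 := hlt i
  have h2 : i.2.1 ≤ H := by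
    have := i.2.2; simp only [Finset.mem_insert, Finset.mem_Ico] at this; omega
  have h3 := Nat.mul_le_mul_left Q h2
  have h4 : Q * H = Q * Q + 2 * p * Q := by rw [hH]; ring
  have h5 : (2 * p + 1) * Q = 2 * p * Q + Q := by ring
  simp only [N]
  omega

end Stepanov

section ArtinSchreier
variable {K : Type} [Field K] (p : ℕ) [hp : Fact p.Prime] [Fintype K] [Algebra (ZMod p) K]

theorem trace_frob (y : K) : Algebra.trace (ZMod p) K (y ^ p) = Algebra.trace (ZMod p) K y := by
  haveI : CharP K p := charP_of_injective_algebraMap (algebraMap (ZMod p) K).injective p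
  haveI : Algebra.IsAlgebraic (ZMod p) K := inferInstance
  have := Algebra.trace_eq_of_algEquiv (FiniteField.frobeniusAlgEquivOfAlgebraic (ZMod p) K) y
  simpa [FiniteField.coe_frobeniusAlgEquivOfAlgebraic, ZMod.card] using this

theorem artin_schreier (z : K) (hz : Algebra.trace (ZMod p) K z = 0) : ∃ y : K, y ^ p - y = z := by
  classical
  haveI : CharP K p := charP_of_injective_algebraMap (algebraMap (ZMod p) K).injective p
  haveI : ExpChar K p := ExpChar.prime hp.out
  let L : K →+ K := (frobenius K p : K →+* K).toAddMonoidHom - AddMonoidHom.id K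
  have hL : ∀ y, L y = y ^ p - y := fun y => rfl
  let T : K →+ ZMod p := (Algebra.trace (ZMod p) K).toAddMonoidHom
  have hT : Function.Surjective T := Algebra.trace_surjective (ZMod p) K
  have h1 : Nat.card L.ker * Nat.card L.range = Nat.card K := by
    rw [← AddSubgroup.card_mul_index L.ker, AddSubgroup.index_ker];
  have h2 : Nat.card T.ker * p = Nat.card K := by
    rw [← AddSubgroup.card_mul_index T.ker, AddSubgroup.index_ker]
    congr 1
    rw [AddMonoidHom.range_eq_top.2 hT]
    simp
  have h3 : Nat.card L.ker ≤ p := by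
    have hne : (Polynomial.X ^ p - Polynomial.X : Polynomial K) ≠ 0 :=
      FiniteField.X_pow_card_sub_X_ne_zero K hp.out.one_lt
    have hd := FiniteField.X_pow_card_sub_X_natDegree_eq K hp.out.one_lt
    have : ((L.ker : Set K)) ⊆ ((Polynomial.X ^ p - Polynomial.X : Polynomial K).roots.toFinset : Set K) := by
      intro y hy
      have hy' : L y = 0 := hy
      rw [hL] at hy'
      simp [Polynomial.mem_roots hne, hy']
    have h4 := Set.ncard_le_ncard this (Finset.finite_toSet _)
    rw [Set.ncard_coe_finset] at h4
    have h5 := (Multiset.toFinset_card_le (Polynomial.X ^ p - Polynomial.X : Polynomial K).roots).trans (Polynomial.card_roots' _)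
    rw [hd] at h5
    exact (h4.trans h5)
  have hle : L.range ≤ T.ker := by
    rintro _ ⟨y, rfl⟩
    rw [AddMonoidHom.mem_ker, hL, map_sub]
    exact sub_eq_zero.2 (trace_frob p y)
  have hcard : Nat.card T.ker ≤ Nat.card L.range := by
    have : Nat.card T.ker * p ≤ Nat.card L.range * p := by
      rw [h2, ← h1, mul_comm]; exact Nat.mul_le_mul_left _ h3
    exact Nat.le_of_mul_le_mul_right this hp.out.pos
  have := AddSubgroup.eq_of_le_of_card_ge hle hcard
  have hz' : z ∈ T.ker := hz
  rw [← this] at hz'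
  obtain ⟨y, hy⟩ := hz'
  exact ⟨y, by rw [← hL, hy]⟩

/-- Kloosterman sum over the finite field `K`. -/
noncomputable def klK (K : Type) [Field K] [Fintype K] [Algebra (ZMod p) K] (a b : K) : ℂ :=
  open Classical in
  ∑ x ∈ univ.filter (fun x : K => x ≠ 0), ZMod.stdAddChar (Algebra.trace (ZMod p) K (a * x + b / x))

theorem klK_bound {a : K} (b : K) (ha : a ≠ 0) (μ : ℕ) (hq : Fintype.card K = p ^ μ * p ^ μ) (hμ : 3 ≤ μ) :
    ‖klK p K a b‖ ≤ (2 * p + 1) * (p : ℝ) ^ μ + 1 := by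
  classical
  haveI : CharP K p := charP_of_injective_algebraMap (algebraMap (ZMod p) K).injective p
  set M : ZMod p → ℕ := fun t => #{x : K | x ≠ 0 ∧ Algebra.trace (ZMod p) K (a * x + b / x) = t} with hM
  have hMb : ∀ t, p * M t ≤ p ^ μ * p ^ μ + (2 * p + 1) * p ^ μ := by
    intro t
    obtain ⟨τ, hτ⟩ := Algebra.trace_surjective (ZMod p) K t
    refine le_trans (Nat.mul_le_mul_left p ?_) (stepanov p b τ ha μ hq hμ)
    refine card_le_card fun x hx => ?_
    simp only [mem_filter, mem_univ, true_and] at hx ⊢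
    refine ⟨hx.1, artin_schreier p _ ?_⟩
    rw [map_sub, hx.2, hτ, sub_self]
  have hS : klK p K a b = ∑ t : ZMod p, (M t : ℂ) * ZMod.stdAddChar t := by
    unfold klK
    rw [← Finset.sum_fiberwise _ (fun x => Algebra.trace (ZMod p) K (a * x + b / x))]
    refine Finset.sum_congr rfl fun t _ => ?_
    rw [Finset.sum_congr rfl (g := fun _ => ZMod.stdAddChar t), Finset.sum_const, nsmul_eq_mul, Finset.filter_filter]
    intro x hx
    rw [(mem_filter.1 hx).2]
  have hsum : ∑ t : ZMod p, M t = p ^ μ * p ^ μ - 1 := by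
    have h1 : #{x : K | x ≠ 0} = p ^ μ * p ^ μ - 1 := by
      rw [← hq, Finset.filter_ne', Finset.card_erase_of_mem (mem_univ _), Finset.card_univ]
    rw [← h1, Finset.card_eq_sum_card_fiberwise (f := fun x => Algebra.trace (ZMod p) K (a * x + b / x)) (t := univ) (fun _ _ => mem_coe.2 (mem_univ _))]
    refine Finset.sum_congr rfl fun t _ => ?_
    rw [Finset.filter_filter]
  have hpsi : ∑ t : ZMod p, (ZMod.stdAddChar t : ℂ) = 0 := by
    refine AddChar.sum_eq_zero_of_ne_one ?_
    intro h
    have := (ZMod.isPrimitive_stdAddChar p) one_ne_zero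
    apply this
    rw [h]; ext; simp [AddChar.mulShift_apply]
  set B : ℝ := ((p:ℝ) ^ μ * p ^ μ + (2 * p + 1) * p ^ μ) / p with hB
  have hp0 : (0:ℝ) < p := by exact_mod_cast hp.out.pos
  have hMB : ∀ t, (M t : ℝ) ≤ B := fun t => by
    rw [hB, le_div_iff₀ hp0]
    have := hMb t
    have h2 : (p:ℝ) * M t ≤ (p:ℝ) ^ μ * p ^ μ + (2 * p + 1) * p ^ μ := by exact_mod_cast this
    linarith
  have hS2 : klK p K a b = ∑ t : ZMod p, ((M t - B : ℝ) : ℂ) * ZMod.stdAddChar t := by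
    rw [hS]
    simp only [Complex.ofReal_sub, sub_mul, Finset.sum_sub_distrib]
    rw [← Finset.mul_sum, hpsi, mul_zero, sub_zero]
    simp
  rw [hS2]
  refine (norm_sum_le _ _).trans ?_
  have : ∀ t : ZMod p, ‖((M t - B : ℝ) : ℂ) * ZMod.stdAddChar t‖ = B - M t := by
    intro t
    rw [norm_mul, AddChar.norm_apply, mul_one, Complex.norm_real, Real.norm_eq_abs, abs_of_nonpos (by linarith [hMB t])]
    ring
  simp only [this]
  rw [Finset.sum_sub_distrib, Finset.sum_const, Finset.card_univ, ZMod.card, nsmul_eq_mul]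
  have h3 : (∑ t : ZMod p, (M t : ℝ)) = (p:ℝ) ^ μ * p ^ μ - 1 := by
    have : 1 ≤ p ^ μ * p ^ μ := Nat.succ_le_of_lt (by have := hp.out.pos; positivity)
    rw [← Nat.cast_sum, hsum, Nat.cast_sub this]; push_cast; ring
  rw [h3, hB]
  field_simp
  linarith
end ArtinSchreier

section KlLam
open Polynomial
variable (p : ℕ) [hp : Fact p.Prime] (a b : ZMod p)

noncomputable def klLam (h : (ZMod p)[X]) : ℂ :=
  if h.coeff 0 = 0 then 0 else ZMod.stdAddChar (-(a * h.nextCoeff) - b * (h.coeff 1 / h.coeff 0))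

variable {K : Type} [Field K] [Fintype K] [Algebra (ZMod p) K]

theorem nextCoeff_minpoly_inv (x : K) (hx : x ≠ 0) :
    (minpoly (ZMod p) x⁻¹).nextCoeff = (minpoly (ZMod p) x).coeff 1 / (minpoly (ZMod p) x).coeff 0 := by
  have hint : IsIntegral (ZMod p) x := .of_finite _ x
  have hint' : IsIntegral (ZMod p) x⁻¹ := .of_finite _ x⁻¹
  set P := minpoly (ZMod p) x with hP
  have hP0 : P.coeff 0 ≠ 0 := minpoly.coeff_zero_ne_zero hint hx
  have hPm : P.Monic := minpoly.monic hint
  have hn : 0 < P.natDegree := minpoly.natDegree_pos hint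
  have htr : P.natTrailingDegree = 0 := by
    rw [natTrailingDegree_eq_zero]; right; exact hP0
  have hrd : P.reverse.natDegree = P.natDegree := by rw [reverse_natDegree, htr]; simp
  set Q := C (P.coeff 0)⁻¹ * P.reverse with hQ
  have hQm : Q.Monic := by
    rw [Monic, hQ, leadingCoeff_mul, leadingCoeff_C, reverse_leadingCoeff, trailingCoeff, htr, inv_mul_cancel₀ hP0]
  have hQd : Q.natDegree = P.natDegree := by
    rw [hQ, natDegree_C_mul (inv_ne_zero hP0), hrd]
  have hroot : aeval x⁻¹ Q = 0 := by
    rw [hQ, map_mul]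
    have : eval₂ (algebraMap (ZMod p) K) (⅟ (Units.mk0 x hx : K)) (reverse P) = 0 := by
      rw [eval₂_reverse_eq_zero_iff]; exact minpoly.aeval _ x
    rw [invOf_eq_inv] at this
    rw [aeval_def x⁻¹ P.reverse]
    simp only [Units.val_mk0] at this
    rw [this, mul_zero]
  have hdeg : (minpoly (ZMod p) x⁻¹).natDegree = P.natDegree := by
    rw [hP, ← IntermediateField.adjoin.finrank hint, ← IntermediateField.adjoin.finrank (.of_finite _ x⁻¹)]
    have : IntermediateField.adjoin (ZMod p) {x⁻¹} = IntermediateField.adjoin (ZMod p) {x} := by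
      apply le_antisymm
      · rw [IntermediateField.adjoin_simple_le_iff]
        exact inv_mem (IntermediateField.mem_adjoin_simple_self _ x)
      · rw [IntermediateField.adjoin_simple_le_iff]
        have := inv_mem (IntermediateField.mem_adjoin_simple_self (ZMod p) x⁻¹)
        rwa [inv_inv] at this
    rw [this]
  have hmin : minpoly (ZMod p) x⁻¹ = Q := by
    symm
    refine minpoly.unique_of_degree_le_degree_minpoly _ _ hQm hroot ?_
    rw [degree_eq_natDegree hQm.ne_zero, degree_eq_natDegree (minpoly.ne_zero hint'), hdeg, hQd]
  rw [hmin, nextCoeff_of_natDegree_pos (by omega), hQd, hQ, coeff_C_mul, coeff_reverse, revAt_le (by omega)]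
  have : P.natDegree - (P.natDegree - 1) = 1 := by omega
  rw [this, div_eq_inv_mul]

theorem klLam_minpoly (x : K) (hx : x ≠ 0) :
    (ZMod.stdAddChar (Algebra.trace (ZMod p) K (algebraMap _ K a * x + algebraMap _ K b / x)) : ℂ)
      = klLam p a b (minpoly (ZMod p) x) ^ (Module.finrank (ZMod p) K / (minpoly (ZMod p) x).natDegree) := by
  have hint : IsIntegral (ZMod p) x := .of_finite _ x
  have hint' : IsIntegral (ZMod p) x⁻¹ := .of_finite _ x⁻¹
  have hP0 : (minpoly (ZMod p) x).coeff 0 ≠ 0 := minpoly.coeff_zero_ne_zero hint hx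
  have hadj : IntermediateField.adjoin (ZMod p) {x⁻¹} = IntermediateField.adjoin (ZMod p) {x} := by
      apply le_antisymm
      · rw [IntermediateField.adjoin_simple_le_iff]
        exact inv_mem (IntermediateField.mem_adjoin_simple_self _ x)
      · rw [IntermediateField.adjoin_simple_le_iff]
        have := inv_mem (IntermediateField.mem_adjoin_simple_self (ZMod p) x⁻¹)
        rwa [inv_inv] at this
  have hfin : Module.finrank (IntermediateField.adjoin (ZMod p) {x}) K =
      Module.finrank (ZMod p) K / (minpoly (ZMod p) x).natDegree := by
    rw [← IntermediateField.adjoin.finrank hint, ← Module.finrank_mul_finrank (ZMod p) (IntermediateField.adjoin (ZMod p) {x}) K,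
      Nat.mul_div_cancel_left _ Module.finrank_pos]
  rw [← hfin]
  rw [div_eq_mul_inv, map_add, ← Algebra.smul_def, ← Algebra.smul_def, map_smul, map_smul,
    trace_eq_finrank_mul_minpoly_nextCoeff, trace_eq_finrank_mul_minpoly_nextCoeff (ZMod p) x⁻¹, hadj,
    nextCoeff_minpoly_inv p x hx, klLam, if_neg hP0, ← AddChar.map_nsmul_eq_pow]
  congr 1
  simp only [smul_eq_mul, nsmul_eq_mul]
  ring
end KlLam

section MonPoly
open Polynomial
variable (p : ℕ) [hp : Fact p.Prime]

theorem monFin (d : ℕ) : {h : (ZMod p)[X] | h.Monic ∧ h.natDegree = d}.Finite := by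
  have : Finite (degreeLT (ZMod p) d) := Finite.of_equiv _ (degreeLTEquiv (ZMod p) d).symm.toEquiv
  exact Finite.of_equiv _ (monicEquivDegreeLT (R := ZMod p) d).symm

noncomputable def Mon (d : ℕ) : Finset (ZMod p)[X] := (monFin p d).toFinset

theorem mem_Mon {d : ℕ} {h : (ZMod p)[X]} : h ∈ Mon p d ↔ h.Monic ∧ h.natDegree = d := by
  simp [Mon]

open Classical in
noncomputable def Irr (d : ℕ) : Finset (ZMod p)[X] := (Mon p d).filter Irreducible

theorem mem_Irr {d : ℕ} {h : (ZMod p)[X]} : h ∈ Irr p d ↔ (h.Monic ∧ h.natDegree = d) ∧ Irreducible h := by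
  simp [Irr, mem_Mon]

open Classical in
theorem mangoldt {d N : ℕ} (hN : d ≤ N) {h : (ZMod p)[X]} (hh : h ∈ Mon p d) :
    ∑ e ∈ Icc 1 N, ∑ P ∈ Irr p e, ∑ m ∈ Icc 1 N, (if P ^ m ∣ h then e else 0) = d := by
  rw [mem_Mon] at hh
  obtain ⟨hm, hd⟩ := hh
  have h0 : h ≠ 0 := hm.ne_zero
  set s := UniqueFactorizationMonoid.normalizedFactors h with hs
  have hsm : ∀ P ∈ s, P.Monic := fun P hP => by
    have := UniqueFactorizationMonoid.normalize_normalized_factor P hP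
    rw [← this]
    exact monic_normalize (UniqueFactorizationMonoid.irreducible_of_normalized_factor P hP).ne_zero
  have hprod : s.prod = h := by
    have := UniqueFactorizationMonoid.prod_normalizedFactors_eq h0
    rw [this, hm.normalize_eq_self]
  have hdeg : d = (s.map natDegree).sum := by
    rw [← hd, ← hprod, natDegree_multiset_prod_of_monic _ hsm]
  have hcount : ∀ P : (ZMod p)[X], P.Monic → Irreducible P → ∀ m, P ^ m ∣ h ↔ m ≤ s.count P := by
    intro P hP hi m
    have h1 := UniqueFactorizationMonoid.emultiplicity_eq_count_normalizedFactors hi h0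
    rw [hP.normalize_eq_self] at h1
    rw [pow_dvd_iff_le_emultiplicity, h1]
    exact_mod_cast Iff.rfl
  have hinner : ∀ e ∈ Icc 1 N, ∀ P ∈ Irr p e, ∑ m ∈ Icc 1 N, (if P ^ m ∣ h then e else 0) = s.count P * e := by
    intro e he P hP
    rw [mem_Irr] at hP
    have hle : s.count P ≤ N := by
      have h1 : P ^ (s.count P) ∣ h := (hcount P hP.1.1 hP.2 _).2 le_rfl
      have h2 := natDegree_le_of_dvd h1 h0
      rw [natDegree_pow, hP.1.2, hd] at h2
      have h3 : 1 ≤ e := (mem_Icc.1 he).1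
      nlinarith
    rw [← Finset.sum_filter, Finset.sum_const, smul_eq_mul]
    congr 1
    have : (Icc 1 N).filter (fun m => P ^ m ∣ h) = Icc 1 (s.count P) := by
      ext m; simp only [mem_filter, mem_Icc, hcount P hP.1.1 hP.2]; omega
    rw [this]; simp
  rw [Finset.sum_congr rfl fun e he => Finset.sum_congr rfl fun P hP => hinner e he P hP]
  rw [hdeg, Finset.sum_multiset_map_count]
  have hfib : ∀ P ∈ s.toFinset, P.natDegree ∈ Icc 1 N := by
    intro P hP
    rw [Multiset.mem_toFinset] at hP
    have hi := UniqueFactorizationMonoid.irreducible_of_normalized_factor P hP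
    have h2 := natDegree_le_of_dvd (UniqueFactorizationMonoid.dvd_of_mem_normalizedFactors hP) h0
    rw [mem_Icc]
    exact ⟨hi.natDegree_pos, by omega⟩
  rw [← Finset.sum_fiberwise_of_maps_to hfib]
  refine Finset.sum_congr rfl fun e he => ?_
  symm
  refine Finset.sum_subset_zero_on_sdiff ?_ ?_ ?_
  · intro P hP
    rw [mem_filter, Multiset.mem_toFinset] at hP
    rw [mem_Irr]
    exact ⟨⟨hsm P hP.1, hP.2⟩, UniqueFactorizationMonoid.irreducible_of_normalized_factor P hP.1⟩
  · intro P hP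
    rw [mem_sdiff, mem_Irr, mem_filter, Multiset.mem_toFinset] at hP
    have : P ∉ s := fun h => hP.2 ⟨h, hP.1.1.2⟩
    rw [Multiset.count_eq_zero_of_notMem this, zero_mul]
  · intro P hP
    rw [mem_filter] at hP
    rw [hP.2, smul_eq_mul]

variable (a b : ZMod p)

theorem klLam_mul {g h : (ZMod p)[X]} (hg : g.Monic) (hh : h.Monic) :
    klLam p a b (g * h) = klLam p a b g * klLam p a b h := by
  unfold klLam
  rw [mul_coeff_zero]
  by_cases h1 : g.coeff 0 = 0
  · simp [h1]
  by_cases h2 : h.coeff 0 = 0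
  · simp [h2]
  rw [if_neg h1, if_neg h2, if_neg (mul_ne_zero h1 h2), ← AddChar.map_add_eq_mul, hg.nextCoeff_mul hh, mul_coeff_one]
  congr 1
  field_simp
  ring

theorem klLam_pow {g : (ZMod p)[X]} (hg : g.Monic) (m : ℕ) :
    klLam p a b (g ^ m) = klLam p a b g ^ m := by
  induction m with
  | zero => simp [klLam, coeff_one, nextCoeff, natDegree_one]
  | succ n ih => rw [pow_succ, klLam_mul p a b (hg.pow n) hg, ih, pow_succ]

noncomputable def klW (d : ℕ) : ℂ := ∑ h ∈ Mon p d, klLam p a b h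

open Classical in
theorem klW_dvd {d : ℕ} {g : (ZMod p)[X]} (hg : g.Monic) :
    ∑ h ∈ (Mon p d).filter (fun h => g ∣ h), klLam p a b h =
      if g.natDegree ≤ d then klLam p a b g * klW p a b (d - g.natDegree) else 0 := by
  split_ifs with hd
  · rw [klW, Finset.mul_sum]
    symm
    refine Finset.sum_bij (fun h _ => g * h) ?_ ?_ ?_ ?_
    · intro h hh
      rw [mem_Mon] at hh
      rw [mem_filter, mem_Mon, hg.natDegree_mul hh.1]
      exact ⟨⟨hg.mul hh.1, by omega⟩, dvd_mul_right _ _⟩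
    · intro h1 _ h2 _ h
      exact mul_left_cancel₀ hg.ne_zero h
    · intro h hh
      rw [mem_filter, mem_Mon] at hh
      obtain ⟨⟨h1, h2⟩, ⟨f, rfl⟩⟩ := hh
      have hf : f.Monic := hg.of_mul_monic_left h1
      refine ⟨f, ?_, rfl⟩
      rw [mem_Mon]
      rw [hg.natDegree_mul hf] at h2
      exact ⟨hf, by omega⟩
    · intro h hh
      rw [mem_Mon] at hh
      exact (klLam_mul p a b hg hh.1).symm
  · refine Finset.sum_eq_zero fun h hh => ?_
    rw [mem_filter, mem_Mon] at hh
    exact absurd (hh.1.2 ▸ natDegree_le_of_dvd hh.2 hh.1.1.ne_zero) hd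

noncomputable def klSN (N j : ℕ) : ℂ :=
  ∑ e ∈ Icc 1 N, ∑ P ∈ Irr p e, ∑ m ∈ Icc 1 N, (if e * m = j then e * klLam p a b P ^ m else 0)

theorem klW_rec {d N : ℕ} (hN : d ≤ N) :
    (d : ℂ) * klW p a b d = ∑ j ∈ Icc 1 d, klSN p a b N j * klW p a b (d - j) := by
  classical
  have h1 : (d : ℂ) * klW p a b d = ∑ e ∈ Icc 1 N, ∑ P ∈ Irr p e, ∑ m ∈ Icc 1 N,
      (if e * m ≤ d then e * klLam p a b P ^ m * klW p a b (d - e * m) else 0) := by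
    rw [klW, Finset.mul_sum]
    have : ∀ h ∈ Mon p d, (d : ℂ) * klLam p a b h =
        ∑ e ∈ Icc 1 N, ∑ P ∈ Irr p e, ∑ m ∈ Icc 1 N, (if P ^ m ∣ h then e * klLam p a b h else 0) := by
      intro h hh
      conv_lhs => rw [← mangoldt p hN hh]
      push_cast
      simp only [Finset.sum_mul, ite_mul, zero_mul]
    rw [Finset.sum_congr rfl this, Finset.sum_comm]
    refine Finset.sum_congr rfl fun e _ => ?_
    rw [Finset.sum_comm]
    refine Finset.sum_congr rfl fun P hP => ?_
    rw [Finset.sum_comm]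
    refine Finset.sum_congr rfl fun m _ => ?_
    rw [mem_Irr] at hP
    rw [← Finset.sum_filter, ← Finset.mul_sum, klW_dvd p a b (hP.1.1.pow m), natDegree_pow, hP.1.2,
      klLam_pow p a b hP.1.1, mul_comm m e, mul_ite, mul_zero, mul_assoc]
  rw [h1]
  simp only [klSN, Finset.sum_mul]
  symm
  rw [Finset.sum_comm]
  refine Finset.sum_congr rfl fun e he => ?_
  rw [Finset.sum_comm]
  refine Finset.sum_congr rfl fun P hP => ?_
  rw [Finset.sum_comm]
  refine Finset.sum_congr rfl fun m hm => ?_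
  simp only [ite_mul, zero_mul]
  rw [Finset.sum_ite_eq (Icc 1 d) (e*m)]
  have : 1 ≤ e * m := Nat.mul_pos (mem_Icc.1 he).1 (mem_Icc.1 hm).1
  simp only [mem_Icc, this, true_and]

end MonPoly

section WeilKl
open Polynomial
variable (p : ℕ) [hp : Fact p.Prime] (a b : ZMod p)

open Classical in
theorem card_minpoly_fiber {K : Type} [Field K] [Fintype K] [Algebra (ZMod p) K] {e : ℕ} {P : (ZMod p)[X]}
    (hP : P ∈ Irr p e) :
    #{x : K | minpoly (ZMod p) x = P} = if e ∣ Module.finrank (ZMod p) K then e else 0 := by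
  rw [mem_Irr] at hP
  obtain ⟨⟨hm, hd⟩, hi⟩ := hP
  have hint : ∀ x : K, IsIntegral (ZMod p) x := fun x => .of_finite _ x
  split_ifs with h
  · have h1 : P ∣ X ^ (Nat.card K) - X := by
      have := hi.natDegree_dvd_iff_dvd_X_pow_card_pow_sub_X (n := Module.finrank (ZMod p) K)
      rw [hd] at this
      have h2 := this.1 h
      rwa [Nat.card_zmod, FiniteField.pow_finrank_eq_natCard] at h2
    have hne : (X ^ (Nat.card K) - X : (ZMod p)[X]) ≠ 0 :=
      FiniteField.X_pow_card_sub_X_ne_zero _ (Finite.one_lt_card)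
    have hsp : Splits (P.map (algebraMap (ZMod p) K)) := by
      refine Splits.of_dvd (g := (X ^ (Nat.card K) - X : (ZMod p)[X]).map (algebraMap (ZMod p) K)) ?_ ?_ ?_
      · have := FiniteField.isSplittingField_sub K (ZMod p)
        rw [← Nat.card_eq_fintype_card] at this
        exact this.splits
      · exact (Polynomial.map_ne_zero_iff (algebraMap (ZMod p) K).injective).2 hne
      · exact Polynomial.map_dvd _ h1
    have hcard := card_rootSet_eq_natDegree (K := K) (PerfectField.separable_of_irreducible hi) hsp
    rw [← hd, ← hcard, ← Set.toFinset_card]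
    congr 1
    ext x
    simp only [mem_filter, mem_univ, true_and, Set.mem_toFinset, mem_rootSet, ne_eq, hm.ne_zero, not_false_iff]
    constructor
    · rintro rfl; exact minpoly.aeval _ x
    · intro h3; exact (minpoly.eq_of_irreducible_of_monic hi h3 hm).symm
  · rw [Finset.card_eq_zero, Finset.filter_eq_empty_iff]
    rintro x - rfl
    exact h (hd ▸ minpoly.degree_dvd (hint x))

theorem klSN_eq {K : Type} [Field K] [Fintype K] [Algebra (ZMod p) K] {N j : ℕ} (hj : 1 ≤ j) (hN : j ≤ N)
    (hK : Module.finrank (ZMod p) K = j) :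
    klSN p a b N j = klK p K (algebraMap _ K a) (algebraMap _ K b) := by
  classical
  have hint : ∀ x : K, IsIntegral (ZMod p) x := fun x => .of_finite _ x
  have h1 : klK p K (algebraMap _ K a) (algebraMap _ K b) =
      ∑ x : K, klLam p a b (minpoly (ZMod p) x) ^ (j / (minpoly (ZMod p) x).natDegree) := by
    unfold klK
    rw [Finset.sum_filter]
    refine Finset.sum_congr rfl fun x _ => ?_
    split_ifs with hx
    · rw [klLam_minpoly p a b x hx, hK]
    · push Not at hx
      subst hx
      rw [minpoly.zero, natDegree_X, Nat.div_one]
      simp only [klLam, coeff_X_zero, if_true]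
      rw [zero_pow (by omega)]
  rw [h1]
  have hfib : ∀ x ∈ (univ : Finset K), (⟨(minpoly (ZMod p) x).natDegree, minpoly (ZMod p) x⟩ : Σ _ : ℕ, (ZMod p)[X]) ∈
      (Icc 1 N).sigma (Irr p) := by
    intro x _
    rw [mem_sigma, mem_Irr, mem_Icc]
    have h2 := minpoly.degree_dvd (hint x)
    rw [hK] at h2
    exact ⟨⟨minpoly.natDegree_pos (hint x), (Nat.le_of_dvd hj h2).trans hN⟩, ⟨minpoly.monic (hint x), rfl⟩, minpoly.irreducible (hint x)⟩
  rw [← Finset.sum_fiberwise_of_maps_to hfib, Finset.sum_sigma, klSN]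
  refine Finset.sum_congr rfl fun e he => Finset.sum_congr rfl fun P hP => ?_
  have hP' := (mem_Irr p).1 hP
  have : (univ.filter fun x : K => (⟨(minpoly (ZMod p) x).natDegree, minpoly (ZMod p) x⟩ : Σ _ : ℕ, (ZMod p)[X]) = ⟨e, P⟩)
      = univ.filter fun x : K => minpoly (ZMod p) x = P := by
    ext x
    simp only [mem_filter, mem_univ, true_and, Sigma.mk.injEq, heq_eq_eq]
    constructor
    · exact fun h => h.2
    · intro h; exact ⟨by rw [h, hP'.1.2], h⟩
  have hc : ∀ x ∈ univ.filter (fun x : K => minpoly (ZMod p) x = P),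
      klLam p a b (minpoly (ZMod p) x) ^ (j / (minpoly (ZMod p) x).natDegree) = klLam p a b P ^ (j / e) := by
    intro x hx
    rw [mem_filter] at hx
    rw [hx.2, hP'.1.2]
  rw [this, Finset.sum_congr rfl hc, Finset.sum_const, card_minpoly_fiber p hP, hK]
  · have he1 := (mem_Icc.1 he).1
    by_cases h : e ∣ j
    · rw [if_pos h, nsmul_eq_mul]
      obtain ⟨m, rfl⟩ := h
      rw [Nat.mul_div_cancel_left _ he1, Finset.sum_eq_single m]
      · simp
      · intro m' _ hne
        rw [if_neg]
        intro h; exact hne (Nat.eq_of_mul_eq_mul_left he1 h)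
      · intro hm
        exfalso; apply hm
        rw [mem_Icc]
        refine ⟨Nat.pos_of_mul_pos_left hj, ?_⟩
        nlinarith
    · rw [if_neg h, zero_smul]
      refine Finset.sum_eq_zero fun m _ => ?_
      rw [if_neg]
      rintro rfl; exact h (dvd_mul_right _ _)

theorem klW_zero : klW p a b 0 = 1 := by
  have : Mon p 0 = {1} := by
    ext h
    rw [mem_Mon, mem_singleton]
    constructor
    · rintro ⟨h1, h2⟩; exact h1.natDegree_eq_zero.1 h2
    · rintro rfl; simp
  rw [klW, this]
  simp [klLam, coeff_one, nextCoeff]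

theorem psi_ne_one {t : ZMod p} (ht : t ≠ 0) : (ZMod.stdAddChar t : ℂ) ≠ 1 := by
  intro h
  apply ht
  apply ZMod.injective_stdAddChar (N := p)
  rw [h]; simp

theorem klW_ge_three (ha : a ≠ 0) {d : ℕ} (hd : 3 ≤ d) : klW p a b d = 0 := by
  have key : klW p a b d = ZMod.stdAddChar (-a) * klW p a b d := by
    conv_rhs => rw [klW, Finset.mul_sum]
    rw [klW]
    symm
    have hdeg : ∀ h : (ZMod p)[X], h.Monic ∧ h.natDegree = d → ∀ c : ZMod p, (C c * X ^ (d - 1)).degree < h.degree := by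
      intro h hh c
      rw [degree_eq_natDegree hh.1.ne_zero, hh.2]
      refine (degree_C_mul_X_pow_le _ _).trans_lt ?_
      exact_mod_cast (by omega : d - 1 < d)
    have hmem : ∀ h : (ZMod p)[X], h ∈ Mon p d → ∀ c : ZMod p, h + C c * X ^ (d - 1) ∈ Mon p d := by
      intro h hh c
      rw [mem_Mon] at hh ⊢
      refine ⟨hh.1.add_of_left (hdeg h hh c), ?_⟩
      rw [natDegree_add_eq_left_of_degree_lt (hdeg h hh c), hh.2]
    refine Finset.sum_bij' (fun h _ => h + C 1 * X ^ (d - 1)) (fun h _ => h + C (-1) * X ^ (d - 1)) ?_ ?_ ?_ ?_ ?_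
    · intro h hh; exact hmem h hh _
    · intro h hh; exact hmem h hh _
    · intro h hh; simp
    · intro h hh; simp
    · intro h hh
      have h2 := (mem_Mon p).1 (hmem h hh 1)
      rw [mem_Mon] at hh
      unfold klLam
      rw [nextCoeff_of_natDegree_pos (by omega), nextCoeff_of_natDegree_pos (by omega), h2.2, hh.2]
      simp only [coeff_add, coeff_C_mul, coeff_X_pow]
      rw [if_neg (by omega : ¬ 0 = d - 1), if_neg (by omega : ¬ 1 = d - 1)]
      simp only [mul_zero, add_zero, if_true, mul_ite, mul_one]
      split_ifs with h3
      · rfl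
      · rw [← AddChar.map_add_eq_mul]; congr 1; ring
  have h1 := psi_ne_one p (neg_ne_zero.2 ha)
  have : (1 - ZMod.stdAddChar (-a)) * klW p a b d = 0 := by linear_combination key
  rcases mul_eq_zero.1 this with h | h
  · exact absurd (sub_eq_zero.1 h).symm h1
  · exact h

theorem klW_two (ha : a ≠ 0) (hb : b ≠ 0) : klW p a b 2 = p := by
  classical
  have h1 : klW p a b 2 = ∑ v : ZMod p, ∑ u : ZMod p, klLam p a b (C 1 * X ^ 2 + C u * X + C v) := by
    rw [klW, ← Finset.sum_product']
    symm
    have hdeg : ∀ u v : ZMod p, (C 1 * X ^ 2 + C u * X + C v).natDegree = 2 := fun u v => natDegree_quadratic one_ne_zero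
    refine Finset.sum_bij (fun (x : ZMod p × ZMod p) _ => C 1 * X ^ 2 + C x.2 * X + C x.1) ?_ ?_ ?_ ?_
    · intro x _
      rw [mem_Mon]
      exact ⟨by rw [Monic, leadingCoeff_quadratic one_ne_zero], hdeg _ _⟩
    · intro x _ y _ h
      have h0 := congrArg (fun f => coeff f 0) h
      have h1 := congrArg (fun f => coeff f 1) h
      simp [coeff_X_pow, coeff_X, coeff_C] at h0 h1
      exact Prod.ext h0 h1
    · intro h hh
      rw [mem_Mon] at hh
      refine ⟨(h.coeff 0, h.coeff 1), by simp, ?_⟩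
      have h3 := as_sum_range_C_mul_X_pow h
      rw [hh.2] at h3
      have h4 : h.coeff 2 = 1 := by rw [← hh.2]; exact hh.1
      simp only [Finset.sum_range_succ, Finset.sum_range_zero, h4] at h3
      rw [h3]; simp [coeff_X_pow, coeff_X, coeff_C]; ring
    · intro x _; rfl
  rw [h1]
  have h2 : ∀ v : ZMod p, ∑ u : ZMod p, klLam p a b (C 1 * X ^ 2 + C u * X + C v) =
      if v = -b / a then (p : ℂ) else 0 := by
    intro v
    have h3 : ∀ u : ZMod p, klLam p a b (C 1 * X ^ 2 + C u * X + C v) =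
        if v = 0 then 0 else ZMod.stdAddChar (u * (-(a + b / v))) := by
      intro u
      unfold klLam
      rw [nextCoeff_of_natDegree_pos (by rw [natDegree_quadratic one_ne_zero]; norm_num), natDegree_quadratic one_ne_zero]
      have c0 : (C 1 * X ^ 2 + C u * X + C v).coeff 0 = v := by simp
      have c1 : (C 1 * X ^ 2 + C u * X + C v).coeff 1 = u := by simp [coeff_X_pow, coeff_X, coeff_C]
      rw [c0, c1]
      split_ifs
      · rfl
      · congr 1; ring
    simp only [h3]
    by_cases hv : v = 0
    · have : ¬ (v = -b / a) := by
        rw [hv]; intro h; symm at h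
        rw [div_eq_zero_iff, neg_eq_zero] at h; tauto
      simp [hv, this]
      intro h; exact absurd h.symm (by rw [hv] at this; exact fun h => this h.symm)
    · simp only [if_neg hv]
      rw [AddChar.sum_mulShift _ (ZMod.isPrimitive_stdAddChar p), ZMod.card]
      have : -(a + b / v) = 0 ↔ v = -b / a := by
        rw [neg_eq_zero, eq_div_iff ha]
        constructor
        · intro h; field_simp at h; linear_combination h
        · intro h; field_simp; linear_combination h
      simp only [this, Nat.cast_ite, Nat.cast_zero]
  simp only [h2]
  simp

theorem weil_kl (ha : a ≠ 0) (hb : b ≠ 0) :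
    ‖klK p (ZMod p) a b‖ ≤ 2 * Real.sqrt p := by
  have hp0 : (0:ℝ) < p := by exact_mod_cast hp.out.pos
  have hp1 : (1:ℝ) < p := by exact_mod_cast hp.out.one_lt
  set S : ℂ := klK p (ZMod p) a b with hS
  have hS1 : ∀ N, 1 ≤ N → klSN p a b N 1 = S := fun N hN => by
    rw [klSN_eq p a b (K := ZMod p) le_rfl hN (by simp)]; simp [hS]
  have hW0 := klW_zero p a b
  have hW1 : klW p a b 1 = S := by
    have := klW_rec p a b (d := 1) (N := 1) le_rfl
    simpa [hW0, hS1] using this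
  -- sums for extension
  let s : ℕ → ℂ := fun n => klSN p a b n n
  haveI : ∀ n, Fintype (GaloisField p n) := fun n => Fintype.ofFinite _
  have hs : ∀ N j, 1 ≤ j → j ≤ N → klSN p a b N j = s j := fun N j h1 h2 => by
    have hf := GaloisField.finrank p (n := j) (by omega)
    rw [klSN_eq p a b h1 h2 hf]
    exact (klSN_eq p a b h1 le_rfl hf).symm
  have hs1 : s 1 = S := hS1 1 le_rfl
  have hW2 := klW_two p a b ha hb
  have hs2 : s 2 = 2 * p - S ^ 2 := by
    have := klW_rec p a b (d := 2) (N := 2) le_rfl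
    have e : Icc 1 2 = ({1, 2} : Finset ℕ) := by decide
    rw [e, Finset.sum_pair (by norm_num), hs 2 1 (by norm_num) (by norm_num), hs 2 2 (by norm_num) le_rfl, hs1] at this
    simp only [hW2, hW0, hW1, Nat.reduceSub] at this
    push_cast at this
    linear_combination -this
  have hrec : ∀ n, s (n + 3) = - S * s (n + 2) - p * s (n + 1) := by
    intro n
    have := klW_rec p a b (d := n + 3) (N := n + 3) le_rfl
    rw [klW_ge_three p a b ha (by omega), mul_zero] at this
    rw [Finset.sum_congr rfl (g := fun j => s j * klW p a b (n + 3 - j))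
      (fun j hj => by rw [hs _ _ (mem_Icc.1 hj).1 (mem_Icc.1 hj).2])] at this
    rw [Finset.sum_Icc_succ_top (by omega), Finset.sum_Icc_succ_top (by omega), Finset.sum_Icc_succ_top (by omega),
      Finset.sum_eq_zero] at this
    · rw [show n + 3 - (n + 1) = 2 by omega, show n + 3 - (n + 1 + 1) = 1 by omega, show n + 3 - (n + 1 + 1 + 1) = 0 by omega,
        hW0, hW1, hW2] at this
      linear_combination -this
    · intro j hj
      rw [klW_ge_three p a b ha (by have := (mem_Icc.1 hj).2; omega), mul_zero]
  obtain ⟨α, hα⟩ : ∃ α : ℂ, α * α + S * α + p = 0 := by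
    obtain ⟨r, hr⟩ := (IsAlgClosed.exists_pow_nat_eq (S ^ 2 - 4 * p) (n := 2) (by norm_num))
    exact ⟨(-S + r) / 2, by linear_combination (1/4 : ℂ) * hr⟩
  set β : ℂ := -S - α with hβ
  have hαβ : α * β = p := by rw [hβ]; linear_combination -hα
  have hsn : ∀ n, s (n + 1) = -(α ^ (n + 1) + β ^ (n + 1)) ∧ s (n + 2) = -(α ^ (n + 2) + β ^ (n + 2)) := by
    intro n
    induction n with
    | zero =>
      refine ⟨by simp [hs1, hβ], ?_⟩
      rw [zero_add, hs2, hβ]; linear_combination (2:ℂ) * hα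
    | succ n ih =>
      refine ⟨ih.2, ?_⟩
      rw [show n + 1 + 2 = n + 3 by ring, hrec, ih.1, ih.2]
      have e1 : S = -(α + β) := by rw [hβ]; ring
      rw [← hαβ, e1]; ring
  have hbound : ∀ μ, 3 ≤ μ → ‖α ^ (2 * μ) + β ^ (2 * μ)‖ ≤ (2 * p + 2) * (p : ℝ) ^ μ := by
    intro μ hμ
    have h1 := (hsn (2 * μ - 1)).1
    rw [show 2 * μ - 1 + 1 = 2 * μ by omega] at h1
    have hf := GaloisField.finrank p (n := 2 * μ) (by omega)
    have h2 : s (2 * μ) = _ := klSN_eq p a b (K := GaloisField p (2 * μ)) (N := 2 * μ) (by omega) le_rfl hf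
    rw [h1] at h2
    have hc : Fintype.card (GaloisField p (2 * μ)) = p ^ μ * p ^ μ := by
      rw [← Nat.card_eq_fintype_card, GaloisField.card p _ (by omega)]; ring
    have h3 := klK_bound p (K := GaloisField p (2 * μ)) (a := algebraMap _ _ a) (algebraMap _ _ b)
      (by simpa using ha) μ hc hμ
    rw [← h2, norm_neg] at h3
    have h4 : (1:ℝ) ≤ (p:ℝ) ^ μ := one_le_pow₀ hp1.le
    linarith
  have hmain : ∀ α β : ℂ, α * β = p → (∀ μ, 3 ≤ μ → ‖α ^ (2 * μ) + β ^ (2 * μ)‖ ≤ (2 * p + 2) * (p : ℝ) ^ μ) →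
      ‖α‖ ≤ Real.sqrt p := by
    intro α β h1 h2
    by_contra hlt
    push Not at hlt
    have hsq : (p:ℝ) < ‖α‖ ^ 2 := by
      have := Real.sq_sqrt hp0.le
      have h5 := Real.sqrt_nonneg (p:ℝ)
      nlinarith
    have hn : ‖α‖ * ‖β‖ = p := by rw [← norm_mul, h1]; simp
    have hβ2 : ‖β‖ ^ 2 ≤ p := by
      have h6 : 0 < ‖α‖ := (Real.sqrt_nonneg _).trans_lt hlt
      have : ‖α‖ ^ 2 * ‖β‖ ^ 2 = p * p := by rw [← mul_pow, hn]; ring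
      by_contra h7; push Not at h7
      nlinarith
    obtain ⟨n, hn⟩ := pow_unbounded_of_one_lt (2 * p + 3 : ℝ) ((one_lt_div hp0).2 hsq)
    have h8 : (2 * p + 3 : ℝ) < (‖α‖ ^ 2 / p) ^ (n + 3) :=
      hn.trans_le (pow_le_pow_right₀ ((one_lt_div hp0).2 hsq).le (by omega))
    rw [div_pow, lt_div_iff₀ (by positivity)] at h8
    have h9 := h2 (n + 3) (by omega)
    have h10 : ‖α ^ (2 * (n + 3))‖ ≤ ‖α ^ (2 * (n + 3)) + β ^ (2 * (n + 3))‖ + ‖β ^ (2 * (n + 3))‖ := by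
      have := norm_sub_le (α ^ (2 * (n + 3)) + β ^ (2 * (n + 3))) (β ^ (2 * (n + 3)))
      simpa using this
    have h11 : ‖β ^ (2 * (n + 3))‖ ≤ (p:ℝ) ^ (n + 3) := by
      rw [norm_pow, pow_mul]; exact pow_le_pow_left₀ (by positivity) hβ2 _
    rw [norm_pow, pow_mul] at h10
    linarith
  have hA := hmain α β hαβ hbound
  have hB := hmain β α (by rw [mul_comm]; exact hαβ) (fun μ hμ => by rw [add_comm]; exact hbound μ hμ)
  have e1 : S = -(α + β) := by rw [hβ]; ring
  rw [e1, norm_neg]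
  exact (norm_add_le _ _).trans (by linarith)
end WeilKl

section StatPhase
variable {R : Type} [CommRing R] [Fintype R] [DecidableEq R] (ψ : AddChar R ℂ) (hψ : ψ.IsPrimitive)

noncomputable def klR (a b : R) : ℂ := ∑ u : Rˣ, ψ (a * u + b * (u⁻¹ : Rˣ))

def oneAdd (t : R) (ht : t ^ 3 = 0) (z : R) : Rˣ :=
  ⟨1 + t * z, 1 - t * z + t ^ 2 * z ^ 2, by linear_combination z^3 * ht, by linear_combination z^3 * ht⟩

theorem klR_avg (a b t : R) (ht : t ^ 3 = 0) :
    (Fintype.card R : ℂ) * klR ψ a b =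
      ∑ u : Rˣ, ψ (a * u + b * (u⁻¹ : Rˣ)) *
        ∑ z : R, ψ (z * (t * (a * u - b * (u⁻¹ : Rˣ))) + t ^ 2 * z ^ 2 * (b * (u⁻¹ : Rˣ))) := by
  have h1 : ∀ z : R, klR ψ a b = ∑ u : Rˣ, ψ (a * u + b * (u⁻¹ : Rˣ)) *
        ψ (z * (t * (a * u - b * (u⁻¹ : Rˣ))) + t ^ 2 * z ^ 2 * (b * (u⁻¹ : Rˣ))) := by
    intro z
    unfold klR
    rw [← Equiv.sum_comp (Equiv.mulRight (oneAdd t ht z))]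
    refine Finset.sum_congr rfl fun u _ => ?_
    rw [← AddChar.map_add_eq_mul]
    congr 1
    simp only [Equiv.coe_mulRight, mul_inv_rev, Units.val_mul]
    have e1 : ((oneAdd t ht z : Rˣ) : R) = 1 + t * z := rfl
    have e2 : (((oneAdd t ht z)⁻¹ : Rˣ) : R) = 1 - t * z + t ^ 2 * z ^ 2 := rfl
    rw [e1, e2]; ring
  simp only [Finset.mul_sum]
  rw [Finset.sum_comm, ← Finset.sum_congr rfl (fun z _ => h1 z), Finset.sum_const, Finset.card_univ, nsmul_eq_mul]

theorem klR_even [Nontrivial R] (hψ : ψ.IsPrimitive) (a b t : R) (ht : t ^ 2 = 0) :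
    ‖klR ψ a b‖ ≤ #{u : Rˣ | t * (a * u - b * (u⁻¹ : Rˣ)) = 0} := by
  have h1 := klR_avg ψ a b t (by rw [pow_succ, ht, zero_mul])
  simp only [ht, zero_mul, add_zero] at h1
  simp only [AddChar.sum_mulShift _ hψ] at h1
  have hc : (0:ℝ) < Fintype.card R := by exact_mod_cast Fintype.card_pos
  have h2 : ‖(Fintype.card R : ℂ) * klR ψ a b‖ ≤ Fintype.card R * #{u : Rˣ | t * (a * u - b * (u⁻¹ : Rˣ)) = 0} := by
    rw [h1]
    refine (norm_sum_le _ _).trans ?_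
    rw [Finset.card_filter]
    push_cast
    rw [Finset.mul_sum]
    refine Finset.sum_le_sum fun u _ => ?_
    rw [norm_mul, AddChar.norm_apply, one_mul]
    split_ifs <;> simp
  rw [norm_mul, Complex.norm_natCast] at h2
  exact le_of_mul_le_mul_left h2 hc

theorem klR_odd [Nontrivial R] (hψ : ψ.IsPrimitive) (a t ϖ : R) (b : R) (hb : IsUnit b) (ht : t ^ 3 = 0) (ht2 : t ^ 2 * ϖ = 0) :
    ‖klR ψ a b‖ ≤ Real.sqrt (#{h : R | 2 * t ^ 2 * h = 0} / Fintype.card R) * #{u : Rˣ | t * ϖ * (a * u - b * (u⁻¹ : Rˣ)) = 0} := by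
  have h1 := klR_avg ψ a b t ht
  have hc : (0:ℝ) < Fintype.card R := by exact_mod_cast Fintype.card_pos
  set D : ℝ := Real.sqrt (#{h : R | 2 * t ^ 2 * h = 0} / Fintype.card R) with hD
  -- Gauss sum bound
  have hG : ∀ A B : R, IsUnit B → ‖∑ z : R, ψ (z * A + t ^ 2 * z ^ 2 * B)‖ ≤ Fintype.card R * D := by
    intro A B hB
    set G := ∑ z : R, ψ (z * A + t ^ 2 * z ^ 2 * B) with hGdef
    have hsq : (‖G‖ ^ 2 : ℂ) = ∑ h : R, ψ (h * A + t ^ 2 * h ^ 2 * B) * (if 2 * t ^ 2 * h = 0 then (Fintype.card R : ℂ) else 0) := by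
      rw [← Complex.mul_conj', hGdef, map_sum, Finset.sum_mul_sum]
      rw [Finset.sum_comm]
      have : ∀ z : R, ∑ x : R, ψ (x * A + t ^ 2 * x ^ 2 * B) * (starRingEnd ℂ) (ψ (z * A + t ^ 2 * z ^ 2 * B))
          = ∑ h : R, ψ (h * A + t ^ 2 * h ^ 2 * B) * ψ (z * (2 * t ^ 2 * h * B)) := by
        intro z
        rw [← Equiv.sum_comp (Equiv.addRight z)]
        refine Finset.sum_congr rfl fun h _ => ?_
        rw [← AddChar.map_neg_eq_conj, ← AddChar.map_add_eq_mul, ← AddChar.map_add_eq_mul]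
        congr 1
        simp only [Equiv.coe_addRight]; ring
      rw [Finset.sum_congr rfl fun z _ => this z, Finset.sum_comm]
      refine Finset.sum_congr rfl fun h _ => ?_
      rw [← Finset.mul_sum, AddChar.sum_mulShift _ hψ]
      have : 2 * t ^ 2 * h * B = 0 ↔ 2 * t ^ 2 * h = 0 := by
        constructor
        · intro h; exact (hB.mul_left_eq_zero).1 h
        · intro h; rw [h, zero_mul]
      simp only [this, Nat.cast_ite, Nat.cast_zero]
    have hle : ‖G‖ ^ 2 ≤ Fintype.card R * #{h : R | 2 * t ^ 2 * h = 0} := by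
      have : ‖G‖ ^ 2 = ‖(‖G‖ ^ 2 : ℂ)‖ := by simp
      rw [this, hsq]
      refine (norm_sum_le _ _).trans ?_
      rw [Finset.card_filter]
      push_cast
      rw [Finset.mul_sum]
      refine Finset.sum_le_sum fun u _ => ?_
      rw [norm_mul, AddChar.norm_apply, one_mul]
      split_ifs <;> simp
    refine abs_le_of_sq_le_sq' ?_ (by positivity) |>.2
    rw [mul_pow, hD, Real.sq_sqrt (by positivity)]
    refine hle.trans (le_of_eq ?_)
    field_simp
  have hG0 : ∀ A B : R, ϖ * A ≠ 0 → ∑ z : R, ψ (z * A + t ^ 2 * z ^ 2 * B) = 0 := by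
    intro A B hA
    set G := ∑ z : R, ψ (z * A + t ^ 2 * z ^ 2 * B) with hGdef
    have h3 : ∀ w : R, G = G * ψ (w * (ϖ * A)) := by
      intro w
      conv_lhs => rw [hGdef]
      rw [← Equiv.sum_comp (Equiv.addRight (w * ϖ)), hGdef, Finset.sum_mul]
      refine Finset.sum_congr rfl fun z _ => ?_
      rw [← AddChar.map_add_eq_mul]
      congr 1
      simp only [Equiv.coe_addRight]
      linear_combination (B * (2 * z * w + w ^ 2 * ϖ)) * ht2
    have h4 : ∑ w : R, G = 0 := by
      rw [Finset.sum_congr rfl fun w _ => h3 w, ← Finset.mul_sum, AddChar.sum_mulShift _ hψ, if_neg hA]; simp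
    rw [Finset.sum_const, Finset.card_univ, nsmul_eq_mul] at h4
    rcases mul_eq_zero.1 h4 with h | h
    · exfalso; rw [Nat.cast_eq_zero] at h; exact Fintype.card_ne_zero h
    · exact h
  have h2 : ‖(Fintype.card R : ℂ) * klR ψ a b‖ ≤ Fintype.card R * (D * #{u : Rˣ | t * ϖ * (a * u - b * (u⁻¹ : Rˣ)) = 0}) := by
    rw [h1]
    refine (norm_sum_le _ _).trans ?_
    rw [Finset.card_filter]
    push_cast
    rw [Finset.mul_sum, Finset.mul_sum]
    refine Finset.sum_le_sum fun u _ => ?_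
    rw [norm_mul, AddChar.norm_apply, one_mul]
    split_ifs with h
    · rw [mul_one]; exact hG _ _ (hb.mul (Units.isUnit _))
    · rw [hG0]
      · simp
      · rwa [← mul_assoc, mul_comm ϖ t]
  rw [norm_mul, Complex.norm_natCast] at h2
  exact le_of_mul_le_mul_left h2 hc
end StatPhase

section PrimePow
variable (p : ℕ) [hp : Fact p.Prime]

theorem pp_dvd {α : ℕ} {x y u : ℤ} (hu : ¬ (p : ℤ) ∣ u) (hxy : x + y = 2 * u) (h : (p : ℤ) ^ α ∣ x * y) :
    (p : ℤ) ^ α ∣ 2 * x ∨ (p : ℤ) ^ α ∣ 2 * y := by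
  have hpp : Prime (p : ℤ) := Nat.prime_iff_prime_int.1 hp.out
  by_cases h1 : (p : ℤ) ∣ x
  · by_cases h2 : (p : ℤ) ∣ y
    · have h3 : (p : ℤ) ∣ 2 * u := hxy ▸ dvd_add h1 h2
      have h4 : (p : ℤ) ∣ 2 := (hpp.dvd_or_dvd h3).resolve_right hu
      have hp2 : p = 2 := by
        have : p ∣ 2 := by exact_mod_cast h4
        exact (Nat.prime_dvd_prime_iff_eq hp.out Nat.prime_two).1 this
      subst hp2
      obtain ⟨x', rfl⟩ := h1
      obtain ⟨y', rfl⟩ := h2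
      push_cast at *
      have h5 : x' + y' = u := by linarith
      by_cases h6 : (2:ℤ) ∣ x'
      · have h7 : ¬ (2:ℤ) ∣ y' := fun h => hu (h5 ▸ dvd_add h6 h)
        left
        have : IsCoprime ((2:ℤ) ^ α) y' := IsCoprime.pow_left ((Prime.coprime_iff_not_dvd (by exact_mod_cast hpp)).2 h7)
        refine this.dvd_of_dvd_mul_right ?_
        have e : 2 * (2 * x') * y' = 2 * x' * (2 * y') := by ring
        rw [e]; exact h
      · right
        have : IsCoprime ((2:ℤ) ^ α) x' := IsCoprime.pow_left ((Prime.coprime_iff_not_dvd (by exact_mod_cast hpp)).2 h6)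
        refine this.dvd_of_dvd_mul_right ?_
        have e : 2 * (2 * y') * x' = 2 * x' * (2 * y') := by ring
        rw [e]; exact h
    · left
      have : IsCoprime ((p:ℤ) ^ α) y := IsCoprime.pow_left ((Prime.coprime_iff_not_dvd hpp).2 h2)
      exact Dvd.dvd.mul_left (this.dvd_of_dvd_mul_right h) 2
  · right
    have : IsCoprime ((p:ℤ) ^ α) x := IsCoprime.pow_left ((Prime.coprime_iff_not_dvd hpp).2 h1)
    exact Dvd.dvd.mul_left (this.dvd_of_dvd_mul_left h) 2

theorem zmod_pow_mul {β j : ℕ} (hβ : β < j) (x : ℤ) :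
    ((p : ZMod (p ^ j)) ^ β * (x : ZMod (p ^ j)) = 0) ↔ (p : ℤ) ^ (j - β) ∣ x := by
  have h1 : ((p : ZMod (p ^ j)) ^ β * (x : ZMod (p ^ j))) = (((p : ℤ) ^ β * x : ℤ) : ZMod (p ^ j)) := by push_cast; ring
  rw [h1, ZMod.intCast_zmod_eq_zero_iff_dvd]
  have h2 : ((p ^ j : ℕ) : ℤ) = (p : ℤ) ^ β * (p : ℤ) ^ (j - β) := by
    rw [← pow_add]; push_cast; congr 1; omega
  rw [h2]
  exact mul_dvd_mul_iff_left (pow_ne_zero _ (by exact_mod_cast hp.out.ne_zero))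

theorem isUnit_zmod {j : ℕ} (hj : 1 ≤ j) (x : ℤ) : IsUnit (x : ZMod (p ^ j)) ↔ ¬ (p : ℤ) ∣ x := by
  rw [ZMod.coe_int_isUnit_iff_isCoprime]
  push_cast
  rw [IsCoprime.pow_left_iff (by omega), Prime.coprime_iff_not_dvd (Nat.prime_iff_prime_int.1 hp.out)]

theorem stat_count {β j : ℕ} (hβ : β < j) (a b : ZMod (p ^ j)) (hab : IsUnit a ∨ IsUnit b) :
    (#{u : (ZMod (p ^ j))ˣ | (p : ZMod (p ^ j)) ^ β * (a * u - b * (u⁻¹ : (ZMod (p ^ j))ˣ)) = 0} ≤ 4 * p ^ β) ∧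
    (¬ (IsUnit a ∧ IsUnit b) → #{u : (ZMod (p ^ j))ˣ | (p : ZMod (p ^ j)) ^ β * (a * u - b * (u⁻¹ : (ZMod (p ^ j))ˣ)) = 0} = 0) := by
  classical
  set S : Finset (ZMod (p ^ j))ˣ := {u : (ZMod (p ^ j))ˣ | (p : ZMod (p ^ j)) ^ β * (a * u - b * (u⁻¹ : (ZMod (p ^ j))ˣ)) = 0} with hS
  have hSm : ∀ u : (ZMod (p ^ j))ˣ, u ∈ S → (p : ZMod (p ^ j)) ^ β * (a * u ^ 2 - b) = 0 := by
    intro u hu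
    rw [hS, mem_filter] at hu
    have h1 := hu.2
    have h2 : (u⁻¹ : (ZMod (p ^ j))ˣ) * (u : ZMod (p ^ j)) = 1 := Units.inv_mul u
    linear_combination (u : ZMod (p ^ j)) * h1 + (p : ZMod (p ^ j)) ^ β * b * h2
  have hpos : 1 ≤ j := by omega
  have hunit : S.Nonempty → (IsUnit a ↔ IsUnit b) := by
    rintro ⟨u, hu⟩
    have h1 := hSm u hu
    obtain ⟨A, rfl⟩ := ZMod.intCast_surjective a
    obtain ⟨B, rfl⟩ := ZMod.intCast_surjective b
    obtain ⟨U, hU⟩ := ZMod.intCast_surjective (u : ZMod (p ^ j))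
    have hU' : ¬ (p : ℤ) ∣ U := by
      rw [← isUnit_zmod p hpos U, hU]; exact Units.isUnit u
    rw [← hU] at h1
    have h2 : (p : ZMod (p ^ j)) ^ β * ((A * U ^ 2 - B : ℤ) : ZMod (p ^ j)) = 0 := by push_cast at h1 ⊢; exact h1
    rw [zmod_pow_mul p hβ] at h2
    have h3 : (p : ℤ) ∣ A * U ^ 2 - B := (dvd_pow_self _ (by omega)).trans h2
    have hpp : Prime (p : ℤ) := Nat.prime_iff_prime_int.1 hp.out
    rw [isUnit_zmod p hpos, isUnit_zmod p hpos, not_iff_not]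
    constructor
    · intro h4
      have := dvd_sub (h4.mul_right (U ^ 2)) h3
      simpa using this
    · intro h4
      have h5 := dvd_add h3 h4
      rw [sub_add_cancel] at h5
      exact (hpp.dvd_or_dvd h5).resolve_right (fun h => hU' (hpp.dvd_of_dvd_pow h))
  constructor
  · rcases S.eq_empty_or_nonempty with h | h
    · rw [h]; simp
    · have hi := hunit h
      have ha : IsUnit a := by tauto
      obtain ⟨v, hv⟩ := h
      have hcov : ∀ u ∈ S, (2 * p ^ β) • ((u : ZMod (p ^ j)) - v) = 0 ∨ (2 * p ^ β) • ((u : ZMod (p ^ j)) + v) = 0 := by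
        intro u hu
        have h1 := hSm u hu
        have h2 := hSm v hv
        have h3 : (p : ZMod (p ^ j)) ^ β * (((u : ZMod (p ^ j)) - v) * (u + v)) = 0 := by
          refine (ha.mul_right_eq_zero).1 ?_
          linear_combination h1 - h2
        obtain ⟨U, hU⟩ := ZMod.intCast_surjective (u : ZMod (p ^ j))
        obtain ⟨V, hV⟩ := ZMod.intCast_surjective (v : ZMod (p ^ j))
        have hU' : ¬ (p : ℤ) ∣ U := by
          rw [← isUnit_zmod p hpos U, hU]; exact Units.isUnit u
        rw [← hU, ← hV] at h3 ⊢
        have h4 : (p : ZMod (p ^ j)) ^ β * (((U - V) * (U + V) : ℤ) : ZMod (p ^ j)) = 0 := by push_cast at h3 ⊢; exact h3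
        rw [zmod_pow_mul p hβ] at h4
        rcases pp_dvd p hU' (by ring) h4 with h5 | h5
        · left
          rw [← zmod_pow_mul p hβ] at h5
          rw [nsmul_eq_mul]; push_cast at h5 ⊢; linear_combination h5
        · right
          rw [← zmod_pow_mul p hβ] at h5
          rw [nsmul_eq_mul]; push_cast at h5 ⊢; linear_combination h5
      haveI : NeZero (p ^ j) := ⟨pow_ne_zero _ hp.out.ne_zero⟩
      have hk : #{w : ZMod (p ^ j) | (2 * p ^ β) • w = 0} ≤ 2 * p ^ β :=
        IsAddCyclic.card_nsmul_eq_zero_le (by have := hp.out.pos; positivity)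
      have hsub : S ⊆ (univ.filter fun u : (ZMod (p ^ j))ˣ => (2 * p ^ β) • ((u : ZMod (p ^ j)) - v) = 0) ∪ (univ.filter fun u : (ZMod (p ^ j))ˣ => (2 * p ^ β) • ((u : ZMod (p ^ j)) + v) = 0) := by
        intro u hu
        rw [mem_union, mem_filter, mem_filter]
        rcases hcov u hu with h | h
        · exact Or.inl ⟨mem_univ _, h⟩
        · exact Or.inr ⟨mem_univ _, h⟩
      refine (card_le_card hsub).trans ((card_union_le _ _).trans ?_)
      have e1 : #(univ.filter fun u : (ZMod (p ^ j))ˣ => (2 * p ^ β) • ((u : ZMod (p ^ j)) - v) = 0) ≤ 2 * p ^ β := by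
        refine le_trans (card_le_card_of_injOn (fun u => (u : ZMod (p ^ j)) - v) ?_ ?_) hk
        · intro u hu; exact mem_coe.2 (mem_filter.2 ⟨mem_univ _, (mem_filter.1 (mem_coe.1 hu)).2⟩)
        · intro u _ w _ h; exact Units.ext (sub_left_injective h)
      have e2 : #(univ.filter fun u : (ZMod (p ^ j))ˣ => (2 * p ^ β) • ((u : ZMod (p ^ j)) + v) = 0) ≤ 2 * p ^ β := by
        refine le_trans (card_le_card_of_injOn (fun u => (u : ZMod (p ^ j)) + v) ?_ ?_) hk
        · intro u hu; exact mem_coe.2 (mem_filter.2 ⟨mem_univ _, (mem_filter.1 (mem_coe.1 hu)).2⟩)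
        · intro u _ w _ h; exact Units.ext (add_left_injective _ h)
      omega
  · intro h
    rw [Finset.card_eq_zero]
    by_contra h2
    have := hunit (Finset.nonempty_iff_ne_empty.2 h2)
    tauto
end PrimePow

section KlInt

noncomputable def kl (c : ℕ) [NeZero c] (a b : ℤ) : ℂ := klR (ZMod.stdAddChar (N := c)) (a : ZMod c) (b : ZMod c)

theorem kl_triv (c : ℕ) [NeZero c] (a b : ℤ) : ‖kl c a b‖ ≤ c := by
  unfold kl klR
  refine (norm_sum_le _ _).trans ?_
  simp only [AddChar.norm_apply]
  rw [Finset.sum_const, Finset.card_univ, ZMod.card_units_eq_totient]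
  simp [Nat.totient_le]

variable (p : ℕ) [hp : Fact p.Prime]

theorem kl_eq_klK (a b : ℤ) : kl p a b = klK p (ZMod p) a b := by
  classical
  unfold kl klR klK
  refine Finset.sum_bij (fun u _ => (u : ZMod p)) ?_ ?_ ?_ ?_
  · intro u _; simp
  · intro u _ v _ h; exact Units.ext h
  · intro x hx
    have hx2 : x ≠ 0 := by simpa using hx
    exact ⟨Units.mk0 x hx2, mem_univ _, rfl⟩
  · intro u _
    rw [Algebra.trace_self_apply, Units.val_inv_eq_inv_val, div_eq_mul_inv]

theorem psi_sum_ne {a : ZMod p} (ha : a ≠ 0) : ∑ u : (ZMod p)ˣ, (ZMod.stdAddChar (a * (u : ZMod p)) : ℂ) = -1 := by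
  classical
  have h1 : ∑ u : (ZMod p)ˣ, (ZMod.stdAddChar (a * (u : ZMod p)) : ℂ) = ∑ x ∈ univ.erase (0 : ZMod p), ZMod.stdAddChar (x * a) := by
    refine Finset.sum_bij (fun u _ => (u : ZMod p)) ?_ ?_ ?_ ?_
    · intro u _; simp
    · intro u _ v _ h; exact Units.ext h
    · intro x hx
      rw [mem_erase] at hx
      exact ⟨Units.mk0 x hx.1, mem_univ _, rfl⟩
    · intro u _; rw [mul_comm]
  rw [h1, Finset.sum_erase_eq_sub (mem_univ _), AddChar.sum_mulShift _ (ZMod.isPrimitive_stdAddChar p), if_neg ha]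
  simp

theorem kl_prime (a b : ℤ) : ‖kl p a b‖ ≤ 8 * Real.sqrt p * Real.sqrt (Int.gcd b p) := by
  have hp1 : (1:ℝ) ≤ Real.sqrt p := by
    rw [Real.one_le_sqrt]; exact_mod_cast hp.out.one_le
  have hz : ∀ x : ℤ, (x : ZMod p) = 0 ↔ (p : ℤ) ∣ x := fun x => ZMod.intCast_zmod_eq_zero_iff_dvd x p
  have hg : (1:ℝ) ≤ Real.sqrt (Int.gcd b p) := by
    rw [Real.one_le_sqrt]
    exact_mod_cast Nat.pos_of_ne_zero (by rw [Ne, Int.gcd_eq_zero_iff]; rintro ⟨-, h⟩; exact hp.out.ne_zero (by exact_mod_cast h))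
  have hprod : 8 * Real.sqrt p ≤ 8 * Real.sqrt p * Real.sqrt (Int.gcd b p) := by
    nlinarith
  by_cases hb : (b : ZMod p) = 0
  · by_cases ha : (a : ZMod p) = 0
    · refine (kl_triv p a b).trans ?_
      have : Int.gcd b p = p := by
        rw [Int.gcd_comm]; exact_mod_cast Int.gcd_eq_left (by positivity) ((hz b).1 hb)
      rw [this, mul_assoc, Real.mul_self_sqrt (by positivity)]
      have : (0:ℝ) ≤ p := by positivity
      linarith
    · have : kl p a b = -1 := by
        unfold kl klR
        simp only [hb, zero_mul, add_zero]
        exact psi_sum_ne p ha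
      rw [this, norm_neg, norm_one]
      linarith
  · by_cases ha : (a : ZMod p) = 0
    · have : kl p a b = -1 := by
        unfold kl klR
        simp only [ha, zero_mul, zero_add]
        rw [← psi_sum_ne p hb, ← Equiv.sum_comp (Equiv.inv (ZMod p)ˣ)]
        rfl
      rw [this, norm_neg, norm_one]
      linarith
    · rw [kl_eq_klK]
      refine (weil_kl p _ _ ha hb).trans ?_
      linarith

theorem kl_pp_unit {j : ℕ} (hj : 2 ≤ j) (a b : ZMod (p ^ j)) (hab : IsUnit a ∨ IsUnit b) :
    ‖klR (ZMod.stdAddChar (N := p ^ j)) a b‖ ≤ 8 * Real.sqrt ((p : ℝ) ^ j) := by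
  have hprim := ZMod.isPrimitive_stdAddChar (p ^ j)
  have hp0 : (0:ℝ) < p := by exact_mod_cast hp.out.pos
  haveI : Fact (1 < p ^ j) := ⟨Nat.one_lt_pow (by omega) hp.out.one_lt⟩
  have hpz : ∀ i, j ≤ i → (p : ZMod (p ^ j)) ^ i = 0 := by
    intro i hi
    have : ((p ^ j : ℕ) : ZMod (p ^ j)) = 0 := ZMod.natCast_self _
    push_cast at this
    obtain ⟨e, rfl⟩ := Nat.exists_eq_add_of_le hi
    rw [pow_add, this, zero_mul]
  by_cases hu : IsUnit a ∧ IsUnit b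
  · rcases Nat.even_or_odd' j with ⟨α, hα | hα⟩
    · have h1 := klR_even _ hprim a b ((p : ZMod (p ^ j)) ^ α) (by rw [← pow_mul]; exact hpz _ (by omega))
      have h2 := (stat_count p (β := α) (j := j) (by omega) a b hab).1
      refine h1.trans ?_
      have h3 : Real.sqrt ((p : ℝ) ^ j) = (p : ℝ) ^ α := by
        rw [hα, mul_comm, pow_mul, Real.sqrt_sq (by positivity)]
      rw [h3]
      have : (0:ℝ) < (p:ℝ) ^ α := by positivity
      calc _ ≤ ((4 * p ^ α : ℕ) : ℝ) := by exact_mod_cast h2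
        _ ≤ _ := by push_cast; linarith
    · have h1 := klR_odd _ hprim a ((p : ZMod (p ^ j)) ^ α) (p : ZMod (p ^ j)) b hu.2 (by rw [← pow_mul]; exact hpz _ (by omega))
        (by rw [← pow_mul, ← pow_succ]; exact hpz _ (by omega))
      simp only [← pow_succ] at h1
      have h2 := (stat_count p (β := α + 1) (j := j) (by omega) a b hab).1
      have h3 : #{h : ZMod (p ^ j) | 2 * ((p : ZMod (p ^ j)) ^ α) ^ 2 * h = 0} ≤ 2 * p ^ (2 * α) := by
        have : #{w : ZMod (p ^ j) | (2 * p ^ (2 * α)) • w = 0} ≤ 2 * p ^ (2 * α) :=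
          IsAddCyclic.card_nsmul_eq_zero_le (by have := hp.out.pos; positivity)
        refine le_trans (le_of_eq ?_) this
        congr 1
        ext w
        simp only [mem_filter, mem_univ, true_and, nsmul_eq_mul]
        push_cast
        rw [← pow_mul, mul_comm α 2]
      refine h1.trans ?_
      rw [ZMod.card]
      have h4 : (#{h : ZMod (p ^ j) | 2 * ((p : ZMod (p ^ j)) ^ α) ^ 2 * h = 0} : ℝ) / ((p ^ j : ℕ) : ℝ) ≤ 2 / p := by
        have h3' : (#{h : ZMod (p ^ j) | 2 * ((p : ZMod (p ^ j)) ^ α) ^ 2 * h = 0} : ℝ) ≤ 2 * (p:ℝ) ^ (2 * α) := by exact_mod_cast h3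
        have h6 : (p:ℝ) ^ j = (p:ℝ) ^ (2 * α) * p := by rw [hα, pow_succ]
        push_cast
        rw [h6, div_le_div_iff₀ (by positivity) hp0]
        nlinarith
      have h5 : (#{u : (ZMod (p ^ j))ˣ | (p : ZMod (p ^ j)) ^ (α + 1) * (a * u - b * (u⁻¹ : (ZMod (p ^ j))ˣ)) = 0} : ℝ) ≤ 4 * (p:ℝ) ^ (α + 1) := by
        exact_mod_cast h2
      calc _ ≤ Real.sqrt (2 / p) * (4 * (p:ℝ) ^ (α + 1)) := by
              refine mul_le_mul (Real.sqrt_le_sqrt h4) h5 (by positivity) (by positivity)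
        _ ≤ _ := by
          refine abs_le_of_sq_le_sq' ?_ (by positivity) |>.2
          rw [mul_pow, mul_pow, mul_pow, Real.sq_sqrt (by positivity), Real.sq_sqrt (by positivity), hα]
          have : 2 / (p:ℝ) * (4 ^ 2 * ((p:ℝ) ^ (α + 1)) ^ 2) = 32 * (p:ℝ) ^ (2 * α + 1) := by
            field_simp; ring
          rw [this]
          have : (0:ℝ) < (p:ℝ) ^ (2 * α + 1) := by positivity
          linarith
  · have h1 := klR_even _ hprim a b ((p : ZMod (p ^ j)) ^ ((j + 1) / 2)) (by rw [← pow_mul]; exact hpz _ (by omega))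
    rw [(stat_count p (β := (j + 1) / 2) (j := j) (by omega) a b hab).2 hu] at h1
    refine h1.trans ?_
    simp

theorem kl_pp_lift {j : ℕ} (hj : 1 ≤ j) (a b : ℤ) :
    kl (p ^ (j + 1)) (p * a) (p * b) = p * kl (p ^ j) a b := by
  classical
  have hd : p ^ j ∣ p ^ (j + 1) := pow_dvd_pow _ (by omega)
  let π := ZMod.unitsMap hd
  have hsurj : Function.Surjective π := ZMod.unitsMap_surjective hd
  have hker : Nat.card π.ker = p := by
    have h1 := π.ker.card_mul_index
    rw [Subgroup.index_ker, MonoidHom.range_eq_top.2 hsurj] at h1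
    rw [Subgroup.card_top, Nat.card_eq_fintype_card (α := (ZMod (p ^ j))ˣ), Nat.card_eq_fintype_card (α := (ZMod (p ^ (j+1)))ˣ),
      ZMod.card_units_eq_totient, ZMod.card_units_eq_totient,
      Nat.totient_prime_pow hp.out (by omega), Nat.totient_prime_pow hp.out (by omega)] at h1
    have h2 : p ^ (j + 1 - 1) = p * p ^ (j - 1) := by
      rw [← pow_succ']; congr 1; omega
    rw [h2, mul_assoc] at h1
    exact Nat.eq_of_mul_eq_mul_right (Nat.mul_pos (pow_pos hp.out.pos _) (Nat.sub_pos_of_lt hp.out.one_lt)) h1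
  have hchar : ∀ x : ZMod (p ^ (j + 1)), (ZMod.stdAddChar ((p : ZMod (p ^ (j + 1))) * x) : ℂ) = ZMod.stdAddChar (ZMod.castHom hd (ZMod (p ^ j)) x) := by
    intro x
    obtain ⟨X, rfl⟩ := ZMod.intCast_surjective x
    have e : (p : ZMod (p ^ (j+1))) * (X : ZMod (p ^ (j+1))) = (((p : ℤ) * X : ℤ) : ZMod (p ^ (j+1))) := by push_cast; ring
    rw [e, map_intCast (ZMod.castHom hd (ZMod (p ^ j))), ZMod.stdAddChar_coe, ZMod.stdAddChar_coe]
    congr 1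
    have : (p : ℂ) ≠ 0 := by exact_mod_cast hp.out.ne_zero
    push_cast
    rw [pow_succ]
    field_simp
  unfold kl klR
  have h1 : ∀ u : (ZMod (p ^ (j + 1)))ˣ, (ZMod.stdAddChar ((((p : ℤ) * a : ℤ) : ZMod (p ^ (j+1))) * (u : ZMod (p ^ (j+1))) + (((p : ℤ) * b : ℤ) : ZMod (p ^ (j+1))) * ((u⁻¹ : (ZMod (p ^ (j + 1)))ˣ) : ZMod (p ^ (j+1)))) : ℂ)
      = ZMod.stdAddChar ((a : ZMod (p ^ j)) * (π u : ZMod (p ^ j)) + (b : ZMod (p ^ j)) * (((π u)⁻¹ : (ZMod (p ^ j))ˣ) : ZMod (p ^ j))) := by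
    intro u
    have e : (((p : ℤ) * a : ℤ) : ZMod (p ^ (j+1))) * u + (((p : ℤ) * b : ℤ) : ZMod (p ^ (j+1))) * (u⁻¹ : (ZMod (p ^ (j + 1)))ˣ)
      = p * (a * u + b * (u⁻¹ : (ZMod (p ^ (j + 1)))ˣ)) := by push_cast; ring
    rw [e, hchar, map_add, map_mul, map_mul, map_intCast, map_intCast, ← map_inv]
    rfl
  rw [Finset.sum_congr rfl fun u _ => h1 u, ← Finset.sum_fiberwise _ π, Finset.mul_sum]
  refine Finset.sum_congr rfl fun v _ => ?_
  obtain ⟨u0, hu0⟩ := hsurj v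
  have hcard : #(univ.filter fun u => π u = v) = p := by
    have h3 := MonoidHom.card_fiber_eq_of_mem_range π ⟨u0, hu0⟩ (⟨1, map_one π⟩ : (1 : (ZMod (p^j))ˣ) ∈ Set.range π)
    rw [h3]
    conv_rhs => rw [← hker]
    rw [Nat.card_eq_fintype_card, Fintype.card_subtype]
    congr 1
    ext g; simp [MonoidHom.mem_ker]
  rw [Finset.sum_congr rfl (g := fun _ => ZMod.stdAddChar ((a : ZMod (p ^ j)) * (v : ZMod (p ^ j)) + (b : ZMod (p ^ j)) * ((v⁻¹ : (ZMod (p ^ j))ˣ) : ZMod (p ^ j))))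
    (fun u hu => by rw [(mem_filter.1 hu).2]), Finset.sum_const, hcard, nsmul_eq_mul]

theorem kl_pp {j : ℕ} (hj : 1 ≤ j) : ∀ (a b : ℤ),
    ‖kl (p ^ j) a b‖ ≤ 8 * Real.sqrt ((p : ℝ) ^ j) * Real.sqrt (Int.gcd b (p ^ j)) := by
  have hp0 : (0:ℝ) < p := by exact_mod_cast hp.out.pos
  induction j, hj using Nat.le_induction with
  | base =>
    intro a b
    have : ∀ c [NeZero c], c = p → ‖kl c a b‖ ≤ 8 * Real.sqrt p * Real.sqrt (Int.gcd b p) := by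
      rintro c _ rfl; exact kl_prime c a b
    have h := this (p ^ 1) (pow_one p)
    have e1 : (p:ℝ) ^ 1 = p := pow_one _
    have e2 : (p:ℤ) ^ 1 = p := pow_one _
    rw [e1, e2]; exact h
  | succ j hj ih =>
    intro a b
    by_cases hab : ¬ (p : ℤ) ∣ a ∨ ¬ (p : ℤ) ∣ b
    · rw [← isUnit_zmod p (j := j + 1) (by omega), ← isUnit_zmod p (j := j + 1) (by omega)] at hab
      have h1 := kl_pp_unit p (j := j + 1) (by omega) _ _ hab
      refine h1.trans (le_mul_of_one_le_right (by positivity) ?_)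
      rw [Real.one_le_sqrt]
      exact_mod_cast Nat.pos_of_ne_zero (by rw [Ne, Int.gcd_eq_zero_iff]; rintro ⟨-, h⟩; exact pow_ne_zero _ hp.out.ne_zero (by exact_mod_cast h))
    · push Not at hab
      obtain ⟨⟨a', rfl⟩, ⟨b', rfl⟩⟩ := hab
      rw [kl_pp_lift p hj, norm_mul, Complex.norm_natCast]
      have h1 := ih a' b'
      have h2 : Int.gcd (p * b') ((p : ℤ) ^ (j + 1)) = p * Int.gcd b' (p ^ j) := by
        rw [pow_succ', Int.gcd_mul_left]; simp
      rw [h2]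
      push_cast
      rw [pow_succ', Real.sqrt_mul hp0.le, Real.sqrt_mul hp0.le]
      have h3 := Real.mul_self_sqrt hp0.le
      calc (p:ℝ) * ‖kl (p ^ j) a' b'‖ ≤ p * (8 * Real.sqrt ((p : ℝ) ^ j) * Real.sqrt (Int.gcd b' (p ^ j))) := by gcongr
        _ = _ := by
          linear_combination (-(8 * Real.sqrt ((p : ℝ) ^ j) * Real.sqrt (Int.gcd b' (p ^ j)))) * h3
end KlInt

section DivBound
theorem divisor_bound (ε : ℝ) (hε : 0 < ε) : ∃ C : ℝ, 1 ≤ C ∧ ∀ n : ℕ, 1 ≤ n → (#n.divisors : ℝ) ≤ C * (n : ℝ) ^ ε := by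
  have hl2 : 0 < Real.log 2 := Real.log_pos (by norm_num)
  set C0 : ℝ := 1 + 1 / (ε * Real.log 2) with hC0
  have hC01 : 1 ≤ C0 := by rw [hC0]; have : 0 < 1 / (ε * Real.log 2) := by positivity
                           linarith
  set P0 : ℕ := ⌈(2:ℝ) ^ (1 / ε)⌉₊ with hP0
  refine ⟨C0 ^ (P0 + 1), one_le_pow₀ hC01, fun n hn => ?_⟩
  have hn0 : n ≠ 0 := by omega
  rw [Nat.card_divisors hn0]
  have h1 : ∀ p ∈ n.primeFactors, ((n.factorization p + 1 : ℕ) : ℝ) ≤ (if p ≤ P0 then C0 else 1) * ((p : ℝ) ^ (n.factorization p)) ^ ε := by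
    intro p hp
    have hpp := Nat.prime_of_mem_primeFactors hp
    have hp2 : (2:ℝ) ≤ p := by exact_mod_cast hpp.two_le
    set e := n.factorization p
    have he : ((p:ℝ) ^ e) ^ ε = ((p:ℝ) ^ ε) ^ e := by
      rw [← Real.rpow_natCast, ← Real.rpow_mul (by positivity), mul_comm, Real.rpow_mul (by positivity), Real.rpow_natCast]
    split_ifs with h
    · have h2 : ((2:ℝ) ^ ε) ^ e ≤ ((p:ℝ) ^ e) ^ ε := by
        rw [he]; exact pow_le_pow_left₀ (by positivity) (Real.rpow_le_rpow (by norm_num) hp2 hε.le) _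
      have h3 : 1 + e * (ε * Real.log 2) ≤ ((2:ℝ) ^ ε) ^ e := by
        have h4 : ((2:ℝ) ^ ε) = Real.exp (Real.log 2 * ε) := Real.rpow_def_of_pos (by norm_num) _
        rw [h4, ← Real.exp_nat_mul]
        have := Real.add_one_le_exp ((e:ℝ) * (Real.log 2 * ε))
        linarith
      have h5 : ((e + 1 : ℕ) : ℝ) ≤ C0 * (1 + e * (ε * Real.log 2)) := by
        rw [hC0]; push_cast
        have h6 : 0 < ε * Real.log 2 := by positivity
        have h7 : (1 + 1 / (ε * Real.log 2)) * (1 + e * (ε * Real.log 2)) = 1 + e + (1 / (ε * Real.log 2) + e * (ε * Real.log 2)) := by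
          field_simp; ring
        rw [h7]
        have : 0 ≤ 1 / (ε * Real.log 2) + e * (ε * Real.log 2) := by positivity
        linarith
      exact h5.trans (mul_le_mul_of_nonneg_left (h3.trans h2) (by linarith))
    · rw [one_mul, he]
      have h2 : (2:ℝ) ≤ (p:ℝ) ^ ε := by
        have h3 : (2:ℝ) ^ (1 / ε) ≤ p := (Nat.le_ceil _).trans (by push Not at h; exact_mod_cast h.le)
        calc (2:ℝ) = ((2:ℝ) ^ (1/ε)) ^ ε := by rw [← Real.rpow_mul (by norm_num), one_div, inv_mul_cancel₀ hε.ne', Real.rpow_one]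
          _ ≤ _ := Real.rpow_le_rpow (by positivity) h3 hε.le
      calc ((e + 1 : ℕ) : ℝ) ≤ ((2 ^ e : ℕ) : ℝ) := by exact_mod_cast Nat.lt_two_pow_self
        _ = (2:ℝ) ^ e := by push_cast; rfl
        _ ≤ _ := pow_le_pow_left₀ (by norm_num) h2 _
  push_cast at h1 ⊢
  refine (Finset.prod_le_prod (fun p _ => by positivity) h1).trans ?_
  rw [Finset.prod_mul_distrib]
  have h2 : ∏ p ∈ n.primeFactors, ((p : ℝ) ^ (n.factorization p)) ^ ε = (n:ℝ) ^ ε := by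
    rw [Real.finsetProd_rpow _ _ (fun p _ => by positivity)]
    congr 1
    have := Nat.prod_factorization_pow_eq_self hn0
    conv_rhs => rw [← this]
    rw [Finsupp.prod]; push_cast; rfl
  rw [h2]
  refine mul_le_mul_of_nonneg_right ?_ (by positivity)
  rw [← Finset.prod_filter, Finset.prod_const]
  refine pow_le_pow_right₀ hC01 ?_
  refine (card_le_card (t := range (P0 + 1)) ?_).trans (by simp)
  intro p hp
  rw [mem_filter] at hp
  rw [mem_range]; omega
end DivBound

section KlCRT

theorem kl_mul {m n : ℕ} [NeZero m] [NeZero n] [NeZero (m * n)] (hmn : m.Coprime n) {x y : ℤ} (hxy : x * m + y * n = 1) (a b : ℤ) :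
    kl (m * n) a b = kl m (y * a) (y * b) * kl n (x * a) (x * b) := by
  let φ := ZMod.chineseRemainder hmn
  have hchar : ∀ z : ZMod (m * n), (ZMod.stdAddChar z : ℂ) = ZMod.stdAddChar ((y : ZMod m) * (φ z).1) * ZMod.stdAddChar ((x : ZMod n) * (φ z).2) := by
    intro z
    obtain ⟨Z, rfl⟩ := ZMod.intCast_surjective z
    rw [map_intCast φ]
    have e1 : (y : ZMod m) * ((Z : ZMod m × ZMod n)).1 = ((y * Z : ℤ) : ZMod m) := by push_cast; simp
    have e2 : (x : ZMod n) * ((Z : ZMod m × ZMod n)).2 = ((x * Z : ℤ) : ZMod n) := by push_cast; simp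
    rw [e1, e2, ZMod.stdAddChar_coe, ZMod.stdAddChar_coe, ZMod.stdAddChar_coe, ← Complex.exp_add]
    congr 1
    have hm : (m : ℂ) ≠ 0 := by exact_mod_cast NeZero.ne m
    have hn : (n : ℂ) ≠ 0 := by exact_mod_cast NeZero.ne n
    have hc : (x : ℂ) * m + y * n = 1 := by exact_mod_cast hxy
    push_cast
    field_simp
    linear_combination (-Z : ℂ) * hc
  let Φ : (ZMod (m * n))ˣ ≃* (ZMod m)ˣ × (ZMod n)ˣ := (Units.mapEquiv φ.toMulEquiv).trans MulEquiv.prodUnits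
  have hΦ1 : ∀ u, (((Φ u).1 : (ZMod m)ˣ) : ZMod m) = (φ u).1 := fun u => rfl
  have hΦ2 : ∀ u, (((Φ u).2 : (ZMod n)ˣ) : ZMod n) = (φ u).2 := fun u => rfl
  unfold kl klR
  rw [Finset.sum_mul_sum, ← Finset.sum_product']
  rw [Finset.univ_product_univ, ← Equiv.sum_comp Φ.toEquiv]
  refine Finset.sum_congr rfl fun u _ => ?_
  rw [hchar]
  have h1 : ((Φ u).1⁻¹ : (ZMod m)ˣ) = (Φ u⁻¹).1 := by rw [map_inv]; rfl
  have h2 : ((Φ u).2⁻¹ : (ZMod n)ˣ) = (Φ u⁻¹).2 := by rw [map_inv]; rfl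
  simp only [MulEquiv.toEquiv_eq_coe, EquivLike.coe_coe]
  rw [h1, h2, hΦ1, hΦ1, hΦ2, hΦ2, map_add φ, map_mul φ, map_mul φ, map_intCast φ, map_intCast φ]
  congr 2
  · push_cast; simp only [Prod.fst_add, Prod.fst_mul, Prod.fst_intCast]; ring
  · push_cast; simp only [Prod.snd_add, Prod.snd_mul, Prod.snd_intCast]; ring

theorem kl_tau (c : ℕ) [hc : NeZero c] (a b : ℤ) :
    ‖kl c a b‖ ≤ (#c.divisors : ℝ) ^ 3 * Real.sqrt c * Real.sqrt (Int.gcd b c) := by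
  have main : ∀ c : ℕ, ∀ (h : NeZero c), ∀ a b : ℤ, ‖kl c a b‖ ≤ (#c.divisors : ℝ) ^ 3 * Real.sqrt c * Real.sqrt (Int.gcd b c) := by
    intro c
    induction c using Nat.recOnPosPrimePosCoprime with
    | zero => intro h; exact absurd rfl h.out
    | one =>
      intro h a b
      refine (kl_triv 1 a b).trans ?_
      simp
    | prime_pow p j hp hj =>
      intro h a b
      haveI : Fact p.Prime := ⟨hp⟩
      refine (kl_pp p (j := j) (by omega) a b).trans ?_
      push_cast
      refine mul_le_mul_of_nonneg_right (mul_le_mul_of_nonneg_right ?_ (by positivity)) (by positivity)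
      rw [Nat.divisors_prime_pow hp, card_map, card_range]
      have : (2:ℝ) ≤ ((j + 1 : ℕ) : ℝ) := by exact_mod_cast (by omega)
      calc (8:ℝ) = 2 ^ 3 := by norm_num
        _ ≤ _ := pow_le_pow_left₀ (by norm_num) this 3
    | coprime m n hm hn hmn ihm ihn =>
      intro h a b
      haveI : NeZero m := ⟨by omega⟩
      haveI : NeZero n := ⟨by omega⟩
      have hxy : (Nat.gcdA m n) * m + (Nat.gcdB m n) * n = 1 := by
        have := Nat.gcd_eq_gcd_ab m n
        rw [hmn] at this
        push_cast at this; linarith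
      set x := Nat.gcdA m n
      set y := Nat.gcdB m n
      rw [kl_mul hmn hxy, norm_mul]
      have h1 := ihm ‹_› (y * a) (y * b)
      have h2 := ihn ‹_› (x * a) (x * b)
      have g1 : Int.gcd (y * b) m = Int.gcd b m :=
        Int.gcd_mul_right_left_of_gcd_eq_one (by
          rw [← Int.isCoprime_iff_gcd_eq_one]; exact ⟨n, x, by linarith⟩)
      have g2 : Int.gcd (x * b) n = Int.gcd b n :=
        Int.gcd_mul_right_left_of_gcd_eq_one (by
          rw [← Int.isCoprime_iff_gcd_eq_one]; exact ⟨m, y, by linarith⟩)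
      rw [g1] at h1; rw [g2] at h2
      have g3 : Int.gcd b ((m * n : ℕ) : ℤ) = Int.gcd b m * Int.gcd b n := by
        have := Nat.Coprime.gcd_mul b.natAbs hmn
        exact this
      rw [g3, hmn.card_divisors_mul]
      push_cast
      rw [Real.sqrt_mul (by positivity), Real.sqrt_mul (by positivity)]
      refine (mul_le_mul h1 h2 (norm_nonneg _) (by positivity)).trans (le_of_eq ?_)
      ring
  exact main c hc a b

theorem kl_bound (ε : ℝ) (hε : 0 < ε) : ∃ C : ℝ, 1 ≤ C ∧ ∀ (c : ℕ) [NeZero c] (a b : ℤ),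
    ‖kl c a b‖ ≤ C * (c : ℝ) ^ ε * Real.sqrt c * Real.sqrt (Int.gcd b c) := by
  obtain ⟨C, hC, h⟩ := divisor_bound (ε / 3) (by positivity)
  refine ⟨C ^ 3, one_le_pow₀ hC, fun c _ a b => ?_⟩
  refine (kl_tau c a b).trans ?_
  refine mul_le_mul_of_nonneg_right (mul_le_mul_of_nonneg_right ?_ (by positivity)) (by positivity)
  refine (pow_le_pow_left₀ (by positivity) (h c (NeZero.one_le)) 3).trans (le_of_eq ?_)
  rw [mul_pow, ← Real.rpow_natCast ((c:ℝ) ^ (ε/3)), ← Real.rpow_mul (by positivity)]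
  congr 2; push_cast; ring
end KlCRT

section D1

noncomputable def qf (a : ℕ → ℂ) (z : ℂ) : ℂ :=
  ∑' n : ℕ, a (n + 1) * Complex.exp (2 * Real.pi * Complex.I * (n + 1) * z)

structure EF (k : ℕ) (a : ℕ → ℂ) : Prop where
  ek : Even k
  k12 : 12 ≤ k
  a1 : a 1 = 1
  hecke : ∀ m n : ℕ, 1 ≤ m → 1 ≤ n →
    a m * a n = ∑ d ∈ (Nat.gcd m n).divisors, (d : ℂ) ^ (k - 1) * a (m * n / d ^ 2)
  summ : ∀ y : ℝ, 0 < y → Summable fun n : ℕ => ‖a (n + 1)‖ * Real.exp (-(2 * Real.pi * (n + 1) * y))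
  trans : ∀ (α β c d : ℤ), α * d - β * c = 1 → ∀ z : ℂ, 0 < z.im →
    0 < ((α * z + β) / (c * z + d)).im ∧
    qf a ((α * z + β) / (c * z + d)) = (c * z + d) ^ k * qf a z
  fd : ∀ z : ℂ, 0 < z.im → ∃ w : ℂ, 3 / 4 ≤ w.im ^ 2 ∧ 0 < w.im ∧
    ‖qf a z‖ * z.im ^ ((k:ℝ) / 2) = ‖qf a w‖ * w.im ^ ((k:ℝ) / 2)
  bdd : ∃ B : ℝ, ∀ z : ℂ, 0 < z.im → ‖qf a z‖ * z.im ^ ((k : ℝ) / 2) ≤ B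

theorem norm_qterm (a : ℕ → ℂ) (n : ℕ) (z : ℂ) :
    ‖a (n + 1) * Complex.exp (2 * Real.pi * Complex.I * (n + 1) * z)‖
      = ‖a (n + 1)‖ * Real.exp (-(2 * Real.pi * (n + 1) * z.im)) := by
  rw [norm_mul, Complex.norm_exp]
  congr 2
  simp [Complex.mul_re, Complex.mul_im]

open UpperHalfPlane in
theorem EF_of {k : ℕ} {a : ℕ → ℂ} (h : IsNormalizedHeckeEigenform k a) : EF k a := by
  obtain ⟨ek, k12, ⟨F, hF0, hF⟩, a1, hecke⟩ := h
  have hFq : ∀ z : ℍ, F z = qf a z := fun z => hF z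
  have htr : ∀ (γ : Matrix.SpecialLinearGroup (Fin 2) ℤ) (z : ℍ), F (γ • z) = (denom γ z) ^ k * F z := by
    intro γ z
    have := SlashInvariantForm.slash_action_eqn_SL'' F (CongruenceSubgroup.mem_Gamma_one γ) z
    exact_mod_cast this
  have tr2 : ∀ (α β c d : ℤ), α * d - β * c = 1 → ∀ z : ℍ, ∃ w : ℍ,
      (w : ℂ) = (α * z + β) / (c * z + d) ∧ w.im = z.im / Complex.normSq (c * z + d) ∧
      F w = (c * z + d) ^ k * F z := by
    intro α β c d hdet z
    let γ : Matrix.SpecialLinearGroup (Fin 2) ℤ := ⟨!![α, β; c, d], by rw [Matrix.det_fin_two_of]; exact hdet⟩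
    refine ⟨γ • z, ?_, ?_, ?_⟩
    · rw [UpperHalfPlane.specialLinearGroup_apply]
      simp [γ]
    · rw [ModularGroup.im_smul_eq_div_normSq, ModularGroup.denom_apply]
      simp [γ]
    · rw [htr, ModularGroup.denom_apply]
      simp [γ]
  have summ : ∀ y : ℝ, 0 < y → Summable fun n : ℕ => ‖a (n + 1)‖ * Real.exp (-(2 * Real.pi * (n + 1) * y)) := by
    intro y hy
    by_contra hns
    apply hF0
    have hlow : ∀ z : ℍ, z.im ≤ y → F z = 0 := by
      intro z hz
      rw [hF]
      apply tsum_eq_zero_of_not_summable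
      intro hs
      apply hns
      have hs' := hs.norm
      refine Summable.of_nonneg_of_le (fun n => by positivity) (fun n => ?_) hs'
      rw [norm_qterm]
      have : 0 ≤ 2 * Real.pi * ((n : ℝ) + 1) := by positivity
      have hz' : ((z : ℂ)).im = z.im := rfl
      rw [hz']
      gcongr
    ext z
    obtain ⟨n, hn⟩ := exists_nat_gt (|z.re| + 1 + z.im / y)
    obtain ⟨w, hw1, hw2, hw3⟩ := tr2 0 (-1) 1 n (by ring) z
    have hden : (((1:ℤ) : ℂ) * z + ((n:ℤ):ℂ)) ≠ 0 := by
      intro h0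
      have := congrArg Complex.im h0
      simp at this
      exact z.im_ne_zero this
    have hw : w.im ≤ y := by
      rw [hw2]
      have hn1 : Complex.normSq (((1:ℤ) : ℂ) * z + ((n:ℤ):ℂ)) ≥ (z.re + n) ^ 2 := by
        rw [Complex.normSq_apply]
        simp
        nlinarith [mul_self_nonneg z.im]
      have h1 : 1 + z.im / y ≤ z.re + n := by
        have := neg_abs_le z.re
        linarith
      have h0 : 0 ≤ z.im / y := by have := z.im_pos; positivity
      have h2 : z.im / y ≤ (z.re + n) ^ 2 := by nlinarith
      rw [div_le_iff₀ (by rw [Complex.normSq_pos]; exact hden)]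
      have : z.im ≤ (z.re + n) ^ 2 * y := by rwa [div_le_iff₀ hy] at h2
      nlinarith
    rw [hlow w hw] at hw3
    have := (mul_eq_zero.mp hw3.symm).resolve_left (pow_ne_zero _ hden)
    simpa using this
  refine ⟨ek, k12, a1, hecke, summ, ?_, ?_, ?_⟩
  · intro α β c d hdet z hz
    obtain ⟨w, hw1, hw2, hw3⟩ := tr2 α β c d hdet ⟨z, hz⟩
    rw [hFq, hFq, hw1] at hw3
    refine ⟨?_, hw3⟩
    have : 0 < (w : ℂ).im := w.im_pos
    rw [hw1] at this
    exact this
  · intro z hz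
    obtain ⟨g, hg⟩ := ModularGroup.exists_smul_mem_fd ⟨z, hz⟩
    refine ⟨((g • (⟨z, hz⟩ : ℍ) : ℍ) : ℂ), ?_, (g • (⟨z, hz⟩ : ℍ) : ℍ).im_pos, ?_⟩
    · have := ModularGroup.three_le_four_mul_im_sq_of_mem_fd hg
      have e : ((g • (⟨z, hz⟩ : ℍ) : ℍ) : ℂ).im = (g • (⟨z, hz⟩ : ℍ) : ℍ).im := rfl
      rw [e]; linarith
    · rw [← hFq, htr, norm_mul, norm_pow]
      have e : ((g • (⟨z, hz⟩ : ℍ) : ℍ) : ℂ).im = (g • (⟨z, hz⟩ : ℍ) : ℍ).im := rfl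
      rw [e, ModularGroup.im_smul_eq_div_normSq]
      have hd : 0 < ‖denom g (⟨z, hz⟩ : ℍ)‖ := norm_pos_iff.mpr (denom_ne_zero _ _)
      rw [Complex.normSq_eq_norm_sq, Real.div_rpow (le_of_lt (UpperHalfPlane.im_pos _)) (by positivity),
        ← Real.rpow_natCast _ 2, ← Real.rpow_mul hd.le]
      have : ((2:ℕ):ℝ) * ((k:ℝ)/2) = (k:ℕ) := by push_cast; ring
      rw [this, Real.rpow_natCast, hFq]
      have e2 : (⟨z, hz⟩ : ℍ).im = z.im := rfl
      rw [e2]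
      have e3 : ((⟨z, hz⟩ : ℍ) : ℂ) = z := rfl
      rw [e3]
      field_simp
  · obtain ⟨C, hC⟩ := CuspFormClass.exists_bound F
    refine ⟨C, fun z hz => ?_⟩
    have := hC ⟨z, hz⟩
    rw [hFq] at this
    have e2 : (⟨z, hz⟩ : ℍ).im = z.im := rfl
    rw [e2, le_div_iff₀ (by positivity)] at this
    simpa using this

end D1

section D2

theorem disc_parseval (c : ℕ → ℂ) (N : ℕ) (hN : 0 < N) :
    ∑ j ∈ range N, ‖∑ n ∈ range N, c n * Complex.exp (2 * Real.pi * Complex.I * (n + 1) * ((j / N : ℝ) : ℂ))‖ ^ 2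
      = N * ∑ n ∈ range N, ‖c n‖ ^ 2 := by
  have hN' : (N : ℂ) ≠ 0 := by exact_mod_cast hN.ne'
  have orth : ∀ n ∈ range N, ∀ m ∈ range N,
      ∑ j ∈ range N, (Complex.exp (2 * Real.pi * Complex.I * ((n : ℂ) - m) / N)) ^ j = if n = m then (N : ℂ) else 0 := by
    intro n hn m hm
    split_ifs with hnm
    · subst hnm; simp
    · have h1 : Complex.exp (2 * Real.pi * Complex.I * ((n : ℂ) - m) / N) ≠ 1 := by
        intro h
        rw [Complex.exp_eq_one_iff] at h
        obtain ⟨t, ht⟩ := h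
        have hp : (2 * Real.pi * Complex.I : ℂ) ≠ 0 := Complex.two_pi_I_ne_zero
        have h2 : ((n : ℂ) - m) = t * N := by
          field_simp at ht
          linear_combination ht
        have h3 : (n : ℤ) - m = t * N := by exact_mod_cast h2
        rw [mem_range] at hn hm
        have h4 : |(n : ℤ) - m| < N := by rw [abs_lt]; constructor <;> omega
        rw [h3, abs_mul] at h4
        have : |t| < 1 := by
          by_contra hh
          push Not at hh
          have : (1:ℤ) * |(N:ℤ)| ≤ |t| * |(N:ℤ)| := mul_le_mul_of_nonneg_right hh (abs_nonneg _)
          rw [one_mul, Nat.abs_cast] at this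
          rw [Nat.abs_cast] at h4
          omega
        have t0 : t = 0 := Int.abs_lt_one_iff.mp this
        rw [t0] at h3
        omega
      rw [geom_sum_eq h1, ← Complex.exp_nat_mul]
      have : Complex.exp (N * (2 * Real.pi * Complex.I * ((n : ℂ) - m) / N)) = 1 := by
        rw [Complex.exp_eq_one_iff]
        exact ⟨(n : ℤ) - m, by push_cast; field_simp⟩
      rw [this]; simp
  apply Complex.ofReal_injective
  push_cast
  have key : ∀ j : ℕ, ((‖∑ n ∈ range N, c n * Complex.exp (2 * Real.pi * Complex.I * (n + 1) * ((j : ℂ) / N))‖ : ℂ)) ^ 2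
     = ∑ n ∈ range N, ∑ m ∈ range N, c n * (starRingEnd ℂ) (c m) * (Complex.exp (2 * Real.pi * Complex.I * ((n : ℂ) - m) / N)) ^ j := by
    intro j
    rw [← Complex.mul_conj', map_sum, Finset.sum_mul_sum]
    refine Finset.sum_congr rfl fun n _ => Finset.sum_congr rfl fun m _ => ?_
    rw [map_mul, ← Complex.exp_conj, ← Complex.exp_nat_mul]
    have : c n * Complex.exp (2 * Real.pi * Complex.I * (n + 1) * ((j : ℂ) / N)) * ((starRingEnd ℂ) (c m) * Complex.exp ((starRingEnd ℂ) (2 * Real.pi * Complex.I * (m + 1) * ((j : ℂ) / N))))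
      = c n * (starRingEnd ℂ) (c m) * (Complex.exp (2 * Real.pi * Complex.I * (n + 1) * ((j : ℂ) / N)) * Complex.exp ((starRingEnd ℂ) (2 * Real.pi * Complex.I * (m + 1) * ((j : ℂ) / N)))) := by ring
    rw [this, ← Complex.exp_add]
    congr 2
    have c2 : (starRingEnd ℂ) (2 : ℂ) = 2 := map_ofNat _ 2
    simp [c2]
    ring
  calc _ = ∑ j ∈ range N, ∑ n ∈ range N, ∑ m ∈ range N, c n * (starRingEnd ℂ) (c m) * (Complex.exp (2 * Real.pi * Complex.I * ((n : ℂ) - m) / N)) ^ j :=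
        Finset.sum_congr rfl fun j _ => key j
    _ = ∑ n ∈ range N, ∑ m ∈ range N, ∑ j ∈ range N, c n * (starRingEnd ℂ) (c m) * (Complex.exp (2 * Real.pi * Complex.I * ((n : ℂ) - m) / N)) ^ j := by
        rw [Finset.sum_comm]
        exact Finset.sum_congr rfl fun n _ => Finset.sum_comm
    _ = ∑ n ∈ range N, ∑ m ∈ range N, c n * (starRingEnd ℂ) (c m) * (if n = m then (N : ℂ) else 0) := by
        refine Finset.sum_congr rfl fun n hn => Finset.sum_congr rfl fun m hm => ?_
        rw [← Finset.mul_sum, orth n hn m hm]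
    _ = _ := by
        rw [Finset.mul_sum]
        refine Finset.sum_congr rfl fun n hn => ?_
        simp only [mul_ite, mul_zero]
        rw [Finset.sum_ite_eq, if_pos hn, Complex.mul_conj']
        ring

theorem EF.parseval {k : ℕ} {a : ℕ → ℂ} (E : EF k a) (y : ℝ) (hy : 0 < y) (M : ℝ)
    (hM : ∀ z : ℂ, z.im = y → ‖qf a z‖ ≤ M) (N : ℕ) :
    ∑ n ∈ range N, (‖a (n + 1)‖ * Real.exp (-(2 * Real.pi * (n + 1) * y))) ^ 2 ≤ M ^ 2 := by
  set t : ℕ → ℝ := fun n => ‖a (n + 1)‖ * Real.exp (-(2 * Real.pi * (n + 1) * y)) with ht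
  have hs := E.summ y hy
  have hM0 : 0 ≤ M := (norm_nonneg _).trans (hM (y * Complex.I) (by simp))
  have tail := tendsto_sum_nat_add t
  have ineq : ∀ N' : ℕ, N ≤ N' → 0 < N' → ∑ n ∈ range N, t n ^ 2 ≤ (M + ∑' i, t (i + N')) ^ 2 := by
    intro N' hNN h0
    have hN0 : (0:ℝ) < N' := by exact_mod_cast h0
    let c : ℕ → ℂ := fun n => a (n + 1) * Real.exp (-(2 * Real.pi * (n + 1) * y))
    have hc : ∀ n, ‖c n‖ = t n := by
      intro n
      simp only [c, t, norm_mul, Complex.norm_real, Real.norm_eq_abs, Real.abs_exp]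
    have hP := disc_parseval c N' h0
    have hle : ∀ j : ℕ, ‖∑ n ∈ range N', c n * Complex.exp (2 * Real.pi * Complex.I * (n + 1) * ((j / N' : ℝ) : ℂ))‖ ≤ M + ∑' i, t (i + N') := by
      intro j
      set x : ℝ := j / N'
      set g : ℕ → ℂ := fun n => c n * Complex.exp (2 * Real.pi * Complex.I * (n + 1) * (x : ℂ)) with hg
      have hgn : ∀ n, ‖g n‖ = t n := by
        intro n
        rw [hg]; dsimp only
        rw [norm_mul, hc, Complex.norm_exp]
        simp
      have hgs : Summable g := Summable.of_norm (by simp_rw [hgn]; exact hs)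
      have hq : qf a (x + y * Complex.I) = ∑' n, g n := by
        unfold qf
        refine tsum_congr fun n => ?_
        rw [hg]; dsimp only [c]
        rw [Complex.ofReal_exp, mul_assoc (a (n+1)), ← Complex.exp_add]
        congr 2
        push_cast
        linear_combination (2 * Real.pi * (n + 1) * y : ℂ) * Complex.I_sq
      have h1 := hgs.sum_add_tsum_nat_add N'
      have h2 : ∑ n ∈ range N', g n = qf a (x + y * Complex.I) - ∑' i, g (i + N') := by
        rw [hq, ← h1]; ring
      rw [h2]
      refine (norm_sub_le _ _).trans (add_le_add (hM _ (by simp)) ?_)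
      have := norm_tsum_le_tsum_norm (f := fun i => g (i + N')) (by simp_rw [hgn]; exact (summable_nat_add_iff N').mpr hs)
      simpa only [hgn] using this
    have hsum : (N' : ℝ) * ∑ n ∈ range N', ‖c n‖ ^ 2 ≤ N' * (M + ∑' i, t (i + N')) ^ 2 := by
      rw [← hP]
      refine (Finset.sum_le_sum fun j _ => pow_le_pow_left₀ (norm_nonneg _) (hle j) 2).trans ?_
      simp
    have h3 := le_of_mul_le_mul_left hsum hN0
    simp_rw [hc] at h3
    refine le_trans ?_ h3
    exact Finset.sum_le_sum_of_subset_of_nonneg (Finset.range_mono hNN) (fun _ _ _ => sq_nonneg _)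
  have lim : Filter.Tendsto (fun N' => (M + ∑' i, t (i + N')) ^ 2) Filter.atTop (nhds ((M + 0) ^ 2)) :=
    (tail.const_add M).pow 2
  rw [add_zero] at lim
  refine ge_of_tendsto lim ?_
  filter_upwards [Filter.eventually_ge_atTop (N + 1)] with N' h
  exact ineq N' (by omega) (by omega)

end D2

section D3

noncomputable def lam (k : ℕ) (a : ℕ → ℂ) (n : ℕ) : ℝ := ‖a n‖ * (n : ℝ) ^ (-(((k : ℝ) - 1) / 2))

theorem lam_nonneg (k : ℕ) (a : ℕ → ℂ) (n : ℕ) : 0 ≤ lam k a n := by unfold lam; positivity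

theorem norm_eq_lam (k : ℕ) (a : ℕ → ℂ) (n : ℕ) (hn : 1 ≤ n) :
    ‖a n‖ = lam k a n * (n : ℝ) ^ (((k : ℝ) - 1) / 2) := by
  unfold lam
  have : (0:ℝ) < n := by exact_mod_cast hn
  rw [mul_assoc, ← Real.rpow_add this]; simp

theorem EF.lam_hecke {k : ℕ} {a : ℕ → ℂ} (E : EF k a) (m n : ℕ) (hm : 1 ≤ m) (hn : 1 ≤ n) :
    lam k a m * lam k a n ≤ ∑ d ∈ (Nat.gcd m n).divisors, lam k a (m * n / d ^ 2) := by
  have h := congrArg norm (E.hecke m n hm hn)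
  rw [norm_mul] at h
  have h2 := h.trans_le (norm_sum_le _ _)
  have hmp : (0:ℝ) < m := by exact_mod_cast hm
  have hnp : (0:ℝ) < n := by exact_mod_cast hn
  set s := ((k : ℝ) - 1) / 2 with hs
  have e1 : lam k a m * lam k a n = ‖a m‖ * ‖a n‖ * ((m * n : ℝ) ^ (-s)) := by
    unfold lam; rw [Real.mul_rpow hmp.le hnp.le]; ring
  rw [e1]
  refine (mul_le_mul_of_nonneg_right h2 (by positivity)).trans (le_of_eq ?_)
  rw [Finset.sum_mul]
  refine Finset.sum_congr rfl fun d hd => ?_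
  have hd' := Nat.dvd_of_mem_divisors hd
  have hdp : 0 < d := Nat.pos_of_mem_divisors hd
  have hdpr : (0:ℝ) < d := by exact_mod_cast hdp
  have hdd : d ^ 2 ∣ m * n := by
    rw [sq]; exact mul_dvd_mul (hd'.trans (Nat.gcd_dvd_left _ _)) (hd'.trans (Nat.gcd_dvd_right _ _))
  obtain ⟨l, hl⟩ := hdd
  have hl2 : m * n / d ^ 2 = l := by rw [hl]; exact Nat.mul_div_cancel_left _ (by positivity)
  rw [hl2]
  unfold lam
  have : (m * n : ℝ) = d ^ 2 * l := by exact_mod_cast hl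
  rw [this, Real.mul_rpow (by positivity) (by positivity), norm_mul, norm_pow, Complex.norm_natCast]
  have e2 : ((d : ℝ) ^ (k - 1)) * ((d : ℝ) ^ 2) ^ (-s) = 1 := by
    rw [← Real.rpow_natCast, ← Real.rpow_natCast, ← Real.rpow_mul hdpr.le, ← Real.rpow_add hdpr]
    have : ((k - 1 : ℕ) : ℝ) + ((2:ℕ):ℝ) * -s = 0 := by
      rw [Nat.cast_sub (by have := E.k12; omega), hs]; push_cast; ring
    rw [this, Real.rpow_zero]
  calc _ = (((d : ℝ) ^ (k - 1)) * ((d : ℝ) ^ 2) ^ (-s)) * (‖a l‖ * (l:ℝ) ^ (-s)) := by ring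
    _ = _ := by rw [e2, one_mul]

noncomputable def nk (k : ℕ) : ℝ := ((k : ℝ) / (4 * Real.pi)) ^ ((k : ℝ) / 2) * Real.exp (-((k:ℝ) / 2))

theorem nk_pos (k : ℕ) (hk : 0 < k) : 0 < nk k := by
  have : (0:ℝ) < k := by exact_mod_cast hk
  have := Real.pi_pos
  unfold nk; positivity

noncomputable def beta (k : ℕ) (a : ℕ → ℂ) (n : ℕ) : ℝ := lam k a n * (n : ℝ) ^ (-(1:ℝ) / 2)

theorem beta_nonneg (k : ℕ) (a : ℕ → ℂ) (n : ℕ) : 0 ≤ beta k a n := by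
  unfold beta; have := lam_nonneg k a n; positivity

theorem tid (k : ℕ) (hk : 0 < k) (a : ℕ → ℂ) (n : ℕ) (hn : 1 ≤ n) (y : ℝ) (hy : 0 < y) :
    ‖a n‖ * Real.exp (-(2 * Real.pi * n * y)) * y ^ ((k:ℝ)/2) =
      nk k * (beta k a n * (4 * Real.pi * n * y / k * Real.exp (1 - 4 * Real.pi * n * y / k)) ^ ((k:ℝ)/2)) := by
  have hkp : (0:ℝ) < k := by exact_mod_cast hk
  have hnp : (0:ℝ) < n := by exact_mod_cast hn
  have hp := Real.pi_pos
  rw [norm_eq_lam k a n hn]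
  unfold beta nk
  rw [Real.mul_rpow (by positivity) (by positivity), ← Real.exp_mul]
  have e1 : 4 * Real.pi * n * y / k = (n * y) * ((k : ℝ) / (4 * Real.pi))⁻¹ := by field_simp
  have e2 : (4 * Real.pi * n * y / k) ^ ((k:ℝ)/2) = (n:ℝ) ^ ((k:ℝ)/2) * y ^ ((k:ℝ)/2) * (((k : ℝ) / (4 * Real.pi)) ^ ((k : ℝ) / 2))⁻¹ := by
    rw [e1, Real.mul_rpow (by positivity) (by positivity), Real.mul_rpow (by positivity) (by positivity), Real.inv_rpow (by positivity)]
  have e3 : (n:ℝ) ^ (((k : ℝ) - 1) / 2) = (n : ℝ) ^ (-(1:ℝ) / 2) * (n:ℝ) ^ ((k:ℝ)/2) := by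
    rw [← Real.rpow_add hnp]; congr 1; ring
  have e4 : Real.exp (-(2 * Real.pi * n * y)) = Real.exp (-((k:ℝ) / 2)) * Real.exp ((1 - 4 * Real.pi * n * y / k) * ((k:ℝ)/2)) := by
    rw [← Real.exp_add]; congr 1; field_simp; ring
  rw [e2, e3, e4]
  have : 0 < ((k : ℝ) / (4 * Real.pi)) ^ ((k : ℝ) / 2) := by positivity
  field_simp

/-- Parseval in normalized form -/
theorem EF.parseval' {k : ℕ} {a : ℕ → ℂ} (E : EF k a) (b : ℝ) (hb : 0 ≤ b)
    (hB : ∀ z : ℂ, 0 < z.im → ‖qf a z‖ * z.im ^ ((k:ℝ)/2) ≤ nk k * b) (Y : ℝ) (hY : 0 < Y) (N : ℕ) :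
    ∑ n ∈ range N, (beta k a (n + 1) * (((n + 1 : ℕ) : ℝ) / Y * Real.exp (1 - ((n + 1 : ℕ) : ℝ) / Y)) ^ ((k:ℝ)/2)) ^ 2 ≤ b ^ 2 := by
  have hk : 0 < k := by have := E.k12; omega
  have hkp : (0:ℝ) < k := by exact_mod_cast hk
  have hp := Real.pi_pos
  set y : ℝ := k / (4 * Real.pi * Y) with hy
  have hy0 : 0 < y := by positivity
  have hyk : 0 < y ^ ((k:ℝ)/2) := by positivity
  have h1 := E.parseval y hy0 (nk k * b / y ^ ((k:ℝ)/2)) (fun z hz => by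
    rw [le_div_iff₀ hyk, ← hz]; exact hB z (by rw [hz]; exact hy0)) N
  have hnk := nk_pos k hk
  have e : ∀ n : ℕ, (‖a (n + 1)‖ * Real.exp (-(2 * Real.pi * (n + 1) * y))) =
     (nk k / y ^ ((k:ℝ)/2)) * (beta k a (n + 1) * (((n + 1 : ℕ) : ℝ) / Y * Real.exp (1 - ((n + 1 : ℕ) : ℝ) / Y)) ^ ((k:ℝ)/2)) := by
    intro n
    have := tid k hk a (n+1) (by omega) y hy0
    have e1 : 4 * Real.pi * ((n + 1 : ℕ) : ℝ) * y / k = ((n + 1 : ℕ) : ℝ) / Y := by rw [hy]; field_simp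
    rw [e1] at this
    rw [div_mul_eq_mul_div, eq_div_iff hyk.ne', ← this]
    push_cast; ring
  simp_rw [e, mul_pow _ (beta _ _ _ * _)] at h1
  rw [← Finset.mul_sum] at h1
  have e2 : (nk k * b / y ^ ((k:ℝ)/2)) ^ 2 = (nk k / y ^ ((k:ℝ)/2)) ^ 2 * b ^ 2 := by ring
  rw [e2] at h1
  exact le_of_mul_le_mul_left h1 (by positivity)

theorem W_le_one (v s : ℝ) (hv : 0 ≤ v) (hs : 0 ≤ s) : (v * Real.exp (1 - v)) ^ s ≤ 1 := by
  apply Real.rpow_le_one (by positivity) _ hs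
  have h := Real.add_one_le_exp (v - 1)
  rw [show 1 - v = -(v-1) by ring, Real.exp_neg, ← div_eq_mul_inv, div_le_one (Real.exp_pos _)]
  linarith

theorem W_tail (v s : ℝ) (hv : 10 ≤ v) (hs : 0 ≤ s) : (v * Real.exp (1 - v)) ^ s ≤ Real.exp (-(v / 2 * s)) := by
  have : v * Real.exp (1 - v) ≤ Real.exp (-(v/2)) := by
    have h1 : Real.exp (1 - v) = Real.exp (-(v/2)) * Real.exp (1 - v/2) := by rw [← Real.exp_add]; congr 1; ring
    rw [h1]
    have h2 : v * Real.exp (1 - v / 2) ≤ 1 := by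
      rw [show 1 - v/2 = -(v/2-1) by ring, Real.exp_neg, ← div_eq_mul_inv, div_le_one (Real.exp_pos _)]
      have h3 := Real.quadratic_le_exp_of_nonneg (show 0 ≤ v/2 - 1 by linarith)
      nlinarith
    calc v * (Real.exp (-(v/2)) * Real.exp (1 - v/2)) = Real.exp (-(v/2)) * (v * Real.exp (1 - v/2)) := by ring
      _ ≤ Real.exp (-(v/2)) * 1 := by gcongr
      _ = _ := mul_one _
  refine (Real.rpow_le_rpow (by positivity) this hs).trans (le_of_eq ?_)
  rw [← Real.exp_mul]; congr 1; ring

theorem EF.exists_b {k : ℕ} {a : ℕ → ℂ} (E : EF k a) : ∃ b : ℝ, 0 ≤ b ∧ b ≤ 4 * (k:ℝ) ^ 3 ∧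
    (∀ z : ℂ, 0 < z.im → ‖qf a z‖ * z.im ^ ((k:ℝ)/2) ≤ nk k * b) := by
  have hk : 0 < k := by have := E.k12; omega
  have hkp : (0:ℝ) < k := by exact_mod_cast hk
  have hp := Real.pi_pos
  have hnk := nk_pos k hk
  let S : Set ℝ := (fun z : ℂ => ‖qf a z‖ * z.im ^ ((k:ℝ)/2)) '' {z | 0 < z.im}
  have hSne : S.Nonempty := ⟨_, Complex.I, by simp, rfl⟩
  have hSb : BddAbove S := by
    obtain ⟨B, hB⟩ := E.bdd
    exact ⟨B, by rintro _ ⟨z, hz, rfl⟩; exact hB z hz⟩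
  set b : ℝ := sSup S / nk k with hb
  have hB : ∀ z : ℂ, 0 < z.im → ‖qf a z‖ * z.im ^ ((k:ℝ)/2) ≤ nk k * b := by
    intro z hz
    rw [hb, mul_div_cancel₀ _ hnk.ne']
    exact le_csSup hSb ⟨z, hz, rfl⟩
  have hb0 : 0 ≤ b := by
    have := hB Complex.I (by simp)
    by_contra hneg
    push Not at hneg
    have h2 : nk k * b < 0 := mul_neg_of_pos_of_neg hnk hneg
    have : 0 ≤ ‖qf a Complex.I‖ * (Complex.I).im ^ ((k:ℝ)/2) := by simp
    linarith
  refine ⟨b, hb0, ?_, hB⟩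
  have hbeta : ∀ n, 1 ≤ n → beta k a n ≤ b := by
    intro n hn
    have hnp : (0:ℝ) < n := by exact_mod_cast hn
    have := E.parseval' b hb0 hB n hnp n
    obtain ⟨m, rfl⟩ : ∃ m, n = m + 1 := ⟨n - 1, by omega⟩
    have h2 := Finset.single_le_sum (f := fun n => (beta k a (n + 1) * (((n + 1 : ℕ) : ℝ) / ((m+1 : ℕ):ℝ) * Real.exp (1 - ((n + 1 : ℕ) : ℝ) / ((m+1:ℕ):ℝ))) ^ ((k:ℝ)/2)) ^ 2) (fun i _ => sq_nonneg _) (Finset.self_mem_range_succ m)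
    have h3 := h2.trans this
    rw [div_self hnp.ne'] at h3
    simp at h3
    exact (pow_le_pow_iff_left₀ (beta_nonneg _ _ _) hb0 (by norm_num)).mp h3
  have hfd : b ≤ (∑ n ∈ range k, beta k a (n + 1)) + b / 2 := by
    rw [hb, div_le_iff₀ hnk, ← hb]
    apply csSup_le hSne
    rintro _ ⟨z, hz, rfl⟩
    obtain ⟨w, hw1, hw0, hw2⟩ := E.fd z hz
    dsimp only
    rw [hw2]
    set y := w.im
    have hy : (433:ℝ)/500 ≤ y := by nlinarith
    have hsum := E.summ y hw0
    have h1 : ‖qf a w‖ ≤ ∑' n : ℕ, ‖a (n + 1)‖ * Real.exp (-(2 * Real.pi * (n + 1) * y)) := by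
      unfold qf
      have := norm_tsum_le_tsum_norm (f := fun n : ℕ => a (n + 1) * Complex.exp (2 * Real.pi * Complex.I * (n + 1) * w)) (by simp_rw [norm_qterm]; exact hsum)
      simpa only [norm_qterm] using this
    refine (mul_le_mul_of_nonneg_right h1 (by positivity)).trans ?_
    rw [← tsum_mul_right]
    have hterm : ∀ n : ℕ, ‖a (n + 1)‖ * Real.exp (-(2 * Real.pi * (n + 1) * y)) * y ^ ((k:ℝ)/2) ≤
        (if n ∈ range k then nk k * beta k a (n + 1) else 0) + nk k * b * ((1/3 : ℝ) * (1/3) ^ n) := by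
      intro n
      have := tid k hk a (n+1) (by omega) y hw0
      have e : ((n + 1 : ℕ) : ℝ) = (n : ℝ) + 1 := by push_cast; ring
      rw [e] at this
      rw [this]
      have hbn := beta_nonneg k a (n+1)
      have hv : 0 ≤ 4 * Real.pi * ((n:ℝ) + 1) * y / k := by positivity
      split_ifs with hn
      · have h2 := W_le_one (4 * Real.pi * ((n:ℝ) + 1) * y / k) ((k:ℝ)/2) hv (by positivity)
        have : nk k * (beta k a (n+1) * (4 * Real.pi * ((n:ℝ) + 1) * y / k * Real.exp (1 - 4 * Real.pi * ((n:ℝ) + 1) * y / k)) ^ ((k:ℝ)/2)) ≤ nk k * (beta k a (n+1) * 1) := by gcongr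
        have h3 : 0 ≤ nk k * b * ((1/3 : ℝ) * (1/3) ^ n) := by positivity
        linarith
      · rw [zero_add, mul_assoc (nk k)]
        rw [mem_range, not_lt] at hn
        have hn' : (k:ℝ) ≤ n := by exact_mod_cast hn
        have hpi := Real.pi_gt_three
        have hv10 : 10 ≤ 4 * Real.pi * ((n:ℝ) + 1) * y / k := by
          rw [le_div_iff₀ hkp]
          have : 10 ≤ 4 * Real.pi * y := by nlinarith
          nlinarith
        have h2 := W_tail _ ((k:ℝ)/2) hv10 (by positivity)
        have e2 : 4 * Real.pi * ((n:ℝ) + 1) * y / k / 2 * ((k:ℝ)/2) = Real.pi * y * ((n:ℝ) + 1) := by field_simp; ring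
        rw [e2] at h2
        have h3 : Real.exp (-(Real.pi * y * ((n:ℝ) + 1))) ≤ (1/3 : ℝ) * (1/3) ^ n := by
          have h4 : Real.exp (-(Real.pi * y * ((n:ℝ) + 1))) ≤ Real.exp (-2 * ((n + 1 : ℕ) : ℝ)) := by
            apply Real.exp_le_exp.mpr
            have : 2 ≤ Real.pi * y := by nlinarith
            push_cast; nlinarith
          refine h4.trans ?_
          rw [mul_comm (-2 : ℝ), Real.exp_nat_mul, pow_succ']
          have h5 : Real.exp (-2) ≤ 1/3 := by
            rw [Real.exp_neg, inv_le_comm₀ (Real.exp_pos _) (by norm_num)]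
            have := Real.add_one_le_exp (2:ℝ)
            linarith
          gcongr
        exact mul_le_mul_of_nonneg_left (mul_le_mul (hbeta _ (by omega)) (h2.trans h3) (by positivity) hb0) hnk.le
    have hs1 : Summable (fun n : ℕ => (if n ∈ range k then nk k * beta k a (n + 1) else 0)) :=
      summable_of_ne_finset_zero (s := range k) (fun n hn => by rw [if_neg hn])
    have hs2 : Summable (fun n : ℕ => nk k * b * ((1/3 : ℝ) * (1/3) ^ n)) :=
      ((summable_geometric_of_lt_one (by norm_num) (by norm_num)).mul_left _).mul_left _
    refine (Summable.tsum_le_tsum hterm (hsum.mul_right _) (hs1.add hs2)).trans (le_of_eq ?_)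
    rw [hs1.tsum_add hs2, tsum_eq_sum (s := range k) (fun n hn => by rw [if_neg hn]), tsum_mul_left, tsum_mul_left, tsum_geometric_of_lt_one (by norm_num) (by norm_num)]
    rw [Finset.sum_congr rfl (fun n hn => if_pos hn), ← Finset.mul_sum]
    ring
  have hlam : ∀ n, 1 ≤ n → lam k a n ≤ b * (n:ℝ) ^ ((1:ℝ)/2) := by
    intro n hn
    have hnp : (0:ℝ) < n := by exact_mod_cast hn
    have h := hbeta n hn
    unfold beta at h
    have e : lam k a n = lam k a n * (n : ℝ) ^ (-(1:ℝ) / 2) * (n:ℝ) ^ ((1:ℝ)/2) := by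
      rw [mul_assoc, ← Real.rpow_add hnp]; norm_num
    rw [e]; gcongr
  have hsq : ∀ n ∈ range k, beta k a (n + 1) ≤ Real.sqrt (b * k) := by
    intro n hn
    rw [mem_range] at hn
    apply Real.le_sqrt_of_sq_le
    have h1 := E.lam_hecke (n+1) (n+1) (by omega) (by omega)
    rw [Nat.gcd_self] at h1
    set m := n + 1 with hm
    have hmp : (0:ℝ) < m := by positivity
    have h2 : ∑ d ∈ m.divisors, lam k a (m * m / d ^ 2) ≤ ∑ d ∈ m.divisors, b * m := by
      refine Finset.sum_le_sum fun d hd => ?_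
      have hd' := Nat.dvd_of_mem_divisors hd
      obtain ⟨l, hl⟩ := hd'
      have hdp : 0 < d := Nat.pos_of_mem_divisors hd
      have hl2 : m * m / d ^ 2 = l ^ 2 := by
        rw [hl]; rw [show d * l * (d * l) = d ^ 2 * l ^ 2 by ring]; exact Nat.mul_div_cancel_left _ (by positivity)
      rw [hl2]
      have hlp : 1 ≤ l := by
        rcases Nat.eq_zero_or_pos l with h | h
        · rw [h] at hl; omega
        · exact h
      refine (hlam (l ^ 2) (Nat.one_le_pow _ _ hlp)).trans ?_
      have : ((l ^ 2 : ℕ) : ℝ) ^ ((1:ℝ)/2) = l := by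
        push_cast; rw [← Real.sqrt_eq_rpow, Real.sqrt_sq (by positivity)]
      rw [this]
      have : l ≤ m := by rw [hl]; exact Nat.le_mul_of_pos_left _ hdp
      have : (l:ℝ) ≤ m := by exact_mod_cast this
      gcongr
    rw [Finset.sum_const, nsmul_eq_mul] at h2
    have h3 : (#m.divisors : ℝ) ≤ m := by exact_mod_cast Nat.card_divisors_le_self m
    have h4 : lam k a m * lam k a m ≤ m * (b * m) := h1.trans (h2.trans (by gcongr))
    unfold beta
    rw [mul_pow, ← Real.rpow_natCast ((m:ℝ) ^ (-(1:ℝ) / 2)), ← Real.rpow_mul hmp.le]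
    have : (-(1:ℝ) / 2 * ((2:ℕ):ℝ)) = -1 := by norm_num
    rw [this, Real.rpow_neg_one, ← div_eq_mul_inv, div_le_iff₀ hmp]
    have : (m:ℝ) ≤ k := by exact_mod_cast (by omega)
    nlinarith [mul_nonneg (mul_nonneg hb0 hmp.le) (sub_nonneg.mpr this)]
  have h1 : b ≤ 2 * (k * Real.sqrt (b * k)) := by
    have := Finset.sum_le_sum hsq
    rw [Finset.sum_const, nsmul_eq_mul, card_range] at this
    linarith
  rcases hb0.eq_or_lt with h0 | h0
  · rw [← h0]; positivity
  have h2 : b ^ 2 ≤ (2 * (k * Real.sqrt (b * k))) ^ 2 := pow_le_pow_left₀ hb0 h1 2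
  have h3 : (2 * (k * Real.sqrt (b * k))) ^ 2 = 4 * (k:ℝ) ^ 3 * b := by
    rw [mul_pow, mul_pow, Real.sq_sqrt (by positivity)]; ring
  rw [h3, sq] at h2
  exact le_of_mul_le_mul_right h2 h0

end D3

section D4

theorem sum_Icc_range (f : ℕ → ℝ) (M : ℕ) : ∑ n ∈ Icc 1 M, f n = ∑ n ∈ range M, f (n + 1) := by
  induction M with
  | zero => simp
  | succ M ih => rw [Finset.sum_Icc_succ_top (by omega), ih, Finset.sum_range_succ]

theorem zbound (σ : ℝ) (hσ : 1 < σ) : ∃ C : ℝ, 1 ≤ C ∧ ∀ M : ℕ, ∑ n ∈ Icc 1 M, (n:ℝ) ^ (-σ) ≤ C := by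
  have hs : Summable (fun n : ℕ => (n:ℝ) ^ (-σ)) := by
    rw [Real.summable_nat_rpow]; linarith
  have h : ∀ M : ℕ, ∑ n ∈ Icc 1 M, (n:ℝ) ^ (-σ) ≤ ∑' n : ℕ, (n:ℝ) ^ (-σ) := fun M =>
    hs.sum_le_tsum _ (fun n _ => by positivity)
  refine ⟨∑' n : ℕ, (n:ℝ) ^ (-σ), ?_, h⟩
  have := h 1
  simpa using this

noncomputable def RS (k : ℕ) (a : ℕ → ℂ) (s : ℝ) (M : ℕ) : ℝ :=
  ∑ n ∈ Icc 1 M, (lam k a n) ^ 2 * (n:ℝ) ^ (-s)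

theorem W_low (v s : ℝ) (hv : 1 ≤ v) (hs : 0 ≤ s) : 1 - s * (v - 1) ^ 2 ≤ (v * Real.exp (1 - v)) ^ s := by
  have hv0 : 0 < v := by linarith
  have e : v * Real.exp (1 - v) = Real.exp (Real.log v + (1 - v)) := by
    rw [Real.exp_add, Real.exp_log hv0]
  rw [e, ← Real.exp_mul]
  have h1 := Real.one_sub_inv_le_log_of_pos hv0
  have h2 : -(v-1)^2 ≤ Real.log v + (1 - v) := by
    have : v⁻¹ ≤ 1 := inv_le_one_of_one_le₀ hv
    have h3 : v⁻¹ * v = 1 := inv_mul_cancel₀ hv0.ne'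
    nlinarith [mul_nonneg (sub_nonneg.mpr hv) (sub_nonneg.mpr this), mul_nonneg (mul_nonneg (sub_nonneg.mpr hv) (sub_nonneg.mpr hv)) (sub_nonneg.mpr this)]
  have h4 := Real.add_one_le_exp ((Real.log v + (1 - v)) * s)
  nlinarith [mul_le_mul_of_nonneg_right h2 hs]

theorem rank_poly (η : ℝ) (hη : 0 < η) : ∃ C : ℝ, 1 ≤ C ∧ ∀ (k : ℕ) (a : ℕ → ℂ), EF k a → ∀ M : ℕ,
    RS k a (1 + η) M ≤ C * (k:ℝ) ^ 7 := by
  obtain ⟨C, hC, hz⟩ := zbound (1 + η) (by linarith)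
  refine ⟨64 * C, by linarith, fun k a E M => ?_⟩
  obtain ⟨b, hb0, hbk, hB⟩ := E.exists_b
  have hk12 := E.k12
  have hk12' : (12:ℝ) ≤ k := by exact_mod_cast hk12
  set f : ℕ → ℕ → ℝ := fun N n => (beta k a n * ((n : ℝ) / N * Real.exp (1 - (n : ℝ) / N)) ^ ((k:ℝ)/2)) ^ 2 with hf
  have hpar : ∀ N ∈ Icc 1 M, ∑ n ∈ Icc 1 M, f N n ≤ b ^ 2 := by
    intro N hN
    rw [sum_Icc_range]
    rw [mem_Icc] at hN
    exact E.parseval' b hb0 hB N (by exact_mod_cast hN.1) M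
  have key : ∀ n ∈ Icc 1 M, (lam k a n) ^ 2 * (n:ℝ) ^ (-(1+η)) ≤ ∑ N ∈ Icc 1 M, 4 * k * ((N:ℝ) ^ (-(1+η)) * f N n) := by
    intro n hn
    rw [mem_Icc] at hn
    have hnp : (0:ℝ) < n := by exact_mod_cast hn.1
    have hnk : n / k ≤ n / 12 := Nat.div_le_div_left hk12 (by norm_num)
    have hlt : n / k < n := Nat.div_lt_self (by omega) (by omega)
    have hsub : Icc (n - n / k) n ⊆ Icc 1 M := by
      intro x hx; rw [mem_Icc] at hx ⊢; omega
    refine le_trans ?_ (Finset.sum_le_sum_of_subset_of_nonneg hsub (fun N _ _ => by positivity))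
    have hterm : ∀ N ∈ Icc (n - n / k) n, k * ((n:ℝ) ^ (-(1+η)) * (beta k a n) ^ 2) ≤ 4 * k * ((N:ℝ) ^ (-(1+η)) * f N n) := by
      intro N hN
      rw [mem_Icc] at hN
      have hN1 : 1 ≤ N := by omega
      have hNp : (0:ℝ) < N := by exact_mod_cast hN1
      have hNn : (N:ℝ) ≤ n := by exact_mod_cast hN.2
      have h1 : (n:ℝ) ^ (-(1+η)) ≤ (N:ℝ) ^ (-(1+η)) :=
        Real.rpow_le_rpow_of_nonpos hNp hNn (by linarith)
      have h2 : k * (n - N) ≤ n := (Nat.mul_le_mul_left k (by omega : n - N ≤ n / k)).trans (Nat.mul_div_le n k)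
      have h3 : (k:ℝ) * (n - N) ≤ n := by
        have : ((k * (n - N) : ℕ) : ℝ) ≤ n := by exact_mod_cast h2
        rwa [Nat.cast_mul, Nat.cast_sub hN.2] at this
      have hv : 1 ≤ (n:ℝ) / N := by rw [le_div_iff₀ hNp]; linarith
      have hv1 : ((n:ℝ) / N - 1) * (k - 1) ≤ 1 := by
        have : ((n:ℝ) / N - 1) = (n - N) / N := by field_simp
        rw [this, div_mul_eq_mul_div, div_le_one hNp]; linarith
      have hW := W_low ((n:ℝ)/N) ((k:ℝ)/2) hv (by positivity)
      have hW2 : (1:ℝ)/2 ≤ ((n : ℝ) / N * Real.exp (1 - (n : ℝ) / N)) ^ ((k:ℝ)/2) := by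
        refine le_trans ?_ hW
        set t := (n:ℝ)/N - 1
        have ht : 0 ≤ t := by simp only [t]; linarith
        have : (t * (k-1)) ^ 2 ≤ 1 := by
          apply pow_le_one₀ _ hv1
          apply mul_nonneg ht; linarith
        nlinarith [mul_nonneg (sq_nonneg t) (show (0:ℝ) ≤ (k-1)^2 - k by nlinarith)]
      have hfN : (beta k a n) ^ 2 * (1/4) ≤ f N n := by
        rw [hf]; dsimp only
        rw [mul_pow]
        have : (1/4:ℝ) ≤ (((n : ℝ) / N * Real.exp (1 - (n : ℝ) / N)) ^ ((k:ℝ)/2)) ^ 2 := by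
          have := pow_le_pow_left₀ (by norm_num) hW2 2
          linarith
        gcongr
      calc k * ((n:ℝ) ^ (-(1+η)) * (beta k a n) ^ 2) = 4 * k * ((n:ℝ) ^ (-(1+η)) * ((beta k a n) ^ 2 * (1/4))) := by ring
        _ ≤ _ := by gcongr
    refine le_trans ?_ (Finset.sum_le_sum hterm)
    rw [Finset.sum_const, Nat.card_Icc, nsmul_eq_mul]
    have hcard : (n:ℝ) / k ≤ ((n + 1 - (n - n / k) : ℕ) : ℝ) := by
      have : n + 1 - (n - n / k) = n / k + 1 := by
        generalize n / k = t at *; omega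
      rw [this]
      push_cast
      have := Nat.lt_div_mul_add (a := n) (b := k) (by omega)
      rw [div_le_iff₀ (by linarith)]
      have h5 : (n:ℝ) < (n / k : ℕ) * k + k := by exact_mod_cast this
      linarith
    have e : (lam k a n) ^ 2 * (n:ℝ) ^ (-(1+η)) = (n:ℝ) / k * (k * ((n:ℝ) ^ (-(1+η)) * (beta k a n) ^ 2)) := by
      unfold beta
      rw [mul_pow, ← Real.rpow_natCast ((n:ℝ) ^ (-(1:ℝ) / 2)), ← Real.rpow_mul hnp.le]
      have : (-(1:ℝ) / 2 * ((2:ℕ):ℝ)) = -1 := by norm_num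
      rw [this, Real.rpow_neg_one]
      field_simp
    rw [e]
    gcongr
  unfold RS
  refine (Finset.sum_le_sum key).trans ?_
  rw [Finset.sum_comm]
  calc ∑ N ∈ Icc 1 M, ∑ n ∈ Icc 1 M, 4 * k * ((N:ℝ) ^ (-(1+η)) * f N n)
      = 4 * k * ∑ N ∈ Icc 1 M, (N:ℝ) ^ (-(1+η)) * ∑ n ∈ Icc 1 M, f N n := by
        rw [Finset.mul_sum]
        refine Finset.sum_congr rfl fun N _ => ?_
        rw [Finset.mul_sum, Finset.mul_sum]
    _ ≤ 4 * k * ∑ N ∈ Icc 1 M, (N:ℝ) ^ (-(1+η)) * b ^ 2 := by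
        gcongr with N hN
        exact hpar N hN
    _ = 4 * k * b ^ 2 * ∑ N ∈ Icc 1 M, (N:ℝ) ^ (-(1+η)) := by rw [← Finset.sum_mul]; ring
    _ ≤ 4 * k * (4 * (k:ℝ)^3) ^ 2 * C := by
        gcongr
        exact hz M
    _ = _ := by ring

theorem sum_dvd_le (M d : ℕ) (hd : 1 ≤ d) (h : ℕ → ℝ) (hh : ∀ n, 0 ≤ h n) :
    ∑ m ∈ (Icc 1 M).filter (d ∣ ·), h m ≤ ∑ m ∈ Icc 1 M, h (d * m) := by
  have e : (Icc 1 M).filter (d ∣ ·) ⊆ (Icc 1 M).image (d * ·) := by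
    intro m hm
    rw [mem_filter, mem_Icc] at hm
    obtain ⟨⟨h1, h2⟩, l, rfl⟩ := hm
    rw [mem_image]
    refine ⟨l, ?_, rfl⟩
    rw [mem_Icc]
    constructor
    · exact Nat.pos_of_mul_pos_left h1
    · exact (Nat.le_mul_of_pos_left l hd).trans h2
  refine (Finset.sum_le_sum_of_subset_of_nonneg e (fun _ _ _ => hh _)).trans (le_of_eq ?_)
  rw [Finset.sum_image]
  intro x _ y _ hxy
  exact Nat.eq_of_mul_eq_mul_left hd hxy

theorem sum_mul_le (M : ℕ) (h : ℕ → ℝ) (hh : ∀ n, 0 ≤ h n) :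
    ∑ m ∈ Icc 1 M, ∑ n ∈ Icc 1 M, h (m * n) ≤ ∑ l ∈ Icc 1 (M * M), (#l.divisors : ℝ) * h l := by
  rw [← Finset.sum_product' (Icc 1 M) (Icc 1 M) (fun m n => h (m * n))]
  have hmap : ∀ x ∈ Icc 1 M ×ˢ Icc 1 M, x.1 * x.2 ∈ Icc 1 (M * M) := by
    intro x hx
    rw [mem_product, mem_Icc, mem_Icc] at hx
    rw [mem_Icc]
    exact ⟨Nat.mul_pos hx.1.1 hx.2.1, Nat.mul_le_mul hx.1.2 hx.2.2⟩
  rw [← Finset.sum_fiberwise_of_maps_to hmap]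
  refine Finset.sum_le_sum fun l hl => ?_
  rw [mem_Icc] at hl
  have : ∀ x ∈ (Icc 1 M ×ˢ Icc 1 M).filter (fun x => x.1 * x.2 = l), h (x.1 * x.2) = h l := by
    intro x hx; rw [(mem_filter.mp hx).2]
  rw [Finset.sum_congr rfl this, Finset.sum_const, nsmul_eq_mul]
  refine mul_le_mul_of_nonneg_right ?_ (hh l)
  have hsub : (Icc 1 M ×ˢ Icc 1 M).filter (fun x => x.1 * x.2 = l) ⊆ l.divisorsAntidiagonal := by
    intro x hx
    rw [Nat.mem_divisorsAntidiagonal]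
    exact ⟨(mem_filter.mp hx).2, by omega⟩
  have := Finset.card_le_card hsub
  rw [← Nat.map_div_right_divisors, card_map] at this
  exact_mod_cast this

theorem rank_step (s e : ℝ) (he : 0 < e) (hs : 1 < s - e) : ∃ C : ℝ, 1 ≤ C ∧ ∀ (k : ℕ) (a : ℕ → ℂ), EF k a → ∀ K : ℝ,
    (∀ M, RS k a (s - e) M ≤ K) → ∀ M, RS k a s M ^ 2 ≤ C * K := by
  obtain ⟨C1, hC1, hdiv⟩ := divisor_bound (e/2) (by positivity)
  obtain ⟨C2, hC2, hz⟩ := zbound 2 (by norm_num)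
  refine ⟨C1 * C1 * C2, one_le_mul_of_one_le_of_one_le (one_le_mul_of_one_le_of_one_le hC1 hC1) hC2, fun k a E K hK M => ?_⟩
  set σ := s - e/2 with hσ
  set g : ℕ → ℝ := fun l => (lam k a l)^2 * (l:ℝ) ^ (-σ) with hg
  have hg0 : ∀ l, 0 ≤ g l := fun l => by rw [hg]; dsimp only; positivity
  have h1 : ∀ m ∈ Icc 1 M, ∀ n ∈ Icc 1 M, (lam k a m) ^ 2 * (m:ℝ) ^ (-s) * ((lam k a n) ^ 2 * (n:ℝ) ^ (-s)) ≤
      C1 * ∑ d ∈ Icc 1 M, (if d ∣ m ∧ d ∣ n then (lam k a (m * n / d ^ 2)) ^ 2 * ((m * n : ℕ):ℝ) ^ (-σ) else 0) := by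
    intro m hm n hn
    rw [mem_Icc] at hm hn
    have hmp : (0:ℝ) < m := by exact_mod_cast hm.1
    have hnp : (0:ℝ) < n := by exact_mod_cast hn.1
    have h2 := E.lam_hecke m n hm.1 hn.1
    have h3 : (lam k a m * lam k a n) ^ 2 ≤ #((Nat.gcd m n).divisors) * ∑ d ∈ (Nat.gcd m n).divisors, (lam k a (m * n / d ^ 2)) ^ 2 :=
      (pow_le_pow_left₀ (mul_nonneg (lam_nonneg _ _ _) (lam_nonneg _ _ _)) h2 2).trans sq_sum_le_card_mul_sum_sq
    have h4 : (#((Nat.gcd m n).divisors) : ℝ) ≤ C1 * ((m * n : ℕ) : ℝ) ^ (e/2) := by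
      refine le_trans ?_ (hdiv (m * n) (Nat.mul_pos hm.1 hn.1))
      exact_mod_cast Finset.card_le_card (Nat.divisors_subset_of_dvd (Nat.mul_pos hm.1 hn.1).ne' ((Nat.gcd_dvd_left m n).trans (Dvd.intro _ rfl)))
    have h5 : ∑ d ∈ Icc 1 M, (if d ∣ m ∧ d ∣ n then (lam k a (m * n / d ^ 2)) ^ 2 * ((m * n : ℕ):ℝ) ^ (-σ) else 0) =
        (∑ d ∈ (Nat.gcd m n).divisors, (lam k a (m * n / d ^ 2)) ^ 2) * ((m * n : ℕ):ℝ) ^ (-σ) := by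
      rw [← Finset.sum_filter, Finset.sum_mul]
      refine Finset.sum_congr ?_ fun _ _ => rfl
      ext d
      rw [mem_filter, mem_Icc, Nat.mem_divisors, ← Nat.dvd_gcd_iff]
      have hgp : 0 < Nat.gcd m n := Nat.gcd_pos_of_pos_left _ hm.1
      constructor
      · rintro ⟨_, h⟩; exact ⟨h, hgp.ne'⟩
      · rintro ⟨h, _⟩
        exact ⟨⟨Nat.pos_of_dvd_of_pos h hgp, (Nat.le_of_dvd hm.1 (h.trans (Nat.gcd_dvd_left _ _))).trans hm.2⟩, h⟩
    rw [h5]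
    have hmn : (0:ℝ) < ((m * n : ℕ) : ℝ) := by push_cast; positivity
    have e1 : ((m * n : ℕ):ℝ) ^ (-σ) = ((m * n : ℕ):ℝ) ^ (e/2) * ((m * n : ℕ):ℝ) ^ (-s) := by
      rw [← Real.rpow_add hmn]; congr 1; rw [hσ]; ring
    have e2 : ((m * n : ℕ):ℝ) ^ (-s) = (m:ℝ) ^ (-s) * (n:ℝ) ^ (-s) := by
      push_cast; rw [Real.mul_rpow hmp.le hnp.le]
    calc _ = (lam k a m * lam k a n) ^ 2 * ((m * n : ℕ):ℝ) ^ (-s) := by rw [e2]; ring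
      _ ≤ (#((Nat.gcd m n).divisors) * ∑ d ∈ (Nat.gcd m n).divisors, (lam k a (m * n / d ^ 2)) ^ 2) * ((m * n : ℕ):ℝ) ^ (-s) := by gcongr
      _ ≤ ((C1 * ((m * n : ℕ) : ℝ) ^ (e/2)) * ∑ d ∈ (Nat.gcd m n).divisors, (lam k a (m * n / d ^ 2)) ^ 2) * ((m * n : ℕ):ℝ) ^ (-s) := by gcongr
      _ = _ := by rw [e1]; ring
  have hinner : ∀ d ∈ Icc 1 M, ∑ m ∈ Icc 1 M, ∑ n ∈ Icc 1 M, (if d ∣ m ∧ d ∣ n then (lam k a (m * n / d ^ 2)) ^ 2 * ((m * n : ℕ):ℝ) ^ (-σ) else 0)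
      ≤ (d:ℝ) ^ (-(2:ℝ)) * (C1 * K) := by
    intro d hd
    rw [mem_Icc] at hd
    have hdp : (0:ℝ) < d := by exact_mod_cast hd.1
    have hd1 : (1:ℝ) ≤ d := by exact_mod_cast hd.1
    set q : ℕ → ℕ → ℝ := fun m n => (lam k a (m * n / d ^ 2)) ^ 2 * ((m * n : ℕ):ℝ) ^ (-σ) with hq
    have hq0 : ∀ m n, 0 ≤ q m n := fun m n => by rw [hq]; dsimp only; positivity
    calc _ = ∑ m ∈ (Icc 1 M).filter (d ∣ ·), ∑ n ∈ (Icc 1 M).filter (d ∣ ·), q m n := by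
          rw [Finset.sum_filter]
          refine Finset.sum_congr rfl fun m _ => ?_
          rw [Finset.sum_filter]
          by_cases hdm : d ∣ m
          · simp [hdm, hq]
          · simp [hdm]
      _ ≤ ∑ m ∈ (Icc 1 M).filter (d ∣ ·), ∑ n ∈ Icc 1 M, q m (d * n) :=
          Finset.sum_le_sum fun m _ => sum_dvd_le M d hd.1 _ (hq0 m)
      _ ≤ ∑ m ∈ Icc 1 M, ∑ n ∈ Icc 1 M, q (d * m) (d * n) :=
          sum_dvd_le M d hd.1 (fun m => ∑ n ∈ Icc 1 M, q m (d * n)) (fun m => Finset.sum_nonneg fun n _ => hq0 _ _)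
      _ ≤ ∑ m ∈ Icc 1 M, ∑ n ∈ Icc 1 M, (d:ℝ) ^ (-(2:ℝ)) * g (m * n) := by
          refine Finset.sum_le_sum fun m _ => Finset.sum_le_sum fun n _ => ?_
          rw [hq, hg]; dsimp only
          have e3 : d * m * (d * n) / d ^ 2 = m * n := by
            rw [show d * m * (d * n) = d ^ 2 * (m * n) by ring]; exact Nat.mul_div_cancel_left _ (pow_pos hd.1 2)
          have e4 : ((d * m * (d * n) : ℕ):ℝ) ^ (-σ) = (d:ℝ) ^ (-(2 * σ)) * ((m * n : ℕ):ℝ) ^ (-σ) := by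
            rw [show d * m * (d * n) = d ^ 2 * (m * n) by ring, Nat.cast_mul, Real.mul_rpow (by positivity) (by positivity)]
            congr 1
            push_cast
            rw [← Real.rpow_natCast, ← Real.rpow_mul hdp.le]; congr 1; push_cast; ring
          rw [e3, e4]
          have h6 : (d:ℝ) ^ (-(2 * σ)) ≤ (d:ℝ) ^ (-(2:ℝ)) := Real.rpow_le_rpow_of_exponent_le hd1 (by rw [hσ]; linarith)
          calc _ = (d:ℝ) ^ (-(2 * σ)) * ((lam k a (m * n)) ^ 2 * ((m * n : ℕ):ℝ) ^ (-σ)) := by ring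
            _ ≤ _ := by gcongr
      _ = (d:ℝ) ^ (-(2:ℝ)) * ∑ m ∈ Icc 1 M, ∑ n ∈ Icc 1 M, g (m * n) := by
          rw [Finset.mul_sum]; refine Finset.sum_congr rfl fun m _ => ?_; rw [Finset.mul_sum]
      _ ≤ (d:ℝ) ^ (-(2:ℝ)) * ∑ l ∈ Icc 1 (M * M), (#l.divisors : ℝ) * g l := by
          gcongr; exact sum_mul_le M g hg0
      _ ≤ (d:ℝ) ^ (-(2:ℝ)) * ∑ l ∈ Icc 1 (M * M), C1 * ((lam k a l)^2 * (l:ℝ) ^ (-(s-e))) := by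
          refine mul_le_mul_of_nonneg_left (Finset.sum_le_sum fun l hl => ?_) (by positivity)
          rw [mem_Icc] at hl
          have hlp : (0:ℝ) < l := by exact_mod_cast hl.1
          refine (mul_le_mul_of_nonneg_right (hdiv l hl.1) (hg0 l)).trans (le_of_eq ?_)
          rw [hg]; dsimp only
          have : (l:ℝ) ^ (-(s-e)) = (l:ℝ) ^ (e/2) * (l:ℝ) ^ (-σ) := by
            rw [← Real.rpow_add hlp]; congr 1; rw [hσ]; ring
          rw [this]; ring
      _ ≤ _ := by
          rw [← Finset.mul_sum]
          gcongr
          exact hK (M * M)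
  have hK0 : 0 ≤ K := by
    refine le_trans ?_ (hK 0); unfold RS; simp
  calc RS k a s M ^ 2 = ∑ m ∈ Icc 1 M, ∑ n ∈ Icc 1 M, (lam k a m) ^ 2 * (m:ℝ) ^ (-s) * ((lam k a n) ^ 2 * (n:ℝ) ^ (-s)) := by
        unfold RS; rw [sq, Finset.sum_mul_sum]
    _ ≤ ∑ m ∈ Icc 1 M, ∑ n ∈ Icc 1 M, C1 * ∑ d ∈ Icc 1 M, (if d ∣ m ∧ d ∣ n then (lam k a (m * n / d ^ 2)) ^ 2 * ((m * n : ℕ):ℝ) ^ (-σ) else 0) :=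
        Finset.sum_le_sum fun m hm => Finset.sum_le_sum fun n hn => h1 m hm n hn
    _ = C1 * ∑ d ∈ Icc 1 M, ∑ m ∈ Icc 1 M, ∑ n ∈ Icc 1 M, (if d ∣ m ∧ d ∣ n then (lam k a (m * n / d ^ 2)) ^ 2 * ((m * n : ℕ):ℝ) ^ (-σ) else 0) := by
        simp_rw [← Finset.mul_sum]
        congr 1
        rw [Finset.sum_comm (s := Icc 1 M) (t := Icc 1 M) (f := fun d m => ∑ n ∈ Icc 1 M, (if d ∣ m ∧ d ∣ n then (lam k a (m * n / d ^ 2)) ^ 2 * ((m * n : ℕ):ℝ) ^ (-σ) else 0))]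
        exact Finset.sum_congr rfl fun m _ => Finset.sum_comm
    _ ≤ C1 * ∑ d ∈ Icc 1 M, (d:ℝ) ^ (-(2:ℝ)) * (C1 * K) := by
        refine mul_le_mul_of_nonneg_left (Finset.sum_le_sum hinner) (by linarith)
    _ ≤ C1 * (C2 * (C1 * K)) := by
        rw [← Finset.sum_mul]
        have := hz M
        gcongr
    _ = _ := by ring

theorem rankin (δ ε : ℝ) (hδ : 0 < δ) (hε : 0 < ε) : ∃ C : ℝ, 1 ≤ C ∧ ∀ (k : ℕ) (a : ℕ → ℂ), EF k a → ∀ M : ℕ,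
    RS k a (1 + δ) M ≤ C * (k:ℝ) ^ ε := by
  have ind : ∀ j : ℕ, ∀ δ : ℝ, 0 < δ → ∃ C : ℝ, 1 ≤ C ∧ ∀ (k : ℕ) (a : ℕ → ℂ), EF k a → ∀ M : ℕ,
      RS k a (1 + δ) M ≤ C * (k:ℝ) ^ ((7:ℝ) / 2 ^ j) := by
    intro j
    induction j with
    | zero =>
      intro δ hδ
      obtain ⟨C, hC, h⟩ := rank_poly δ hδ
      refine ⟨C, hC, fun k a E M => (h k a E M).trans (le_of_eq ?_)⟩
      rw [pow_zero, div_one, ← Real.rpow_natCast]; norm_num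
    | succ j ih =>
      intro δ hδ
      obtain ⟨C, hC, h⟩ := ih (δ/2) (by positivity)
      obtain ⟨C', hC', h'⟩ := rank_step (1+δ) (δ/2) (by positivity) (by linarith)
      refine ⟨C' * C, one_le_mul_of_one_le_of_one_le hC' hC, fun k a E M => ?_⟩
      have hk : (0:ℝ) < k := by have := E.k12; exact_mod_cast (by omega)
      have h1 := h' k a E (C * (k:ℝ) ^ ((7:ℝ) / 2 ^ j)) (fun M => by
        have := h k a E M
        rwa [show 1 + δ / 2 = 1 + δ - δ/2 by ring] at this) M
      have h2 : RS k a (1+δ) M ^ 2 ≤ (C' * C * (k:ℝ) ^ ((7:ℝ) / 2 ^ (j+1))) ^ 2 := by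
        refine h1.trans ?_
        rw [mul_pow, ← Real.rpow_natCast ((k:ℝ) ^ _) 2, ← Real.rpow_mul hk.le]
        have : (7:ℝ) / 2 ^ (j+1) * ((2:ℕ):ℝ) = 7 / 2 ^ j := by rw [pow_succ]; push_cast; field_simp
        rw [this, ← mul_assoc]
        have h3 : 1 ≤ C' * C := one_le_mul_of_one_le_of_one_le hC' hC
        have : C' * C ≤ (C' * C) ^ 2 := by nlinarith
        gcongr
      exact le_of_sq_le_sq h2 (by positivity)
  obtain ⟨j, hj⟩ := pow_unbounded_of_one_lt (7/ε) (show (1:ℝ) < 2 by norm_num)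
  obtain ⟨C, hC, h⟩ := ind j δ hδ
  refine ⟨C, hC, fun k a E M => (h k a E M).trans ?_⟩
  have hk : (1:ℝ) ≤ k := by have := E.k12; exact_mod_cast (by omega)
  have : (7:ℝ) / 2 ^ j ≤ ε := by
    rw [div_lt_iff₀ hε] at hj
    rw [div_le_iff₀ (by positivity)]; linarith
  gcongr

end D4

section C1

noncomputable def rsum (d : ℕ) [NeZero d] (n : ZMod d) : ℂ := ∑ u : (ZMod d)ˣ, ZMod.stdAddChar (N := d) (u * n)

theorem qf_char (a : ℕ → ℂ) (d : ℕ) [NeZero d] (b : ℤ) (ζ : ℂ) :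
    qf a ((b : ℂ) / d + Complex.I * ζ) =
      ∑' n : ℕ, a (n + 1) * ZMod.stdAddChar (N := d) ((b : ZMod d) * ((n + 1 : ℕ) : ZMod d)) * Complex.exp (-(2 * Real.pi * (n + 1) * ζ)) := by
  unfold qf
  refine tsum_congr fun n => ?_
  have e : ((b : ZMod d) * ((n + 1 : ℕ) : ZMod d)) = ((b * (n + 1 : ℕ) : ℤ) : ZMod d) := by push_cast; ring
  rw [e, ZMod.stdAddChar_coe, mul_assoc (a (n + 1)), ← Complex.exp_add]
  congr 2
  push_cast
  linear_combination (2 * Real.pi * (n + 1) * ζ : ℂ) * Complex.I_sq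

theorem norm_std (d : ℕ) [NeZero d] (x : ZMod d) : ‖ZMod.stdAddChar (N := d) x‖ = 1 :=
  AddChar.norm_apply _ _

theorem EF.summ_exp {k : ℕ} {a : ℕ → ℂ} (E : EF k a) (ζ : ℂ) (hζ : 0 < ζ.re) (f : ℕ → ℂ) (C : ℝ) (hf : ∀ n, ‖f n‖ ≤ C) :
    Summable fun n : ℕ => a (n + 1) * f n * Complex.exp (-(2 * Real.pi * (n + 1) * ζ)) := by
  refine Summable.of_norm_bounded ((E.summ ζ.re hζ).mul_left C) fun n => ?_
  rw [norm_mul, norm_mul, Complex.norm_exp]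
  have : (-(2 * (Real.pi : ℂ) * (n + 1) * ζ)).re = -(2 * Real.pi * (n + 1) * ζ.re) := by
    simp [Complex.mul_re]
  rw [this]
  calc _ = ‖f n‖ * (‖a (n + 1)‖ * Real.exp (-(2 * Real.pi * (n + 1) * ζ.re))) := by ring
    _ ≤ _ := by gcongr; exact hf n

theorem EF.qtrans {k : ℕ} {a : ℕ → ℂ} (E : EF k a) (d : ℕ) [NeZero d] (b α : ℤ) (h : (d : ℤ) ∣ α * b + 1) (ζ : ℂ) (hζ : 0 < ζ.re) :
    qf a ((b : ℂ) / d + Complex.I * ζ) = ((Complex.I * d * ζ) ^ k)⁻¹ * qf a ((α : ℂ) / d + Complex.I * (1 / (d ^ 2 * ζ))) := by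
  obtain ⟨β, hβ⟩ := h
  have hd : (d : ℂ) ≠ 0 := by exact_mod_cast NeZero.ne d
  have hz0 : ζ ≠ 0 := by rintro rfl; simp at hζ
  have him : 0 < ((b : ℂ) / d + Complex.I * ζ).im := by
    have e0 : ((b : ℂ) / d) = (((b : ℝ) / d : ℝ) : ℂ) := by push_cast; rfl
    rw [e0, Complex.add_im, Complex.ofReal_im]
    simpa using hζ
  obtain ⟨-, h2⟩ := E.trans α (-β) d (-b) (by linear_combination -hβ) _ him
  have e1 : (((d : ℕ) : ℤ) : ℂ) * ((b : ℂ) / d + Complex.I * ζ) + ((-b : ℤ) : ℂ) = Complex.I * d * ζ := by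
    push_cast; field_simp; ring
  have e2 : ((α : ℂ) * ((b : ℂ) / d + Complex.I * ζ) + ((-β : ℤ) : ℂ)) / (Complex.I * d * ζ) = (α : ℂ) / d + Complex.I * (1 / (d ^ 2 * ζ)) := by
    have hb : (α : ℂ) * b + 1 = d * β := by exact_mod_cast hβ
    have hI := Complex.I_ne_zero
    push_cast
    field_simp
    linear_combination hb - Complex.I_sq
  rw [e1, e2] at h2
  rw [h2]
  have : (Complex.I * d * ζ) ^ k ≠ 0 := pow_ne_zero _ (mul_ne_zero (mul_ne_zero Complex.I_ne_zero hd) hz0)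
  rw [inv_mul_cancel_left₀ this]

theorem EF.Pbound {k : ℕ} {a : ℕ → ℂ} (E : EF k a) (d : ℕ) [NeZero d] (a0 : ℤ) (ζ : ℂ) (hζ : 0 < ζ.re) :
    (Summable fun m : ℕ => ‖a (m + 1)‖ * ‖kl d (-a0) (-((m + 1 : ℕ) : ℤ))‖ * Real.exp (-(2 * Real.pi * (m + 1) * (ζ.re / (d ^ 2 * ‖ζ‖ ^ 2))))) ∧
    ‖∑' n : ℕ, a (n + 1) * rsum d (((n + 1 : ℕ) : ZMod d) - a0) * Complex.exp (-(2 * Real.pi * (n + 1) * ζ))‖ ≤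
      (d * ‖ζ‖) ^ (-(k:ℝ)) * ∑' m : ℕ, ‖a (m + 1)‖ * ‖kl d (-a0) (-((m + 1 : ℕ) : ℤ))‖ * Real.exp (-(2 * Real.pi * (m + 1) * (ζ.re / (d ^ 2 * ‖ζ‖ ^ 2)))) := by
  have hd : (d : ℂ) ≠ 0 := by exact_mod_cast NeZero.ne d
  have hdp : (0:ℝ) < d := by exact_mod_cast NeZero.pos d
  have hz0 : ζ ≠ 0 := by rintro rfl; simp at hζ
  have hzn : 0 < ‖ζ‖ := norm_pos_iff.mpr hz0
  set w : ℂ := 1 / (d ^ 2 * ζ) with hw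
  have hwre : w.re = ζ.re / (d ^ 2 * ‖ζ‖ ^ 2) := by
    rw [hw, one_div, mul_inv]
    have : ((d : ℂ) ^ 2)⁻¹ = ((((d:ℝ) ^ 2)⁻¹ : ℝ) : ℂ) := by push_cast; rfl
    rw [this, Complex.re_ofReal_mul, Complex.inv_re, Complex.normSq_eq_norm_sq]
    field_simp
  have hw0 : 0 < w.re := by rw [hwre]; positivity
  let χ := ZMod.stdAddChar (N := d)
  -- lifts
  have lift : ∀ u : (ZMod d)ˣ, ∃ b α : ℤ, (b : ZMod d) = u ∧ (α : ZMod d) = -((u⁻¹ : (ZMod d)ˣ) : ZMod d) ∧ (d : ℤ) ∣ α * b + 1 := by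
    intro u
    obtain ⟨b, hb⟩ := ZMod.intCast_surjective (u : ZMod d)
    obtain ⟨α, hα⟩ := ZMod.intCast_surjective (-((u⁻¹ : (ZMod d)ˣ) : ZMod d))
    refine ⟨b, α, hb, hα, ?_⟩
    rw [← ZMod.intCast_zmod_eq_zero_iff_dvd]
    push_cast
    rw [hb, hα]; simp
  have key : ∀ u : (ZMod d)ˣ,
      ∑' n : ℕ, a (n + 1) * χ ((u : ZMod d) * ((n + 1 : ℕ) : ZMod d)) * Complex.exp (-(2 * Real.pi * (n + 1) * ζ)) =
      ((Complex.I * d * ζ) ^ k)⁻¹ * ∑' n : ℕ, a (n + 1) * χ (-((u⁻¹ : (ZMod d)ˣ) : ZMod d) * ((n + 1 : ℕ) : ZMod d)) * Complex.exp (-(2 * Real.pi * (n + 1) * w)) := by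
    intro u
    obtain ⟨b, α, hb, hα, hdvd⟩ := lift u
    have := E.qtrans d b α hdvd ζ hζ
    rw [← hw, qf_char, qf_char, hb, hα] at this
    exact this
  have e1 : ∑' n : ℕ, a (n + 1) * rsum d (((n + 1 : ℕ) : ZMod d) - a0) * Complex.exp (-(2 * Real.pi * (n + 1) * ζ)) =
      ((Complex.I * d * ζ) ^ k)⁻¹ * ∑' m : ℕ, a (m + 1) * kl d (-a0) (-((m + 1 : ℕ) : ℤ)) * Complex.exp (-(2 * Real.pi * (m + 1) * w)) := by
    calc _ = ∑' n : ℕ, ∑ u : (ZMod d)ˣ, χ (-(u * (a0 : ZMod d))) * (a (n + 1) * χ ((u : ZMod d) * ((n + 1 : ℕ) : ZMod d)) * Complex.exp (-(2 * Real.pi * (n + 1) * ζ))) := by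
          refine tsum_congr fun n => ?_
          unfold rsum
          rw [Finset.mul_sum, Finset.sum_mul]
          refine Finset.sum_congr rfl fun u _ => ?_
          have : (u : ZMod d) * (((n + 1 : ℕ) : ZMod d) - a0) = -(u * (a0 : ZMod d)) + (u : ZMod d) * ((n + 1 : ℕ) : ZMod d) := by ring
          rw [this, AddChar.map_add_eq_mul]; ring
      _ = ∑ u : (ZMod d)ˣ, χ (-(u * (a0 : ZMod d))) * ∑' n : ℕ, (a (n + 1) * χ ((u : ZMod d) * ((n + 1 : ℕ) : ZMod d)) * Complex.exp (-(2 * Real.pi * (n + 1) * ζ))) := by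
          rw [Summable.tsum_finsetSum]
          · refine Finset.sum_congr rfl fun u _ => tsum_mul_left
          · intro u _
            exact (E.summ_exp ζ hζ _ 1 (fun n => (norm_std d _).le)).mul_left _
      _ = ∑ u : (ZMod d)ˣ, ∑' n : ℕ, χ (-(u * (a0 : ZMod d))) * (((Complex.I * d * ζ) ^ k)⁻¹ * (a (n + 1) * χ (-((u⁻¹ : (ZMod d)ˣ) : ZMod d) * ((n + 1 : ℕ) : ZMod d)) * Complex.exp (-(2 * Real.pi * (n + 1) * w)))) := by
          refine Finset.sum_congr rfl fun u _ => ?_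
          rw [key, tsum_mul_left, tsum_mul_left]
      _ = _ := by
          rw [← Summable.tsum_finsetSum, ← tsum_mul_left]
          · refine tsum_congr fun n => ?_
            unfold kl klR
            rw [Finset.mul_sum, Finset.sum_mul, Finset.mul_sum]
            refine Finset.sum_congr rfl fun u _ => ?_
            have : (((-a0 : ℤ) : ZMod d) * u + ((-((n + 1 : ℕ) : ℤ) : ℤ) : ZMod d) * ((u⁻¹ : (ZMod d)ˣ) : ZMod d)) = -(u * (a0 : ZMod d)) + -((u⁻¹ : (ZMod d)ˣ) : ZMod d) * ((n + 1 : ℕ) : ZMod d) := by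
              push_cast; ring
            rw [this, AddChar.map_add_eq_mul]; ring
          · intro u _
            exact ((E.summ_exp w hw0 _ 1 (fun n => (norm_std d _).le)).mul_left _).mul_left _
  have hnorm : ∀ m : ℕ, ‖a (m + 1) * kl d (-a0) (-((m + 1 : ℕ) : ℤ)) * Complex.exp (-(2 * Real.pi * (m + 1) * w))‖ =
      ‖a (m + 1)‖ * ‖kl d (-a0) (-((m + 1 : ℕ) : ℤ))‖ * Real.exp (-(2 * Real.pi * (m + 1) * (ζ.re / (d ^ 2 * ‖ζ‖ ^ 2)))) := by
    intro m
    rw [norm_mul, norm_mul, Complex.norm_exp]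
    have : (-(2 * (Real.pi : ℂ) * (m + 1) * w)).re = -(2 * Real.pi * (m + 1) * w.re) := by
      simp [Complex.mul_re]
    rw [this, hwre]
  have hs := (E.summ_exp w hw0 (fun m => kl d (-a0) (-((m + 1 : ℕ) : ℤ))) d (fun m => kl_triv d _ _)).norm
  simp_rw [hnorm] at hs
  refine ⟨hs, ?_⟩
  rw [e1, norm_mul]
  have e3 : ‖((Complex.I * d * ζ) ^ k)⁻¹‖ = (d * ‖ζ‖) ^ (-(k:ℝ)) := by
    rw [norm_inv, norm_pow, norm_mul, norm_mul, Complex.norm_I, one_mul, Complex.norm_natCast, Real.rpow_neg (by positivity), Real.rpow_natCast]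
  rw [e3]
  refine mul_le_mul_of_nonneg_left ?_ (by positivity)
  have := norm_tsum_le_tsum_norm (f := fun m : ℕ => a (m + 1) * kl d (-a0) (-((m + 1 : ℕ) : ℤ)) * Complex.exp (-(2 * Real.pi * (m + 1) * w))) (by simp_rw [hnorm]; exact hs)
  simpa only [hnorm] using this

end C1

section C2

noncomputable def rN (d : ℕ) (n : ℤ) : ℂ :=
  ∑ j ∈ (range d).filter (fun j => Nat.Coprime d j), Complex.exp (2 * Real.pi * Complex.I * ((j : ℂ) * n) / d)

theorem rsum_eq (d : ℕ) [NeZero d] (n : ℤ) : rsum d (n : ZMod d) = rN d n := by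
  unfold rsum rN
  refine Finset.sum_bij (fun u _ => (u : ZMod d).val) ?_ ?_ ?_ ?_
  · intro u _
    rw [mem_filter, mem_range]
    exact ⟨ZMod.val_lt _, (ZMod.val_coe_unit_coprime u).symm⟩
  · intro u _ v _ h
    exact Units.ext (ZMod.val_injective d h)
  · intro j hj
    rw [mem_filter, mem_range] at hj
    exact ⟨ZMod.unitOfCoprime j hj.2.symm, mem_univ _, by rw [ZMod.coe_unitOfCoprime, ZMod.val_cast_of_lt hj.1]⟩
  · intro u _
    have : (u : ZMod d) * (n : ZMod d) = (((u : ZMod d).val * n : ℤ) : ZMod d) := by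
      push_cast; rw [ZMod.natCast_zmod_val]
    rw [this, ZMod.stdAddChar_coe]
    push_cast; rfl

theorem sum_rN (q : ℕ) (hq : 0 < q) (n : ℤ) : ∑ d ∈ q.divisors, rN d n = if (q : ℤ) ∣ n then (q : ℂ) else 0 := by
  have hqc : (q : ℂ) ≠ 0 := by exact_mod_cast hq.ne'
  have h1 : ∑ d ∈ q.divisors, rN d n = ∑ j ∈ range q, Complex.exp (2 * Real.pi * Complex.I * ((j : ℂ) * n) / q) := by
    have hmap : ∀ j ∈ range q, q / Nat.gcd q j ∈ q.divisors := fun j _ =>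
      Nat.mem_divisors.mpr ⟨Nat.div_dvd_of_dvd (Nat.gcd_dvd_left _ _), hq.ne'⟩
    rw [← Finset.sum_fiberwise_of_maps_to hmap]
    refine Finset.sum_congr rfl fun d hd => ?_
    obtain ⟨⟨g, hg⟩, -⟩ := Nat.mem_divisors.mp hd
    have hdp : 0 < d := Nat.pos_of_mem_divisors hd
    have hgp : 0 < g := Nat.pos_of_ne_zero (by rintro rfl; omega)
    unfold rN
    refine Finset.sum_bij (fun i _ => i * g) ?_ ?_ ?_ ?_
    · intro i hi
      rw [mem_filter, mem_range] at hi ⊢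
      refine ⟨by rw [hg]; exact Nat.mul_lt_mul_of_pos_right hi.1 hgp, ?_⟩
      rw [hg, Nat.gcd_mul_right, hi.2, one_mul, Nat.mul_div_cancel _ hgp]
    · intro i _ i' _ h
      exact Nat.eq_of_mul_eq_mul_right hgp h
    · intro j hj
      rw [mem_filter, mem_range] at hj
      have hG : 0 < Nat.gcd q j := Nat.gcd_pos_of_pos_left _ hq
      have hgg : Nat.gcd q j = g := by
        have h3 := Nat.div_mul_cancel (Nat.gcd_dvd_left q j)
        rw [hj.2] at h3
        exact Nat.eq_of_mul_eq_mul_left hdp (h3.trans hg)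
      have hgj : g ∣ j := hgg ▸ Nat.gcd_dvd_right q j
      refine ⟨j / g, ?_, Nat.div_mul_cancel hgj⟩
      rw [mem_filter, mem_range]
      constructor
      · rw [Nat.div_lt_iff_lt_mul hgp, ← hg]; exact hj.1
      · have := Nat.coprime_div_gcd_div_gcd hG
        rwa [hj.2, hgg] at this
    · intro i _
      congr 1
      have hgc : (g : ℂ) ≠ 0 := by exact_mod_cast hgp.ne'
      have hdc : (d : ℂ) ≠ 0 := by exact_mod_cast hdp.ne'
      rw [hg]; push_cast; field_simp
  rw [h1]
  have h2 : ∀ j ∈ range q, Complex.exp (2 * Real.pi * Complex.I * ((j : ℂ) * n) / q) = (Complex.exp (2 * Real.pi * Complex.I * n / q)) ^ j := by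
    intro j _
    rw [← Complex.exp_nat_mul]; congr 1; ring
  rw [Finset.sum_congr rfl h2]
  split_ifs with h
  · obtain ⟨t, ht⟩ := h
    have : Complex.exp (2 * Real.pi * Complex.I * n / q) = 1 := by
      rw [Complex.exp_eq_one_iff]; exact ⟨t, by rw [ht]; push_cast; field_simp⟩
    rw [this]; simp
  · have h3 : Complex.exp (2 * Real.pi * Complex.I * n / q) ≠ 1 := by
      intro h4
      rw [Complex.exp_eq_one_iff] at h4
      obtain ⟨t, ht⟩ := h4
      apply h
      have hp : (2 * Real.pi * Complex.I : ℂ) ≠ 0 := Complex.two_pi_I_ne_zero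
      have h5 : (n : ℂ) = q * t := by field_simp at ht; linear_combination ht
      exact ⟨t, by exact_mod_cast h5⟩
    rw [geom_sum_eq h3, ← Complex.exp_nat_mul]
    have : Complex.exp (q * (2 * Real.pi * Complex.I * n / q)) = 1 := by
      rw [Complex.exp_eq_one_iff]; exact ⟨n, by field_simp⟩
    rw [this]; simp

theorem gcdsum (δ ε : ℝ) (hδ : 0 < δ) (hε : 0 < ε) : ∃ C : ℝ, 1 ≤ C ∧ ∀ d M : ℕ, 1 ≤ d →
    ∑ m ∈ Icc 1 M, (Nat.gcd m d : ℝ) * (m:ℝ) ^ (-(1 + δ)) ≤ C * (d:ℝ) ^ ε := by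
  obtain ⟨C1, hC1, hz⟩ := zbound (1 + δ) (by linarith)
  obtain ⟨C2, hC2, hd⟩ := divisor_bound ε hε
  refine ⟨C1 * C2, one_le_mul_of_one_le_of_one_le hC1 hC2, fun d M hd1 => ?_⟩
  have h1 : ∀ m ∈ Icc 1 M, (Nat.gcd m d : ℝ) * (m:ℝ) ^ (-(1 + δ)) ≤ ∑ g ∈ d.divisors, if g ∣ m then (g:ℝ) * (m:ℝ) ^ (-(1 + δ)) else 0 := by
    intro m hm
    have hmem : Nat.gcd m d ∈ d.divisors := Nat.mem_divisors.mpr ⟨Nat.gcd_dvd_right _ _, by omega⟩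
    have := Finset.single_le_sum (f := fun g : ℕ => if g ∣ m then (g:ℝ) * (m:ℝ) ^ (-(1 + δ)) else 0) (fun g _ => by split_ifs <;> positivity) hmem
    rwa [if_pos (Nat.gcd_dvd_left m d)] at this
  refine (Finset.sum_le_sum h1).trans ?_
  rw [Finset.sum_comm]
  have h2 : ∀ g ∈ d.divisors, ∑ m ∈ Icc 1 M, (if g ∣ m then (g:ℝ) * (m:ℝ) ^ (-(1 + δ)) else 0) ≤ C1 := by
    intro g hg
    have hgp : 1 ≤ g := Nat.pos_of_mem_divisors hg
    have hgr : (1:ℝ) ≤ g := by exact_mod_cast hgp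
    rw [← Finset.sum_filter]
    refine (sum_dvd_le M g hgp (fun m => (g:ℝ) * (m:ℝ) ^ (-(1 + δ))) (fun m => by positivity)).trans ?_
    refine le_trans (Finset.sum_le_sum (g := fun m : ℕ => (m:ℝ) ^ (-(1+δ))) fun m _ => ?_) (hz M)
    push_cast
    rw [Real.mul_rpow (by positivity) (by positivity), ← mul_assoc]
    have : (g:ℝ) * (g:ℝ) ^ (-(1+δ)) ≤ 1 := by
      rw [← Real.rpow_one_add' (by positivity) (by linarith)]
      exact Real.rpow_le_one_of_one_le_of_nonpos hgr (by linarith)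
    have h0 : 0 ≤ (m:ℝ) ^ (-(1+δ)) := by positivity
    nlinarith
  refine (Finset.sum_le_sum h2).trans ?_
  rw [Finset.sum_const, nsmul_eq_mul]
  have := hd d hd1
  nlinarith

theorem klsum (δ ε : ℝ) (hδ : 0 < δ) (hε : 0 < ε) : ∃ C : ℝ, 1 ≤ C ∧ ∀ (k : ℕ) (a : ℕ → ℂ), EF k a →
    ∀ (d : ℕ) [NeZero d] (a0 : ℤ) (M : ℕ),
    ∑ m ∈ Icc 1 M, lam k a m * ‖kl d a0 (-(m : ℤ))‖ * (m:ℝ) ^ (-(1 + δ)) ≤ C * (k:ℝ) ^ ε * (d:ℝ) ^ (1/2 + ε) := by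
  obtain ⟨C1, hC1, hR⟩ := rankin δ (2 * ε) hδ (by positivity)
  obtain ⟨C2, hC2, hg⟩ := gcdsum δ ε hδ hε
  obtain ⟨C3, hC3, hk⟩ := kl_bound (ε/2) (by positivity)
  refine ⟨C1 * C2 * C3, one_le_mul_of_one_le_of_one_le (one_le_mul_of_one_le_of_one_le hC1 hC2) hC3, fun k a E d _ a0 M => ?_⟩
  have hd1 : 1 ≤ d := NeZero.one_le
  have hdp : (0:ℝ) < d := by exact_mod_cast hd1
  have hkp : (0:ℝ) < k := by have := E.k12; exact_mod_cast (by omega)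
  have hsum0 : 0 ≤ ∑ m ∈ Icc 1 M, lam k a m * ‖kl d a0 (-(m : ℤ))‖ * (m:ℝ) ^ (-(1 + δ)) :=
    Finset.sum_nonneg fun m _ => by have := lam_nonneg k a m; positivity
  refine le_of_sq_le_sq ?_ (by positivity)
  set s := -(1 + δ)
  have cs := Finset.sum_mul_sq_le_sq_mul_sq (Icc 1 M) (fun m => lam k a m * ((m:ℝ) ^ (s/2))) (fun m => ‖kl d a0 (-(m : ℤ))‖ * (m:ℝ) ^ (s/2))
  have hsq : ∀ m : ℕ, (m:ℝ) ^ (s/2) * (m:ℝ) ^ (s/2) = (m:ℝ) ^ s := by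
    intro m
    rw [← Real.rpow_add' (by positivity) (by simp only [s]; linarith)]; congr 1; ring
  have e1 : ∀ m ∈ Icc 1 M, lam k a m * ((m:ℝ) ^ (s/2)) * (‖kl d a0 (-(m : ℤ))‖ * (m:ℝ) ^ (s/2)) = lam k a m * ‖kl d a0 (-(m : ℤ))‖ * (m:ℝ) ^ s := by
    intro m _; rw [← hsq]; ring
  have e2 : ∀ m ∈ Icc 1 M, (lam k a m * ((m:ℝ) ^ (s/2))) ^ 2 = (lam k a m) ^ 2 * (m:ℝ) ^ s := by
    intro m _; rw [← hsq]; ring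
  have e3 : ∀ m ∈ Icc 1 M, (‖kl d a0 (-(m : ℤ))‖ * (m:ℝ) ^ (s/2)) ^ 2 ≤ C3 ^ 2 * (d:ℝ) ^ ε * d * ((Nat.gcd m d : ℝ) * (m:ℝ) ^ s) := by
    intro m _
    have h := hk d a0 (-(m:ℤ))
    have hgcd : Int.gcd (-(m:ℤ)) d = Nat.gcd m d := by rw [Int.neg_gcd]; exact Int.gcd_natCast_natCast m d
    rw [hgcd] at h
    have h2 := pow_le_pow_left₀ (norm_nonneg _) h 2
    have e4 : (C3 * (d:ℝ) ^ (ε / 2) * Real.sqrt d * Real.sqrt (Nat.gcd m d : ℝ)) ^ 2 = C3 ^ 2 * (d:ℝ) ^ ε * d * (Nat.gcd m d : ℝ) := by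
      rw [mul_pow, mul_pow, mul_pow, Real.sq_sqrt (by positivity), Real.sq_sqrt (by positivity), ← Real.rpow_natCast ((d:ℝ) ^ _), ← Real.rpow_mul hdp.le]
      congr 4; push_cast; ring
    rw [e4] at h2
    rw [mul_pow, sq ((m:ℝ) ^ (s/2)), hsq, ← mul_assoc]
    gcongr
  rw [Finset.sum_congr rfl e1, Finset.sum_congr rfl e2] at cs
  refine cs.trans ?_
  have h5 : ∑ m ∈ Icc 1 M, (‖kl d a0 (-(m : ℤ))‖ * (m:ℝ) ^ (s/2)) ^ 2 ≤ C3 ^ 2 * (d:ℝ) ^ ε * d * (C2 * (d:ℝ) ^ ε) := by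
    refine (Finset.sum_le_sum e3).trans ?_
    rw [← Finset.mul_sum]
    have := hg d M hd1
    gcongr
  have h6 := hR k a E M
  unfold RS at h6
  calc _ ≤ (C1 * (k:ℝ) ^ (2 * ε)) * (C3 ^ 2 * (d:ℝ) ^ ε * d * (C2 * (d:ℝ) ^ ε)) := by
        refine mul_le_mul h6 h5 (by positivity) (by positivity)
    _ = (C1 * C2) * (C3 ^ 2 * (k:ℝ) ^ (2 * ε) * ((d:ℝ) ^ ε * d * (d:ℝ) ^ ε)) := by ring
    _ ≤ (C1 * C2) ^ 2 * (C3 ^ 2 * (k:ℝ) ^ (2 * ε) * ((d:ℝ) ^ ε * d * (d:ℝ) ^ ε)) := by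
        have : 1 ≤ C1 * C2 := one_le_mul_of_one_le_of_one_le hC1 hC2
        gcongr
        nlinarith
    _ = _ := by
        have e5 : ((k:ℝ) ^ ε) ^ 2 = (k:ℝ) ^ (2 * ε) := by
          rw [← Real.rpow_natCast, ← Real.rpow_mul hkp.le]; congr 1; push_cast; ring
        have e6 : ((d:ℝ) ^ (1/2 + ε)) ^ 2 = (d:ℝ) ^ ε * d * (d:ℝ) ^ ε := by
          rw [← Real.rpow_natCast, ← Real.rpow_mul hdp.le]
          nth_rewrite 3 [← Real.rpow_one (d:ℝ)]
          rw [← Real.rpow_add hdp, ← Real.rpow_add hdp]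
          congr 1; push_cast; ring
        rw [mul_pow (C1*C2*C3 * (k:ℝ)^ε), mul_pow (C1*C2*C3) ((k:ℝ)^ε), e5, e6]; ring

theorem W_pow (y κ δ : ℝ) (hy : 0 < y) (hκ : 2 ≤ κ) (hδ : 0 < δ) (hδ1 : δ ≤ 1) :
    (y * Real.exp (1 - y)) ^ κ ≤ 4 * y ^ (-(1 + δ)) := by
  rcases le_total y 1 with h | h
  · have h1 := W_le_one y κ hy.le (by linarith)
    have h2 : 1 ≤ y ^ (-(1+δ)) := Real.one_le_rpow_of_pos_of_le_one_of_nonpos hy h (by linarith)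
    linarith
  · have hb : y * Real.exp (1 - y) ≤ 1 := by
      have := W_le_one y 1 hy.le (by norm_num); rwa [Real.rpow_one] at this
    have h1 : (y * Real.exp (1 - y)) ^ κ ≤ (y * Real.exp (1 - y)) ^ (2:ℝ) :=
      Real.rpow_le_rpow_of_exponent_ge (by positivity) hb hκ
    have h2 : y ^ (-(2:ℝ)) ≤ y ^ (-(1+δ)) := Real.rpow_le_rpow_of_exponent_le h (by linarith)
    have h3 : (y * Real.exp (1 - y)) ^ (2:ℝ) ≤ 4 * y ^ (-(2:ℝ)) := by
      rw [Real.rpow_neg hy.le, ← div_eq_mul_inv, le_div_iff₀ (by positivity)]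
      rw [Real.rpow_two, Real.rpow_two, ← mul_pow]
      have : y * Real.exp (1 - y) * y ≤ 2 := by
        rw [show 1 - y = -(y-1) by ring, Real.exp_neg]
        have hq := Real.quadratic_le_exp_of_nonneg (show 0 ≤ y - 1 by linarith)
        have he := Real.exp_pos (y-1)
        have : y * (Real.exp (y-1))⁻¹ * y = y ^ 2 / Real.exp (y-1) := by field_simp
        rw [this, div_le_iff₀ he]
        nlinarith
      calc _ ≤ (2:ℝ) ^ 2 := pow_le_pow_left₀ (by positivity) this 2
        _ = 4 := by norm_num
    linarith

end C2

section C3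

theorem Pterm {κ v r m δ A : ℝ} (k : ℝ) (hk : k = 2 * κ + 1) (hκ : 2 ≤ κ) (hv : 0 < v) (hr : 0 < r) (hm : 0 < m) (hδ : 0 < δ) (hδ1 : δ ≤ 1)
    (hA : 0 ≤ A) :
    v ^ κ * Real.exp κ * (r ^ (-k) * (A * m ^ κ * Real.exp (-(κ * v * m / r ^ 2)))) ≤
      4 * r ^ (1 + 2 * δ) * v ^ (-(1 + δ)) * (A * m ^ (-(1 + δ))) := by
  set y := m * v / r ^ 2 with hy
  have hyp : 0 < y := by positivity
  have h := W_pow y κ δ hyp hκ hδ hδ1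
  have hr2 : ∀ s : ℝ, (r ^ 2) ^ s = r ^ (2 * s) := fun s => by
    rw [← Real.rpow_natCast, ← Real.rpow_mul hr.le]; norm_num
  have e1 : (y * Real.exp (1 - y)) ^ κ = m ^ κ * v ^ κ * r ^ (-(2 * κ)) * (Real.exp κ * Real.exp (-(κ * v * m / r ^ 2))) := by
    rw [Real.mul_rpow hyp.le (Real.exp_pos _).le, ← Real.exp_mul, ← Real.exp_add, hy, Real.div_rpow (by positivity) (by positivity),
      Real.mul_rpow hm.le hv.le, hr2, Real.rpow_neg hr.le, div_eq_mul_inv]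
    congr 2; ring
  have e2 : y ^ (-(1 + δ)) = m ^ (-(1+δ)) * v ^ (-(1+δ)) * r ^ (2 * (1 + δ)) := by
    rw [hy, Real.div_rpow (by positivity) (by positivity),
      Real.mul_rpow hm.le hv.le, hr2, div_eq_mul_inv, ← Real.rpow_neg hr.le]
    congr 2; ring
  have e3 : r ^ (-k) = r ^ (-(2 * κ)) * r ^ (-1 : ℝ) := by
    rw [← Real.rpow_add hr, hk]; congr 1; ring
  have e4 : r ^ (1 + 2 * δ) = r ^ (2 * (1 + δ)) * r ^ (-1 : ℝ) := by
    rw [← Real.rpow_add hr]; congr 1; ring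
  rw [e1, e2] at h
  rw [e3, e4]
  have hp : 0 ≤ A * r ^ (-1 : ℝ) := by positivity
  have := mul_le_mul_of_nonneg_left h hp
  calc _ = _ := ?_
    _ ≤ _ := this
    _ = _ := ?_
  · ring
  · ring

theorem Pd_bound (δ ε : ℝ) (hδ : 0 < δ) (hδ1 : δ ≤ 1) (hε : 0 < ε) : ∃ C : ℝ, 1 ≤ C ∧ ∀ (k : ℕ) (a : ℕ → ℂ), EF k a →
    ∀ (d : ℕ) [NeZero d] (a0 : ℤ) (v : ℝ) (ζ : ℂ), 0 < v → 2 * Real.pi * ζ.re = ((k:ℝ) - 1) / 2 * v →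
    v ^ (((k:ℝ) - 1) / 2) * Real.exp (((k:ℝ) - 1) / 2) * ‖∑' n : ℕ, a (n + 1) * rsum d (((n + 1 : ℕ) : ZMod d) - a0) * Complex.exp (-(2 * Real.pi * (n + 1) * ζ))‖ ≤
      C * (k:ℝ) ^ ε * (d:ℝ) ^ (3/2 + ε + 2 * δ) * ‖ζ‖ ^ (1 + 2 * δ) * v ^ (-(1 + δ)) := by
  obtain ⟨C1, hC1, hkl⟩ := klsum δ ε hδ hε
  refine ⟨4 * C1, by linarith, fun k a E d _ a0 v ζ hv hre => ?_⟩
  have hd1 : 1 ≤ d := NeZero.one_le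
  have hdp : (0:ℝ) < d := by exact_mod_cast hd1
  have hk12 : (12:ℝ) ≤ k := by exact_mod_cast E.k12
  set κ := ((k:ℝ) - 1) / 2 with hκ
  have hκ2 : 2 ≤ κ := by linarith
  have hζ : 0 < ζ.re := by
    have : 0 < 2 * Real.pi * ζ.re := by rw [hre]; positivity
    have hp := Real.pi_pos
    exact pos_of_mul_pos_right this (by positivity)
  have hζn : 0 < ‖ζ‖ := norm_pos_iff.mpr (by rintro rfl; simp at hζ)
  have hr : 0 < d * ‖ζ‖ := by positivity
  obtain ⟨hs, hP⟩ := E.Pbound d a0 ζ hζ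
  have hpos : 0 ≤ v ^ κ * Real.exp κ := by positivity
  refine (mul_le_mul_of_nonneg_left hP hpos).trans ?_
  rw [← tsum_mul_left, ← tsum_mul_left]
  refine Real.tsum_le_of_sum_range_le (fun n => by positivity) fun M => ?_
  have ht : ∀ m ∈ range M, v ^ κ * Real.exp κ * ((d * ‖ζ‖) ^ (-(k:ℝ)) * (‖a (m + 1)‖ * ‖kl d (-a0) (-((m + 1 : ℕ) : ℤ))‖ * Real.exp (-(2 * Real.pi * (m + 1) * (ζ.re / (d ^ 2 * ‖ζ‖ ^ 2)))))) ≤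
     4 * (d * ‖ζ‖) ^ (1 + 2 * δ) * v ^ (-(1 + δ)) * (lam k a (m+1) * ‖kl d (-a0) (-((m + 1 : ℕ) : ℤ))‖ * ((m+1:ℕ):ℝ) ^ (-(1 + δ))) := by
    intro m _
    have h := Pterm (κ := κ) (v := v) (r := d * ‖ζ‖) (m := ((m+1:ℕ):ℝ)) (δ := δ) (A := lam k a (m+1) * ‖kl d (-a0) (-((m + 1 : ℕ) : ℤ))‖) k (by rw [hκ]; ring) hκ2 hv hr (by positivity) hδ hδ1 (mul_nonneg (lam_nonneg _ _ _) (norm_nonneg _))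
    have e1 : Real.exp (-(2 * Real.pi * (m + 1) * (ζ.re / (d ^ 2 * ‖ζ‖ ^ 2)))) = Real.exp (-(κ * v * ((m+1:ℕ):ℝ) / (d * ‖ζ‖) ^ 2)) := by
      rw [← hre]; congr 1; push_cast; rw [mul_pow]; ring
    rw [e1, norm_eq_lam k a (m+1) (by omega)]
    refine le_trans (le_of_eq ?_) h
    ring
  refine (Finset.sum_le_sum ht).trans ?_
  rw [← Finset.mul_sum]
  have h2 := hkl k a E d (-a0) M
  rw [sum_Icc_range] at h2
  have hc : 0 ≤ 4 * (d * ‖ζ‖) ^ (1 + 2 * δ) * v ^ (-(1 + δ)) := by positivity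
  refine (mul_le_mul_of_nonneg_left h2 hc).trans (le_of_eq ?_)
  rw [Real.mul_rpow hdp.le hζn.le]
  have : (d:ℝ) ^ (3/2 + ε + 2 * δ) = (d:ℝ) ^ (1 + 2 * δ) * (d:ℝ) ^ (1/2 + ε) := by
    rw [← Real.rpow_add hdp]; congr 1; ring
  rw [this]; ring

theorem Pq_bound (δ ε : ℝ) (hδ : 0 < δ) (hδ1 : δ ≤ 1) (hε : 0 < ε) : ∃ C : ℝ, 1 ≤ C ∧ ∀ (k : ℕ) (a : ℕ → ℂ), EF k a →
    ∀ (q : ℕ) (a0 : ℤ) (v : ℝ) (ζ : ℂ), 0 < q → 0 < v → 2 * Real.pi * ζ.re = ((k:ℝ) - 1) / 2 * v →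
    v ^ (((k:ℝ) - 1) / 2) * Real.exp (((k:ℝ) - 1) / 2) * ‖∑' n : ℕ, a (n + 1) * (if (q : ℤ) ∣ ((n + 1 : ℕ) : ℤ) - a0 then 1 else 0) * Complex.exp (-(2 * Real.pi * (n + 1) * ζ))‖ ≤
      C * (k:ℝ) ^ ε * (q:ℝ) ^ (1/2 + 2 * ε + 2 * δ) * ‖ζ‖ ^ (1 + 2 * δ) * v ^ (-(1 + δ)) := by
  obtain ⟨C1, hC1, hd⟩ := Pd_bound δ ε hδ hδ1 hε
  obtain ⟨C2, hC2, hdiv⟩ := divisor_bound ε hε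
  refine ⟨C1 * C2, one_le_mul_of_one_le_of_one_le hC1 hC2, fun k a E q a0 v ζ hq hv hre => ?_⟩
  have hqp : (0:ℝ) < q := by exact_mod_cast hq
  have hqc : (q:ℂ) ≠ 0 := by exact_mod_cast hq.ne'
  have hk12 : (12:ℝ) ≤ k := by exact_mod_cast E.k12
  have hζ : 0 < ζ.re := by
    have : 0 < 2 * Real.pi * ζ.re := by rw [hre]; have : 0 < (k:ℝ) - 1 := by linarith
                                        positivity
    have hp := Real.pi_pos
    exact pos_of_mul_pos_right this (by positivity)
  have hr : ∀ d ∈ q.divisors, ∀ n : ℤ, ‖rN d n‖ ≤ d := by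
    intro d _ n
    unfold rN
    refine (norm_sum_le _ _).trans ?_
    refine (Finset.sum_le_card_nsmul _ _ 1 ?_).trans ?_
    · intro j _
      rw [Complex.norm_exp]
      have : (2 * Real.pi * Complex.I * ((j : ℂ) * n) / d).re = 0 := by
        rw [show (2 * Real.pi * Complex.I * ((j : ℂ) * n) / d) = ((2 * Real.pi * (j * n) / d : ℝ) : ℂ) * Complex.I by push_cast; ring]
        rw [Complex.re_ofReal_mul]; simp
      rw [this, Real.exp_zero]
    · rw [nsmul_eq_mul, mul_one]
      exact_mod_cast (Finset.card_filter_le _ _).trans (by simp)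
  have hsm : ∀ d ∈ q.divisors, Summable fun n : ℕ => a (n + 1) * rN d (((n + 1 : ℕ) : ℤ) - a0) * Complex.exp (-(2 * Real.pi * (n + 1) * ζ)) :=
    fun d hd => E.summ_exp ζ hζ _ d fun n => hr d hd _
  have hsum : ∑' n : ℕ, a (n + 1) * (if (q : ℤ) ∣ ((n + 1 : ℕ) : ℤ) - a0 then 1 else 0) * Complex.exp (-(2 * Real.pi * (n + 1) * ζ))
     = (q:ℂ)⁻¹ * ∑ d ∈ q.divisors, ∑' n : ℕ, a (n + 1) * rN d (((n + 1 : ℕ) : ℤ) - a0) * Complex.exp (-(2 * Real.pi * (n + 1) * ζ)) := by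
    rw [← Summable.tsum_finsetSum hsm, ← tsum_mul_left]
    refine tsum_congr fun n => ?_
    rw [← Finset.sum_mul, ← Finset.mul_sum, sum_rN q hq]
    split_ifs
    · field_simp
    · simp
  set c := v ^ (((k:ℝ) - 1) / 2) * Real.exp (((k:ℝ) - 1) / 2) with hc
  have hc0 : 0 ≤ c := by positivity
  have hb : ∀ d ∈ q.divisors, c * ‖∑' n : ℕ, a (n + 1) * rN d (((n + 1 : ℕ) : ℤ) - a0) * Complex.exp (-(2 * Real.pi * (n + 1) * ζ))‖ ≤
      C1 * (k:ℝ) ^ ε * (q:ℝ) ^ (3/2 + ε + 2 * δ) * ‖ζ‖ ^ (1 + 2 * δ) * v ^ (-(1 + δ)) := by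
    intro d hdd
    have hdp : 0 < d := Nat.pos_of_mem_divisors hdd
    haveI : NeZero d := ⟨hdp.ne'⟩
    have h := hd k a E d a0 v ζ hv hre
    have e : ∀ n : ℕ, rsum d (((n + 1 : ℕ) : ZMod d) - a0) = rN d (((n + 1 : ℕ) : ℤ) - a0) := by
      intro n; rw [← rsum_eq]; push_cast; rfl
    simp only [e] at h
    refine h.trans ?_
    have : (d:ℝ) ≤ q := by exact_mod_cast Nat.divisor_le hdd
    gcongr
  rw [hsum, norm_mul, norm_inv, Complex.norm_natCast]
  calc c * ((q:ℝ)⁻¹ * ‖∑ d ∈ q.divisors, ∑' n : ℕ, a (n + 1) * rN d (((n + 1 : ℕ) : ℤ) - a0) * Complex.exp (-(2 * Real.pi * (n + 1) * ζ))‖)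
      ≤ c * ((q:ℝ)⁻¹ * ∑ d ∈ q.divisors, ‖∑' n : ℕ, a (n + 1) * rN d (((n + 1 : ℕ) : ℤ) - a0) * Complex.exp (-(2 * Real.pi * (n + 1) * ζ))‖) := by
        gcongr; exact norm_sum_le _ _
    _ = (q:ℝ)⁻¹ * ∑ d ∈ q.divisors, c * ‖∑' n : ℕ, a (n + 1) * rN d (((n + 1 : ℕ) : ℤ) - a0) * Complex.exp (-(2 * Real.pi * (n + 1) * ζ))‖ := by
        rw [← Finset.mul_sum]; ring
    _ ≤ (q:ℝ)⁻¹ * ∑ d ∈ q.divisors, (C1 * (k:ℝ) ^ ε * (q:ℝ) ^ (3/2 + ε + 2 * δ) * ‖ζ‖ ^ (1 + 2 * δ) * v ^ (-(1 + δ))) := by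
        exact mul_le_mul_of_nonneg_left (Finset.sum_le_sum hb) (by positivity)
    _ = (q:ℝ)⁻¹ * ((#q.divisors : ℝ) * (C1 * (k:ℝ) ^ ε * (q:ℝ) ^ (3/2 + ε + 2 * δ) * ‖ζ‖ ^ (1 + 2 * δ) * v ^ (-(1 + δ)))) := by
        rw [Finset.sum_const, nsmul_eq_mul]
    _ ≤ (q:ℝ)⁻¹ * ((C2 * (q:ℝ) ^ ε) * (C1 * (k:ℝ) ^ ε * (q:ℝ) ^ (3/2 + ε + 2 * δ) * ‖ζ‖ ^ (1 + 2 * δ) * v ^ (-(1 + δ)))) := by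
        have := hdiv q hq
        gcongr
    _ = _ := by
        have : (q:ℝ) ^ (1/2 + 2 * ε + 2 * δ) = (q:ℝ)⁻¹ * (q:ℝ) ^ ε * (q:ℝ) ^ (3/2 + ε + 2 * δ) := by
          rw [← Real.rpow_neg_one, ← Real.rpow_add hqp, ← Real.rpow_add hqp]; congr 1; ring
        rw [this]; ring

end C3

section C4
open MeasureTheory FourierTransform

theorem fourier_norm_le (f : ℝ → ℂ) (α β M : ℝ) (hαβ : α ≤ β) (hf : ∀ x, x ∉ Set.Icc α β → f x = 0)
    (hM : ∀ x, ‖f x‖ ≤ M) (ξ : ℝ) : ‖𝓕 f ξ‖ ≤ M * (β - α) := by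
  have h1 : ‖𝓕 f ξ‖ ≤ ∫ x, ‖f x‖ := VectorFourier.norm_fourierIntegral_le_integral_norm _ _ _ f ξ
  refine h1.trans ?_
  rw [← setIntegral_eq_integral_of_forall_compl_eq_zero (s := Set.Icc α β) (fun x hx => by rw [hf x hx, norm_zero])]
  have h2 := norm_setIntegral_le_of_norm_le_const (μ := volume) (s := Set.Icc α β) (f := fun x => ‖f x‖) (C := M) (by simp) (fun x _ => by simpa using hM x)
  rw [Real.norm_of_nonneg (by positivity)] at h2
  refine h2.trans (le_of_eq ?_)
  simp [hαβ]

theorem fourier_pack (H : ℝ → ℂ) (α β M W : ℝ) (hαβ : α ≤ β) (hW : 0 < W) (hH : ContDiff ℝ (⊤ : ℕ∞) H) (hs : ∀ x, x ∉ Set.Icc α β → H x = 0)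
    (h0 : ∀ x, ‖H x‖ ≤ M) (h4 : ∀ x, ‖iteratedDeriv 4 H x‖ ≤ M * W⁻¹ ^ 4) :
    Continuous (𝓕 H) ∧ (∀ ξ, ‖𝓕 H ξ‖ ≤ 4 * M * (β - α) * ((1 + (W * ξ) ^ 2)⁻¹) ^ 2) ∧
    Integrable (𝓕 H) ∧ ∀ x, H x = ∫ ξ, 𝓕 H ξ * Complex.exp (2 * Real.pi * Complex.I * x * ξ) := by
  have hsn : ∀ n : ℕ, ∀ x, x ∉ Set.Icc α β → iteratedDeriv n H x = 0 := by
    intro n x hx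
    have : H =ᶠ[nhds x] fun _ => 0 := by
      filter_upwards [(isClosed_Icc (a := α) (b := β)).isOpen_compl.mem_nhds hx] with y hy using hs y hy
    rw [this.iteratedDeriv_eq]
    simp
  have hcn : ∀ n : ℕ, Continuous (iteratedDeriv n H) := fun n => hH.continuous_iteratedDeriv n (by exact_mod_cast le_top)
  have hint : ∀ n : ℕ, Integrable (iteratedDeriv n H) := fun n =>
    (hcn n).integrable_of_hasCompactSupport (HasCompactSupport.intro isCompact_Icc (hsn n))
  have hint0 : Integrable H := by simpa using hint 0
  have hM : 0 ≤ M := (norm_nonneg _).trans (h0 0)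
  have hc : Continuous (𝓕 H) := VectorFourier.fourierIntegral_continuous Real.continuous_fourierChar (by exact continuous_inner) hint0
  have hb0 := fourier_norm_le H α β M hαβ hs h0
  have hb4 := fourier_norm_le (iteratedDeriv 4 H) α β _ hαβ (hsn 4) h4
  have hL : 0 ≤ M * (β - α) := mul_nonneg hM (by linarith)
  have hb : ∀ ξ, ‖𝓕 H ξ‖ ≤ 4 * M * (β - α) * ((1 + (W * ξ) ^ 2)⁻¹) ^ 2 := by
    intro ξ
    have e := congrFun (Real.fourier_iteratedDeriv (n := 4) (N := ⊤) hH (fun n _ => hint n) le_top) ξ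
    have h := hb4 ξ
    rw [e, norm_smul, norm_pow] at h
    have e2 : ‖(2 * (Real.pi:ℂ) * Complex.I * ξ)‖ = 2 * Real.pi * |ξ| := by
      simp [abs_of_pos Real.pi_pos]
    rw [e2] at h
    have hp : 1 ≤ 2 * Real.pi := by have := Real.pi_gt_three; linarith
    have h1 : |ξ| ^ 4 * ‖𝓕 H ξ‖ ≤ M * W⁻¹ ^ 4 * (β - α) := by
      refine le_trans ?_ h
      gcongr
      nlinarith [abs_nonneg ξ]
    have h2 : (W * ξ) ^ 4 * ‖𝓕 H ξ‖ ≤ M * (β - α) := by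
      have e3 : (W * ξ) ^ 4 = W ^ 4 * |ξ| ^ 4 := by rw [mul_pow, ← Even.pow_abs (by decide) ξ]
      rw [e3, mul_assoc]
      calc _ ≤ W ^ 4 * (M * W⁻¹ ^ 4 * (β - α)) := by gcongr
        _ = _ := by field_simp
    have h3 := hb0 ξ
    rw [inv_pow, ← div_eq_mul_inv, le_div_iff₀ (by positivity)]
    have h5 : (1 + (W * ξ) ^ 2) ^ 2 ≤ 2 * (1 + (W * ξ) ^ 4) := by nlinarith [sq_nonneg ((W*ξ)^2 - 1)]
    have := mul_le_mul_of_nonneg_left h5 (norm_nonneg (𝓕 H ξ))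
    nlinarith
  have hi : Integrable (𝓕 H) := by
    have hg : Integrable (fun ξ : ℝ => 4 * M * (β - α) * (1 + (W * ξ) ^ 2)⁻¹) :=
      (integrable_inv_one_add_sq.comp_mul_left' hW.ne').const_mul _
    refine hg.mono' hc.aestronglyMeasurable (Filter.Eventually.of_forall fun ξ => (hb ξ).trans ?_)
    have h1 : (1 + (W * ξ) ^ 2)⁻¹ ≤ 1 := inv_le_one_of_one_le₀ (by nlinarith [sq_nonneg (W*ξ)])
    have h2 : 0 ≤ (1 + (W * ξ) ^ 2)⁻¹ := by positivity
    refine mul_le_mul_of_nonneg_left ?_ (by linarith)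
    nlinarith
  refine ⟨hc, hb, hi, fun x => ?_⟩
  have := congrFun (hH.continuous.fourierInv_fourier_eq hint0 hi) x
  rw [Real.fourierInv_eq'] at this
  rw [← this]
  refine integral_congr_ae (Filter.Eventually.of_forall fun ξ => ?_)
  simp only [smul_eq_mul, RCLike.inner_apply, conj_trivial]
  rw [mul_comm]
  congr 2
  push_cast; ring

theorem fourier_int (h : ℝ → ℂ) (A W σ δ : ℝ) (hA : 0 ≤ A) (hW : 0 < W) (hσ : 0 ≤ σ) (hσW : σ ≤ W⁻¹) (hδ : 0 < δ) (hδ1 : δ ≤ 1/2) (hc : Continuous h)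
    (hb : ∀ ξ, ‖h ξ‖ ≤ A * ((1 + (W * ξ) ^ 2)⁻¹) ^ 2) :
    Integrable (fun ξ : ℝ => ‖h ξ‖ * ‖(σ : ℂ) - Complex.I * ξ‖ ^ (1 + 2 * δ)) ∧
    ∫ ξ : ℝ, ‖h ξ‖ * ‖(σ : ℂ) - Complex.I * ξ‖ ^ (1 + 2 * δ) ≤ 2 * Real.pi * A * W⁻¹ ^ (2 + 2 * δ) := by
  have hWi : 0 < W⁻¹ := by positivity
  have hp : ∀ ξ : ℝ, ‖h ξ‖ * ‖(σ : ℂ) - Complex.I * ξ‖ ^ (1 + 2 * δ) ≤ 2 * A * W⁻¹ ^ (1 + 2 * δ) * (1 + (W * ξ) ^ 2)⁻¹ := by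
    intro ξ
    have h1 : ‖(σ : ℂ) - Complex.I * ξ‖ ≤ W⁻¹ * (1 + |W * ξ|) := by
      refine (norm_sub_le _ _).trans ?_
      rw [norm_mul, Complex.norm_I, one_mul, Complex.norm_real, Complex.norm_real, Real.norm_of_nonneg hσ, Real.norm_eq_abs, abs_mul, abs_of_pos hW]
      rw [mul_add, mul_one, ← mul_assoc, inv_mul_cancel₀ hW.ne', one_mul]
      linarith
    have h2 : ‖(σ : ℂ) - Complex.I * ξ‖ ^ (1 + 2 * δ) ≤ W⁻¹ ^ (1 + 2 * δ) * (2 * (1 + (W * ξ) ^ 2)) := by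
      calc _ ≤ (W⁻¹ * (1 + |W * ξ|)) ^ (1 + 2 * δ) := by gcongr
        _ = W⁻¹ ^ (1 + 2 * δ) * (1 + |W * ξ|) ^ (1 + 2 * δ) := by rw [Real.mul_rpow hWi.le (by positivity)]
        _ ≤ W⁻¹ ^ (1 + 2 * δ) * (1 + |W * ξ|) ^ (2:ℝ) := by
            gcongr
            · linarith [abs_nonneg (W * ξ)]
            · linarith
        _ ≤ _ := by
            gcongr
            rw [Real.rpow_two]
            nlinarith [sq_abs (W * ξ), sq_nonneg (|W * ξ| - 1)]
    calc _ ≤ (A * ((1 + (W * ξ) ^ 2)⁻¹) ^ 2) * (W⁻¹ ^ (1 + 2 * δ) * (2 * (1 + (W * ξ) ^ 2))) := by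
          gcongr
          exact hb ξ
      _ = _ := by
          have : (1 + (W * ξ) ^ 2) ≠ 0 := by positivity
          field_simp
  have hg : Integrable (fun ξ : ℝ => 2 * A * W⁻¹ ^ (1 + 2 * δ) * (1 + (W * ξ) ^ 2)⁻¹) :=
      (integrable_inv_one_add_sq.comp_mul_left' hW.ne').const_mul _
  have hcont : Continuous (fun ξ : ℝ => ‖h ξ‖ * ‖(σ : ℂ) - Complex.I * ξ‖ ^ (1 + 2 * δ)) := by
    refine hc.norm.mul (Continuous.rpow_const (by fun_prop) fun _ => Or.inr (by linarith))
  have hint : Integrable (fun ξ : ℝ => ‖h ξ‖ * ‖(σ : ℂ) - Complex.I * ξ‖ ^ (1 + 2 * δ)) := by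
    refine hg.mono' hcont.aestronglyMeasurable (Filter.Eventually.of_forall fun ξ => ?_)
    rw [Real.norm_of_nonneg (by positivity)]
    exact hp ξ
  refine ⟨hint, (integral_mono hint hg hp).trans (le_of_eq ?_)⟩
  have e : W⁻¹ ^ (2 + 2 * δ) = W⁻¹ ^ (1 + 2 * δ) * W⁻¹ := by
    rw [show 2 + 2 * δ = (1 + 2 * δ) + 1 by ring, Real.rpow_add_one hWi.ne']
  rw [e, integral_const_mul, Measure.integral_comp_mul_left (fun y => (1 + y ^ 2)⁻¹) W, integral_univ_inv_one_add_sq, abs_of_pos hWi,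
    smul_eq_mul]
  ring

theorem fourier_swap (b : ℕ → ℂ) (σ s B : ℝ) (hB : 0 ≤ B) (hσ : 0 < σ) (hs : 0 < s)
    (hb : Summable fun n : ℕ => ‖b n‖ * Real.exp (-(2 * Real.pi * (n + 1) * σ)))
    (H h : ℝ → ℂ) (hi : Integrable h) (hH : ∀ x : ℝ, H x = ∫ ξ, h ξ * Complex.exp (2 * Real.pi * Complex.I * x * ξ))
    (hint : Integrable (fun ξ : ℝ => ‖h ξ‖ * ‖(σ : ℂ) - Complex.I * ξ‖ ^ s))
    (hP : ∀ ξ : ℝ, ‖∑' n : ℕ, b n * Complex.exp (-(2 * Real.pi * (n + 1) * ((σ : ℂ) - Complex.I * ξ)))‖ ≤ B * ‖(σ : ℂ) - Complex.I * ξ‖ ^ s) :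
    ‖∑' n : ℕ, b n * Complex.exp (-(2 * Real.pi * (n + 1) * σ)) * H (n + 1)‖ ≤ B * ∫ ξ : ℝ, ‖h ξ‖ * ‖(σ : ℂ) - Complex.I * ξ‖ ^ s := by
  set F : ℕ → ℝ → ℂ := fun n ξ => h ξ * (b n * Complex.exp (-(2 * Real.pi * (n + 1) * ((σ : ℂ) - Complex.I * ξ)))) with hF
  have hn : ∀ n ξ, ‖F n ξ‖ = ‖h ξ‖ * (‖b n‖ * Real.exp (-(2 * Real.pi * (n + 1) * σ))) := by
    intro n ξ
    simp only [hF]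
    rw [norm_mul, norm_mul, Complex.norm_exp]
    congr 3
    simp [Complex.mul_re, Complex.mul_im]
  have hFi : ∀ n, Integrable (F n) := by
    intro n
    refine hi.mul_bdd (c := ‖b n‖ * Real.exp (-(2 * Real.pi * (n + 1) * σ))) ?_ (Filter.Eventually.of_forall fun ξ => ?_)
    · exact Continuous.aestronglyMeasurable (by fun_prop)
    · rw [norm_mul, Complex.norm_exp]
      refine le_of_eq ?_
      congr 2
      simp [Complex.mul_re, Complex.mul_im]
  have hsm : Summable fun n => ∫ ξ, ‖F n ξ‖ := by
    simp_rw [hn]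
    simp_rw [integral_mul_const]
    exact hb.mul_left _
  have key := hasSum_integral_of_summable_integral_norm hFi hsm
  have e1 : ∀ n, ∫ ξ, F n ξ = b n * Complex.exp (-(2 * Real.pi * (n + 1) * σ)) * H (n + 1) := by
    intro n
    rw [hH, ← integral_const_mul]
    refine integral_congr_ae (Filter.Eventually.of_forall fun ξ => ?_)
    simp only [hF]
    have : Complex.exp (-(2 * Real.pi * (n + 1) * ((σ : ℂ) - Complex.I * ξ))) = Complex.exp (-(2 * Real.pi * (n + 1) * σ)) * Complex.exp (2 * Real.pi * Complex.I * ((n + 1 : ℝ) : ℂ) * ξ) := by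
      rw [← Complex.exp_add]; congr 1; push_cast; ring
    rw [this]; ring
  simp_rw [e1] at key
  rw [key.tsum_eq, ← integral_const_mul]
  refine norm_integral_le_of_norm_le (hint.const_mul B) (Filter.Eventually.of_forall fun ξ => ?_)
  simp only [hF]
  rw [tsum_mul_left, norm_mul]
  have := mul_le_mul_of_nonneg_left (hP ξ) (norm_nonneg (h ξ))
  linarith

end C4

section C5
open MeasureTheory FourierTransform

noncomputable def bmp : ContDiffBump (0 : ℝ) := ⟨1/4, 1/2, by norm_num, by norm_num⟩

noncomputable def psi (x : ℝ) : ℂ := ((bmp x : ℝ) : ℂ)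

theorem psi_cd : ContDiff ℝ (⊤ : ℕ∞) psi := Complex.ofRealCLM.contDiff.comp bmp.contDiff

theorem bmp_zero (x : ℝ) (hx : 1/2 ≤ |x|) : bmp x = 0 :=
  bmp.zero_of_le_dist (by simpa [Real.dist_eq, bmp] using hx)

theorem bmp_one (x : ℝ) (hx : |x| ≤ 1/4) : bmp x = 1 :=
  bmp.one_of_mem_closedBall (by simpa [Real.dist_eq, bmp] using hx)

theorem psi_bound : ∃ D : ℝ, 1 ≤ D ∧ ∀ j ≤ 4, ∀ x, ‖iteratedDeriv j psi x‖ ≤ D := by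
  have hj : ∀ j : ℕ, ∃ D : ℝ, ∀ x, ‖iteratedDeriv j psi x‖ ≤ D := by
    intro j
    have hc : Continuous (iteratedDeriv j psi) := psi_cd.continuous_iteratedDeriv j (by exact_mod_cast le_top)
    refine hc.bounded_above_of_compact_support (HasCompactSupport.intro (isCompact_Icc (a := (-1:ℝ)) (b := 1)) fun x hx => ?_)
    have : psi =ᶠ[nhds x] fun _ => 0 := by
      filter_upwards [(isClosed_Icc (a := (-1:ℝ)) (b := 1)).isOpen_compl.mem_nhds hx] with y hy
      have : 1 ≤ |y| := by
        by_contra h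
        rw [not_le, abs_lt] at h
        exact hy ⟨h.1.le, h.2.le⟩
      simp [psi, bmp_zero y (by linarith)]
    rw [this.iteratedDeriv_eq]
    simp
  choose D hD using hj
  refine ⟨1 + ∑ j ∈ range 5, |D j|, by have : 0 ≤ ∑ j ∈ range 5, |D j| := Finset.sum_nonneg fun _ _ => abs_nonneg _
                                       linarith, fun j hj x => ?_⟩
  have h1 := Finset.single_le_sum (f := fun j => |D j|) (fun _ _ => abs_nonneg _) (mem_range.mpr (show j < 5 by omega))
  have h2 := hD j x
  have h3 := le_abs_self (D j)
  linarith

theorem psi_comp (j : ℕ) (c s x : ℝ) : iteratedDeriv j (fun x => psi (c * x + s)) x = c ^ j • iteratedDeriv j psi (c * x + s) := by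
  have h1 : ContDiff ℝ j (fun y => psi (y + s)) := by
    have : ContDiff ℝ (⊤ : ℕ∞) (fun y => psi (y + s)) := psi_cd.comp (by fun_prop)
    exact this.of_le (by exact_mod_cast le_top)
  have := congrFun (iteratedDeriv_comp_const_smul h1 c) x
  rw [this, iteratedDeriv_comp_add_const]

theorem H_bound : ∃ D : ℝ, 1 ≤ D ∧ ∀ (G : ℝ → ℂ) (K : ℕ → ℝ) (u c s : ℝ), 0 < u → 0 < c → c ≤ 2 * u → ContDiff ℝ (⊤ : ℕ∞) G →
    (∀ i ≤ 4, ∀ x, ‖iteratedDeriv i G x‖ ≤ K i * u ^ i) →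
    ContDiff ℝ (⊤ : ℕ∞) (fun x => G x * psi (c * x + s)) ∧
    ∀ j ≤ 4, ∀ x, ‖iteratedDeriv j (fun x => G x * psi (c * x + s)) x‖ ≤ (D * ∑ i ∈ range 5, K i) * u ^ j := by
  obtain ⟨D, hD1, hD⟩ := psi_bound
  refine ⟨256 * D, by linarith, fun G K u c s hu hc hcu hG hK => ?_⟩
  have hK0 : ∀ i ≤ 4, 0 ≤ K i := fun i hi => by
    have := (norm_nonneg _).trans (hK i hi 0)
    exact nonneg_of_mul_nonneg_left this (by positivity)
  have hp : ContDiff ℝ (⊤ : ℕ∞) (fun x => psi (c * x + s)) := psi_cd.comp (by fun_prop)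
  refine ⟨hG.mul hp, fun j hj x => ?_⟩
  rw [iteratedDeriv_fun_mul ((hG.of_le (by exact_mod_cast le_top)).contDiffAt) ((hp.of_le (by exact_mod_cast le_top)).contDiffAt)]
  refine (norm_sum_le _ _).trans ?_
  have h1 : ∀ i ∈ range (j+1), ‖((j.choose i : ℕ) : ℂ) * iteratedDeriv i G x * iteratedDeriv (j - i) (fun x => psi (c * x + s)) x‖ ≤ 256 * D * u ^ j * K i := by
    intro i hi
    have hij : i ≤ j := by have := mem_range.mp hi; omega
    rw [psi_comp, norm_mul, norm_mul, norm_smul, Complex.norm_natCast, norm_pow, Real.norm_of_nonneg hc.le]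
    have a1 : ((j.choose i : ℕ) : ℝ) ≤ 16 := by
      have h := Nat.choose_le_two_pow j i
      have h2 : 2 ^ j ≤ 2 ^ 4 := Nat.pow_le_pow_right (by norm_num) hj
      exact_mod_cast h.trans h2
    have a2 := hK i (by omega) x
    have a3 := hD (j - i) (by omega) (c * x + s)
    have a4 : c ^ (j - i) ≤ 16 * u ^ (j - i) := by
      calc c ^ (j - i) ≤ (2 * u) ^ (j - i) := pow_le_pow_left₀ hc.le hcu _
        _ = 2 ^ (j - i) * u ^ (j - i) := mul_pow _ _ _
        _ ≤ 2 ^ 4 * u ^ (j - i) := by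
          have : (2:ℝ) ^ (j - i) ≤ 2 ^ 4 := pow_le_pow_right₀ (by norm_num) (by omega)
          gcongr
        _ = _ := by norm_num
    have hk := hK0 i (by omega)
    calc _ ≤ 16 * (K i * u ^ i) * (16 * u ^ (j - i) * D) := by gcongr
      _ = 256 * D * (u ^ i * u ^ (j - i)) * K i := by ring
      _ = _ := by rw [← pow_add]; congr 4; omega
  refine (Finset.sum_le_sum h1).trans ?_
  rw [← Finset.mul_sum]
  have h2 : ∑ i ∈ range (j+1), K i ≤ ∑ i ∈ range 5, K i :=
    Finset.sum_le_sum_of_subset_of_nonneg (by intro i hi; rw [mem_range] at *; omega) (fun i hi _ => hK0 i (by have := mem_range.mp hi; omega))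
  calc _ ≤ 256 * D * u ^ j * ∑ i ∈ range 5, K i := by gcongr
    _ = _ := by ring

set_option maxHeartbeats 1000000 in
theorem Tv_bound (δ ε : ℝ) (hδ : 0 < δ) (hδ1 : δ ≤ 1/2) (hε : 0 < ε) : ∃ C : ℝ, 1 ≤ C ∧ ∀ (k : ℕ) (a : ℕ → ℂ), EF k a →
    ∀ (q : ℕ) (a0 : ℤ) (v X Z : ℝ) (G : ℝ → ℂ) (K : ℕ → ℝ), 0 < q → 1 ≤ X → (k:ℝ) ≤ Z → 1 / (4 * X) ≤ v → v ≤ 3 / (2 * X) →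
    ContDiff ℝ (⊤ : ℕ∞) G → (∀ i ≤ 4, ∀ x, ‖iteratedDeriv i G x‖ ≤ K i * (Z / X) ^ i) →
    v ^ (((k:ℝ) - 1) / 2) * Real.exp (((k:ℝ) - 1) / 2) * ‖∑' n : ℕ, a (n + 1) * (if (q : ℤ) ∣ ((n + 1 : ℕ) : ℤ) - a0 then 1 else 0) *
        Complex.exp (-(((k:ℝ) - 1) / 2 * v * (n + 1) : ℝ)) * (G (n + 1) * psi ((v * Z) * (n + 1) + (-Z)))‖ ≤
      C * (∑ i ∈ range 5, K i) * (k:ℝ) ^ ε * (q:ℝ) ^ (1/2 + 2 * ε + 2 * δ) * Z ^ (1 + 2 * δ) := by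
  obtain ⟨C1, hC1, hP⟩ := Pq_bound δ ε hδ (by linarith) hε
  obtain ⟨D, hD1, hH⟩ := H_bound
  refine ⟨16 * (2 * Real.pi) * 16 * C1 * D, ?_, fun k a E q a0 v X Z G K hq hX hkZ hv1 hv2 hG hK => ?_⟩
  · have := Real.pi_gt_three
    have h2 : 1 ≤ C1 * D := one_le_mul_of_one_le_of_one_le hC1 hD1
    nlinarith
  have hk12 : (12:ℝ) ≤ k := by exact_mod_cast E.k12
  have hX0 : 0 < X := by linarith
  have hZ0 : 0 < Z := by linarith
  have hv : 0 < v := lt_of_lt_of_le (by positivity) hv1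
  have hqp : (0:ℝ) < q := by exact_mod_cast hq
  have hpi := Real.pi_gt_three
  set κ := ((k:ℝ) - 1) / 2 with hκ
  have hκ0 : 0 < κ := by rw [hκ]; linarith
  set u := Z / X with hu
  have hu0 : 0 < u := by positivity
  have hvX : v * (2 * X) ≤ 3 := by rwa [le_div_iff₀ (by positivity)] at hv2
  have hvX1 : 1 ≤ v * (4 * X) := by rwa [div_le_iff₀ (by positivity)] at hv1
  have hvu : v * Z ≤ 2 * u := by
    rw [hu, ← mul_div_assoc, le_div_iff₀ hX0]; nlinarith
  obtain ⟨hcd, hb⟩ := hH G K u (v * Z) (-Z) hu0 (by positivity) hvu hG hK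
  set H := fun x => G x * psi ((v * Z) * x + (-Z)) with hHdef
  set S := ∑ i ∈ range 5, K i with hS
  set α := (1 - 1 / (2 * Z)) / v with hα
  set β := (1 + 1 / (2 * Z)) / v with hβ
  have hba : β - α = 1 / (v * Z) := by rw [hα, hβ]; field_simp; ring
  have hαβ : α ≤ β := by have : 0 ≤ β - α := by rw [hba]; positivity
                         linarith
  have hsupp : ∀ x, x ∉ Set.Icc α β → H x = 0 := by
    intro x hx
    have : 1 / 2 ≤ |(v * Z) * x + (-Z)| := by
      by_contra h
      rw [not_le, abs_lt] at h
      refine hx ⟨?_, ?_⟩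
      · rw [hα, div_le_iff₀ hv, sub_le_iff_le_add, ← sub_le_iff_le_add', le_div_iff₀ (by positivity)]; nlinarith
      · rw [hβ, le_div_iff₀ hv, ← sub_le_iff_le_add', le_div_iff₀ (by positivity)]; nlinarith
    simp [hHdef, psi, bmp_zero _ this]
  have hb0 := hb 0 (by norm_num)
  have hb4 := hb 4 (by norm_num)
  simp only [iteratedDeriv_zero, pow_zero, mul_one] at hb0
  obtain ⟨f1, f2, f3, f4⟩ := fourier_pack H α β (D * S) u⁻¹ hαβ (by positivity) hcd hsupp hb0 (by rw [inv_inv]; exact hb4)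
  have hM : 0 ≤ D * S := (norm_nonneg _).trans (hb0 0)
  set σ := κ * v / (2 * Real.pi) with hσ
  have hσ0 : 0 < σ := by positivity
  have hσu : σ ≤ u := by
    rw [hσ, hu, div_le_div_iff₀ (by positivity) hX0]
    have h1 : κ ≤ Z := by rw [hκ]; linarith
    have h2 : κ * v * X ≤ Z * (v * X) := by rw [mul_assoc]; gcongr
    nlinarith
  have hA : 0 ≤ 4 * (D * S) * (β - α) := by rw [hba]; positivity
  obtain ⟨g1, g2⟩ := fourier_int (𝓕 H) _ u⁻¹ σ δ hA (by positivity) hσ0.le (by rw [inv_inv]; exact hσu) hδ hδ1 f1 f2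
  rw [inv_inv] at g2
  set c := v ^ κ * Real.exp κ with hc
  have hc0 : 0 < c := by positivity
  set Q := C1 * (k:ℝ) ^ ε * (q:ℝ) ^ (1/2 + 2 * ε + 2 * δ) with hQ
  have hQ0 : 0 ≤ Q := by positivity
  set b : ℕ → ℂ := fun n => a (n + 1) * (if (q : ℤ) ∣ ((n + 1 : ℕ) : ℤ) - a0 then 1 else 0) with hbdef
  have hbs : Summable fun n : ℕ => ‖b n‖ * Real.exp (-(2 * Real.pi * (n + 1) * σ)) := by
    refine Summable.of_nonneg_of_le (fun n => by positivity) (fun n => ?_) (E.summ σ hσ0)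
    gcongr
    simp only [hbdef]
    rw [norm_mul]
    split_ifs <;> simp
  have hre : ∀ ξ : ℝ, ((σ : ℂ) - Complex.I * ξ).re = σ := by intro ξ; simp
  have sw := fourier_swap b σ (1 + 2 * δ) (Q * v ^ (-(1 + δ)) / c) (by positivity) hσ0 (by linarith) hbs H (𝓕 H) f3 f4 g1 (by
    intro ξ
    have := hP k a E q a0 v ((σ : ℂ) - Complex.I * ξ) hq hv (by rw [hre, hσ, mul_div_cancel₀ _ (by positivity)])
    rw [div_mul_eq_mul_div, le_div_iff₀ hc0, mul_comm]
    refine this.trans (le_of_eq ?_)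
    rw [hQ]; ring)
  have e1 : ∀ n : ℕ, Complex.exp (-(κ * v * (n + 1) : ℝ)) = Complex.exp (-(2 * Real.pi * (n + 1) * σ)) := by
    intro n
    congr 2
    rw [hσ]; push_cast; field_simp
  simp only [hbdef] at sw
  have hlhs : ‖∑' n : ℕ, a (n + 1) * (if (q : ℤ) ∣ ((n + 1 : ℕ) : ℤ) - a0 then 1 else 0) *
        Complex.exp (-(κ * v * (n + 1) : ℝ)) * (G (n + 1) * psi ((v * Z) * (n + 1) + (-Z)))‖ ≤ Q * v ^ (-(1 + δ)) / c * (2 * Real.pi * (4 * (D * S) * (β - α)) * u ^ (2 + 2 * δ)) := by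
    simp only [e1]
    exact sw.trans (mul_le_mul_of_nonneg_left g2 (by positivity))
  refine (mul_le_mul_of_nonneg_left hlhs hc0.le).trans ?_
  have e2 : c * (Q * v ^ (-(1 + δ)) / c * (2 * Real.pi * (4 * (D * S) * (β - α)) * u ^ (2 + 2 * δ))) =
      Q * (D * S) * (2 * Real.pi * 4) * (v ^ (-(1 + δ)) * (β - α) * u ^ (2 + 2 * δ)) := by
    field_simp
  rw [e2]
  have e3 : v ^ (-(1 + δ)) * (β - α) * u ^ (2 + 2 * δ) ≤ 64 * Z ^ (1 + 2 * δ) := by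
    have i1 : v ^ (-(1 + δ)) ≤ 16 * X ^ (1 + δ) := by
      calc v ^ (-(1 + δ)) ≤ (1 / (4 * X)) ^ (-(1 + δ)) := Real.rpow_le_rpow_of_nonpos (by positivity) hv1 (by linarith)
        _ = (4 * X) ^ (1 + δ) := by rw [one_div, Real.rpow_neg (by positivity), Real.inv_rpow (by positivity), inv_inv]
        _ = 4 ^ (1 + δ) * X ^ (1 + δ) := Real.mul_rpow (by norm_num) hX0.le
        _ ≤ 4 ^ (2:ℝ) * X ^ (1 + δ) := by
              have : (4:ℝ) ^ (1 + δ) ≤ 4 ^ (2:ℝ) := Real.rpow_le_rpow_of_exponent_le (by norm_num) (by linarith)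
              gcongr
        _ = _ := by norm_num
    have i2 : β - α ≤ 4 * u⁻¹ := by
      rw [hba, hu, inv_div, ← mul_div_assoc, div_le_div_iff₀ (by positivity) hZ0]; nlinarith
    have i3 : u ^ (2 + 2 * δ) = u * (Z ^ (1 + 2 * δ) * X ^ (-(1 + 2 * δ))) := by
      rw [show 2 + 2 * δ = 1 + (1 + 2 * δ) by ring, Real.rpow_add hu0, Real.rpow_one, hu, Real.div_rpow hZ0.le hX0.le, Real.rpow_neg hX0.le, div_eq_mul_inv (Z ^ _)]
    have i4 : X ^ (1 + δ) * X ^ (-(1 + 2 * δ)) ≤ 1 := by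
      rw [← Real.rpow_add hX0]
      exact Real.rpow_le_one_of_one_le_of_nonpos hX (by linarith)
    calc _ ≤ 16 * X ^ (1 + δ) * (4 * u⁻¹) * u ^ (2 + 2 * δ) := by
          have : 0 ≤ β - α := by linarith
          gcongr
      _ = 64 * Z ^ (1 + 2 * δ) * (X ^ (1 + δ) * X ^ (-(1 + 2 * δ))) := by
          rw [i3]
          have : u⁻¹ * u = 1 := inv_mul_cancel₀ hu0.ne'
          linear_combination (64 * Z ^ (1 + 2 * δ) * (X ^ (1 + δ) * X ^ (-(1 + 2 * δ)))) * this
      _ ≤ 64 * Z ^ (1 + 2 * δ) * 1 := by gcongr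
      _ = _ := by ring
  calc _ ≤ Q * (D * S) * (2 * Real.pi * 4) * (64 * Z ^ (1 + 2 * δ)) := by
        gcongr
    _ = _ := by rw [hQ]; ring

end C5

section C6
open MeasureTheory

noncomputable def gav (κ Y r : ℝ) : ℝ := (r * Real.exp (1 - r)) ^ κ * bmp (Y * r + (-Y)) / r

theorem gav_zero (κ Y r : ℝ) (hY : 1 ≤ Y) (hr : r ∉ Set.Icc (1/2) (3/2)) : gav κ Y r = 0 := by
  have : 1/2 ≤ |Y * r + (-Y)| := by
    by_contra h
    rw [not_le, abs_lt] at h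
    refine hr ⟨?_, ?_⟩ <;> nlinarith
  rw [gav, bmp_zero _ this]; simp

theorem gav_int (κ Y : ℝ) (hκ : 0 < κ) (hY : 1 ≤ Y) : Integrable (gav κ Y) := by
  have hc : ContinuousOn (gav κ Y) (Set.Icc (1/2) (3/2)) := by
    unfold gav
    refine ContinuousOn.div (ContinuousOn.mul (ContinuousOn.rpow_const (by fun_prop) fun x _ => Or.inr hκ.le) ?_) continuousOn_id ?_
    · exact (bmp.continuous.comp (by fun_prop)).continuousOn
    · intro x hx
      have := hx.1
      have h0 : (0:ℝ) < x := by linarith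
      exact h0.ne'
  have h1 : IntegrableOn (gav κ Y) (Set.Icc (1/2) (3/2)) := hc.integrableOn_compact isCompact_Icc
  exact h1.integrable_of_forall_notMem_eq_zero fun x hx => gav_zero κ Y x hY hx

theorem gav_nonneg (κ Y r : ℝ) (hr : 0 < r) : 0 ≤ gav κ Y r := by
  unfold gav
  have := bmp.nonneg (x := Y * r + (-Y))
  positivity

theorem gav_low (κ Y : ℝ) (hκ : 0 < κ) (hY : 1 ≤ Y) (hκY : κ ≤ Y) : 1 / (16 * Y) ≤ ∫ r in Set.Ioi 0, gav κ Y r := by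
  have hY0 : 0 < Y := by linarith
  have hi := gav_int κ Y hκ hY
  have hY4 : 1 / (4 * Y) ≤ 1 / 4 := by
    rw [div_le_div_iff₀ (by positivity) (by norm_num)]; linarith
  have hpos : 0 < 1 / (4 * Y) := by positivity
  have h1 : ∫ r in Set.Icc 1 (1 + 1 / (4 * Y)), gav κ Y r ≤ ∫ r in Set.Ioi 0, gav κ Y r := by
    refine setIntegral_mono_set hi.integrableOn ?_ ?_
    · exact (ae_restrict_iff' measurableSet_Ioi).mpr (Filter.Eventually.of_forall fun r hr => gav_nonneg κ Y r hr)
    · refine HasSubset.Subset.eventuallyLE fun r hr => ?_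
      have := hr.1
      simp only [Set.mem_Ioi]; linarith
  have h2 : ∫ r in Set.Icc 1 (1 + 1 / (4 * Y)), (1/4 : ℝ) ≤ ∫ r in Set.Icc 1 (1 + 1 / (4 * Y)), gav κ Y r := by
    refine setIntegral_mono_on (by simp) hi.integrableOn measurableSet_Icc fun r hr => ?_
    have hr1 := hr.1
    have hr2 : r - 1 ≤ 1 / (4 * Y) := by linarith [hr.2]
    have hYr : Y * (r - 1) ≤ 1 / 4 := by
      rw [le_div_iff₀ (by positivity)] at hr2; linarith
    have hb : bmp (Y * r + (-Y)) = 1 := by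
      apply bmp_one
      rw [abs_le]; constructor <;> nlinarith
    have hw := W_low r κ hr1 hκ.le
    have hs : κ * (r - 1) ^ 2 ≤ 1 / 2 := by
      have : κ * (r - 1) ≤ Y * (r - 1) := by gcongr
      nlinarith
    unfold gav
    rw [hb, mul_one, le_div_iff₀ (by linarith)]
    nlinarith
  refine le_trans (le_of_eq ?_) (h2.trans h1)
  simp [hY0.le]
  field_simp
  norm_num

theorem gav_scale (κ Y n : ℝ) (hn : 0 < n) : ∫ v in Set.Ioi 0, n * gav κ Y (n * v) = ∫ r in Set.Ioi 0, gav κ Y r := by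
  rw [integral_const_mul, integral_comp_mul_left_Ioi _ 0 hn, mul_zero, smul_eq_mul, ← mul_assoc, mul_inv_cancel₀ hn.ne', one_mul]

theorem T_bound (δ ε : ℝ) (hδ : 0 < δ) (hδ1 : δ ≤ 1/2) (hε : 0 < ε) : ∃ C : ℝ, 1 ≤ C ∧ ∀ (k : ℕ) (a : ℕ → ℂ), EF k a →
    ∀ (q : ℕ) (a0 : ℤ) (X Z : ℝ) (G : ℝ → ℂ) (K : ℕ → ℝ) (N : ℕ), 0 < q → 1 ≤ X → (k:ℝ) ≤ Z → 2 * X < N →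
    ContDiff ℝ (⊤ : ℕ∞) G → (∀ x : ℝ, G x ≠ 0 → X ≤ x ∧ x ≤ 2 * X) → (∀ i ≤ 4, ∀ x, ‖iteratedDeriv i G x‖ ≤ K i * (Z / X) ^ i) →
    ‖∑ n ∈ range N, a (n + 1) * (if (q : ℤ) ∣ ((n + 1 : ℕ) : ℤ) - a0 then 1 else 0) * (((n + 1 : ℕ) : ℝ) ^ (-(((k:ℝ) - 1) / 2)) : ℝ) * G (n + 1)‖ ≤
      C * (∑ i ∈ range 5, K i) * (k:ℝ) ^ ε * (q:ℝ) ^ (1/2 + 2 * ε + 2 * δ) * Z ^ (2 + 2 * δ) := by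
  obtain ⟨C, hC1, hT⟩ := Tv_bound δ ε hδ hδ1 hε
  refine ⟨80 * C, by linarith, fun k a E q a0 X Z G K N hq hX hkZ hN hG hsupp hK => ?_⟩
  have hk12 : (12:ℝ) ≤ k := by exact_mod_cast E.k12
  have hX0 : 0 < X := by linarith
  have hZ0 : 0 < Z := by linarith
  have hT' := fun v h1 h2 => hT k a E q a0 v X Z G K hq hX hkZ h1 h2 hG hK
  set κ := ((k:ℝ) - 1) / 2 with hκ
  have hκ0 : 0 < κ := by rw [hκ]; linarith
  set B := C * (∑ i ∈ range 5, K i) * (k:ℝ) ^ ε * (q:ℝ) ^ (1/2 + 2 * ε + 2 * δ) * Z ^ (1 + 2 * δ) with hB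
  set c := ∫ r in Set.Ioi 0, gav κ Z r with hc
  have hcl : 1 / (16 * Z) ≤ c := gav_low κ Z hκ0 (by linarith) (by rw [hκ]; linarith)
  have hgi := gav_int κ Z hκ0 (by linarith)
  have hc0 : 0 < c := lt_of_lt_of_le (by positivity) hcl
  set w : ℕ → ℂ := fun n => a (n + 1) * (if (q : ℤ) ∣ ((n + 1 : ℕ) : ℤ) - a0 then 1 else 0) * (((n + 1 : ℕ) : ℝ) ^ (-κ) : ℝ) * G (n + 1) with hw
  set F : ℝ → ℂ := fun v => ∑ n ∈ range N, w n * ((((n + 1 : ℕ) : ℝ) * gav κ Z (((n + 1 : ℕ) : ℝ) * v) : ℝ) : ℂ) with hF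
  have hni : ∀ n : ℕ, Integrable (fun v : ℝ => w n * ((((n + 1 : ℕ) : ℝ) * gav κ Z (((n + 1 : ℕ) : ℝ) * v) : ℝ) : ℂ)) := by
    intro n
    refine Integrable.const_mul ?_ _
    refine Integrable.ofReal ?_
    exact (hgi.comp_mul_left' (by positivity)).const_mul _
  have hcT : (c : ℂ) * ∑ n ∈ range N, w n = ∫ v in Set.Ioi 0, F v := by
    rw [hF, integral_finset_sum _ fun n _ => (hni n).integrableOn, Finset.mul_sum]
    refine Finset.sum_congr rfl fun n _ => ?_
    rw [integral_const_mul, integral_complex_ofReal, gav_scale _ _ _ (by positivity), mul_comm]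
  have hI : ∫ v in Set.Ioi 0, F v = ∫ v in Set.Icc (1 / (4 * X)) (3 / (2 * X)), F v := by
    refine setIntegral_eq_of_subset_of_forall_diff_eq_zero measurableSet_Ioi (fun v hv => ?_) (fun v hv => ?_)
    · have := hv.1
      exact lt_of_lt_of_le (by positivity) this
    · simp only [hF]
      refine Finset.sum_eq_zero fun n _ => ?_
      by_cases hg : G (n + 1) = 0
      · simp [hw, hg]
      · obtain ⟨g1, g2⟩ := hsupp _ hg
        rw [gav_zero κ Z _ (by linarith), mul_zero, Complex.ofReal_zero, mul_zero]
        intro hm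
        refine hv.2 ⟨?_, ?_⟩
        · have h1 := hm.1
          have hv0 : 0 < v := hv.1
          push_cast at h1
          rw [div_le_iff₀ (by positivity)]
          nlinarith
        · have h1 := hm.2
          have hv0 : 0 < v := hv.1
          push_cast at h1
          rw [le_div_iff₀ (by positivity)]
          nlinarith
  have hFb : ∀ v ∈ Set.Icc (1 / (4 * X)) (3 / (2 * X)), ‖F v‖ ≤ 4 * X * B := by
    intro v hv
    have hv0 : 0 < v := lt_of_lt_of_le (by positivity) hv.1
    have hb := hT' v hv.1 hv.2
    rw [tsum_eq_sum (s := range N) (by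
      intro n hn
      have hn' : N ≤ n := by simpa using hn
      have : G (n + 1) = 0 := by
        by_contra hg
        have := (hsupp _ hg).2
        have h2 : (N:ℝ) ≤ n := by exact_mod_cast hn'
        linarith
      simp [this])] at hb
    have e : F v = ((v⁻¹ : ℝ) : ℂ) * (((v ^ κ * Real.exp κ : ℝ) : ℂ) * ∑ n ∈ range N, a (n + 1) * (if (q : ℤ) ∣ ((n + 1 : ℕ) : ℤ) - a0 then 1 else 0) *
        Complex.exp (-(κ * v * (n + 1) : ℝ)) * (G (n + 1) * psi ((v * Z) * (n + 1) + (-Z)))) := by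
      rw [hF, Finset.mul_sum, Finset.mul_sum]
      refine Finset.sum_congr rfl fun n _ => ?_
      simp only [hw]
      have hn0 : (0:ℝ) < ((n + 1 : ℕ) : ℝ) := by positivity
      have e1 : (((n + 1 : ℕ) : ℝ) ^ (-κ)) * (((n + 1 : ℕ) : ℝ) * gav κ Z (((n + 1 : ℕ) : ℝ) * v)) = v⁻¹ * (v ^ κ * Real.exp κ) * (Real.exp (-(κ * v * (n + 1))) * bmp ((v * Z) * (n + 1) + (-Z))) := by
        unfold gav
        rw [Real.mul_rpow (by positivity) (Real.exp_pos _).le, Real.mul_rpow hn0.le hv0.le, ← Real.exp_mul, Real.rpow_neg hn0.le]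
        have e2 : Real.exp ((1 - ((n + 1 : ℕ) : ℝ) * v) * κ) = Real.exp κ * Real.exp (-(κ * v * (n + 1))) := by
          rw [← Real.exp_add]; congr 1; push_cast; ring
        have e3 : Z * (((n + 1 : ℕ) : ℝ) * v) + -Z = (v * Z) * (n + 1) + (-Z) := by push_cast; ring
        rw [e2, e3]
        have : (((n + 1 : ℕ) : ℝ) ^ κ) ≠ 0 := by positivity
        field_simp
      have e4 := congrArg (fun x : ℝ => (x : ℂ)) e1
      rw [Complex.ofReal_mul] at e4
      have e5 : Complex.exp (-(κ * v * (n + 1) : ℝ)) = ((Real.exp (-(κ * v * (n + 1))) : ℝ) : ℂ) := by push_cast; rfl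
      rw [e5]
      unfold psi
      rw [Complex.ofReal_mul (v⁻¹ * _), Complex.ofReal_mul (v⁻¹), Complex.ofReal_mul (Real.exp (-(κ * v * (n + 1))))] at e4
      linear_combination (a (n + 1) * (if (q : ℤ) ∣ ((n + 1 : ℕ) : ℤ) - a0 then 1 else 0) * G (n + 1)) * e4
    rw [e, norm_mul, norm_mul, Complex.norm_real, Complex.norm_real, Real.norm_of_nonneg (by positivity), Real.norm_of_nonneg (by positivity)]
    have hvi : v⁻¹ ≤ 4 * X := by
      rw [inv_le_comm₀ hv0 (by positivity), ← one_div]; exact hv.1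
    exact mul_le_mul hvi hb (by positivity) (by positivity)
  have hfin := norm_setIntegral_le_of_norm_le_const (μ := volume) (f := F) (by simp) hFb
  have hvol : volume.real (Set.Icc (1 / (4 * X)) (3 / (2 * X))) = 5 / (4 * X) := by
    rw [Real.volume_real_Icc_of_le]
    · field_simp; norm_num
    · rw [div_le_div_iff₀ (by positivity) (by positivity)]; linarith
  rw [hvol, ← hI, ← hcT, norm_mul, Complex.norm_real, Real.norm_of_nonneg hc0.le] at hfin
  have h5 : 4 * X * B * (5 / (4 * X)) = 5 * B := by field_simp
  rw [h5] at hfin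
  have h6 : 1 / (16 * Z) * ‖∑ n ∈ range N, w n‖ ≤ 5 * B := le_trans (by gcongr) hfin
  rw [div_mul_eq_mul_div, one_mul, div_le_iff₀ (by positivity)] at h6
  refine h6.trans (le_of_eq ?_)
  have e7 : Z ^ (2 + 2 * δ) = Z ^ (1 + 2 * δ) * Z := by
    rw [show 2 + 2 * δ = (1 + 2 * δ) + 1 by ring, Real.rpow_add_one hZ0.ne']
  rw [e7, hB]; ring

theorem final_aux :
    ∀ ε : ℝ, 0 < ε → ∀ κ : ℕ → ℝ, ∃ K : ℝ,
      ∀ (k : ℕ) (a : ℕ → ℂ), IsNormalizedHeckeEigenform k a →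
        ∀ (X Z : ℝ) (G : ℝ → ℂ) (a₀ q : ℕ),
          1 ≤ X → 1 ≤ Z → 0 < a₀ → 0 < q →
          ContDiff ℝ (⊤ : ℕ∞) G →
          (∀ x : ℝ, G x ≠ 0 → X ≤ x ∧ x ≤ 2 * X) →
          (∀ ν : ℕ, ∀ x : ℝ, ‖iteratedDeriv ν G x‖ ≤ κ ν * (X / Z) ^ (-(ν : ℝ))) →
          ‖∑' n : ℕ, if (n : ZMod q) = (a₀ : ZMod q) then
              G (n : ℝ) * heckeLambda k a (n : ℤ) else 0‖ ≤
            K * ((q : ℝ) * k * Z) ^ ε * (Z ^ 2 + (k : ℝ) ^ 2) * (q : ℝ) ^ ((1 : ℝ) / 2) := by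
  intro ε hε κ
  set δ := min (ε / 8) (1/2) with hδdef
  have hδ : 0 < δ := lt_min (by positivity) (by norm_num)
  have hδ1 : δ ≤ 1/2 := min_le_right _ _
  have hδ2 : δ ≤ ε / 8 := min_le_left _ _
  obtain ⟨C, hC1, hT⟩ := T_bound δ (ε / 4) hδ hδ1 (by positivity)
  refine ⟨4 * C * ∑ i ∈ range 5, κ i, fun k a hE X Z G a₀ q hX hZ ha₀ hq hG hsupp hder => ?_⟩
  have E := EF_of hE
  have hk12 : (12:ℝ) ≤ k := by exact_mod_cast E.k12
  have hX0 : 0 < X := by linarith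
  have hZ0 : 0 < Z := by linarith
  have hk0 : (0:ℝ) < k := by linarith
  have hq1 : (1:ℝ) ≤ q := by exact_mod_cast hq
  have hq0 : (0:ℝ) < q := by linarith
  set Y := Z + k with hY
  have hY0 : 0 < Y := by positivity
  have hκ0 : ∀ i, 0 ≤ κ i := fun i => by
    have := (norm_nonneg _).trans (hder i 0)
    exact nonneg_of_mul_nonneg_left this (by positivity)
  have hder' : ∀ i ≤ 4, ∀ x, ‖iteratedDeriv i G x‖ ≤ κ i * (Y / X) ^ i := by
    intro i _ x
    refine (hder i x).trans ?_
    refine mul_le_mul_of_nonneg_left ?_ (hκ0 i)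
    rw [Real.rpow_neg (by positivity), Real.rpow_natCast, ← inv_pow, inv_div]
    have : Z ≤ Y := by rw [hY]; linarith
    gcongr
  set N := ⌊2 * X⌋₊ + 1 with hN
  have hNX : 2 * X < N := by rw [hN]; exact_mod_cast Nat.lt_floor_add_one (2 * X)
  have h := hT k a E q a₀ X Y G κ N hq hX (by rw [hY]; linarith) hNX hG hsupp hder'
  have hsum : (∑' n : ℕ, if (n : ZMod q) = (a₀ : ZMod q) then
              G (n : ℝ) * heckeLambda k a (n : ℤ) else 0) = ∑ n ∈ range N, a (n + 1) * (if (q : ℤ) ∣ ((n + 1 : ℕ) : ℤ) - (a₀ : ℤ) then 1 else 0) * (((n + 1 : ℕ) : ℝ) ^ (-(((k:ℝ) - 1) / 2)) : ℝ) * G (n + 1) := by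
    rw [tsum_eq_sum (s := range (N + 1)) (by
      intro n hn
      have hn' : N + 1 ≤ n := by simpa using hn
      have : G n = 0 := by
        by_contra hg
        have := (hsupp _ hg).2
        have h2 : (N:ℝ) + 1 ≤ n := by exact_mod_cast hn'
        linarith
      simp [this]), Finset.sum_range_succ']
    have h0 : G ((0:ℕ):ℝ) = 0 := by
      by_contra hg
      have := (hsupp _ hg).1
      simp at this; linarith
    rw [h0, zero_mul, ite_self, add_zero]
    refine Finset.sum_congr rfl fun n _ => ?_
    have hiff : (((n + 1 : ℕ) : ZMod q) = (a₀ : ZMod q)) ↔ (q : ℤ) ∣ ((n + 1 : ℕ) : ℤ) - (a₀ : ℤ) := by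
      rw [← ZMod.intCast_zmod_eq_zero_iff_dvd, Int.cast_sub, sub_eq_zero, Int.cast_natCast, Int.cast_natCast]
    by_cases hd : (q : ℤ) ∣ ((n + 1 : ℕ) : ℤ) - (a₀ : ℤ)
    · rw [if_pos hd, if_pos (hiff.mpr hd)]
      unfold heckeLambda
      rw [if_pos (by positivity)]
      simp only [Int.toNat_natCast]
      push_cast; ring
    · rw [if_neg hd, if_neg (fun h => hd (hiff.mp h))]
      simp
  rw [hsum]
  refine h.trans ?_
  set S := ∑ i ∈ range 5, κ i with hS
  have hS0 : 0 ≤ S := Finset.sum_nonneg fun i _ => hκ0 i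
  have hkZ1 : 1 ≤ (k:ℝ) * Z := by nlinarith
  have y1 : Y ^ (2 + 2 * δ) ≤ 2 * (Z ^ 2 + (k:ℝ) ^ 2) * (2 * ((k:ℝ) * Z) ^ (ε / 4)) := by
    rw [Real.rpow_add hY0, Real.rpow_two]
    have i1 : Y ^ 2 ≤ 2 * (Z ^ 2 + (k:ℝ) ^ 2) := by rw [hY]; nlinarith [sq_nonneg (Z - k)]
    have i2 : Y ≤ 2 * (k * Z) := by rw [hY]; nlinarith
    have i3 : Y ^ (2 * δ) ≤ 2 * ((k:ℝ) * Z) ^ (ε / 4) := by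
      calc Y ^ (2 * δ) ≤ (2 * (k * Z)) ^ (2 * δ) := by gcongr
        _ = 2 ^ (2 * δ) * ((k:ℝ) * Z) ^ (2 * δ) := Real.mul_rpow (by norm_num) (by positivity)
        _ ≤ 2 ^ (1:ℝ) * ((k:ℝ) * Z) ^ (ε / 4) := by
          refine mul_le_mul (Real.rpow_le_rpow_of_exponent_le (by norm_num) (by linarith)) (Real.rpow_le_rpow_of_exponent_le hkZ1 (by linarith)) (by positivity) (by positivity)
        _ = _ := by rw [Real.rpow_one]
    exact mul_le_mul i1 i3 (by positivity) (by positivity)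
  have q1 : (q:ℝ) ^ (1/2 + 2 * (ε / 4) + 2 * δ) ≤ (q:ℝ) ^ ((1:ℝ)/2) * (q:ℝ) ^ ε := by
    rw [← Real.rpow_add hq0]
    exact Real.rpow_le_rpow_of_exponent_le hq1 (by linarith)
  have k1 : (k:ℝ) ^ (ε / 4) ≤ ((k:ℝ) * Z) ^ (ε / 4) := by
    gcongr; nlinarith
  have kz : ((k:ℝ) * Z) ^ (ε / 4) * ((k:ℝ) * Z) ^ (ε / 4) ≤ ((k:ℝ) * Z) ^ ε := by
    rw [← Real.rpow_add (by positivity)]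
    exact Real.rpow_le_rpow_of_exponent_le hkZ1 (by linarith)
  have e8 : ((q : ℝ) * k * Z) ^ ε = (q:ℝ) ^ ε * ((k:ℝ) * Z) ^ ε := by
    rw [mul_assoc, Real.mul_rpow hq0.le (by positivity)]
  rw [e8]
  calc _ ≤ C * S * ((k:ℝ) * Z) ^ (ε / 4) * ((q:ℝ) ^ ((1:ℝ)/2) * (q:ℝ) ^ ε) * (2 * (Z ^ 2 + (k:ℝ) ^ 2) * (2 * ((k:ℝ) * Z) ^ (ε / 4))) := by
        gcongr
    _ = 4 * C * S * (q:ℝ) ^ ε * (((k:ℝ) * Z) ^ (ε / 4) * ((k:ℝ) * Z) ^ (ε / 4)) * (Z ^ 2 + (k:ℝ) ^ 2) * (q:ℝ) ^ ((1:ℝ)/2) := by ring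
    _ ≤ 4 * C * S * (q:ℝ) ^ ε * ((k:ℝ) * Z) ^ ε * (Z ^ 2 + (k:ℝ) ^ 2) * (q:ℝ) ^ ((1:ℝ)/2) := by gcongr
    _ = _ := by ring

end C6

end Parts

/-- **Hecke eigenvalues in arithmetic progressions** (Corollary 7.6, level 1):
`Σ_{n ≡ a (q)} G(n) λ(n) ≪_ε (qkZ)^ε (Z² + k²) q^{1/2}`. -/
theorem hecke_eigenvalues_in_AP :
    ∀ ε : ℝ, 0 < ε → ∀ κ : ℕ → ℝ, ∃ K : ℝ,
      ∀ (k : ℕ) (a : ℕ → ℂ), IsNormalizedHeckeEigenform k a →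
        ∀ (X Z : ℝ) (G : ℝ → ℂ) (a₀ q : ℕ),
          1 ≤ X → 1 ≤ Z → 0 < a₀ → 0 < q →
          ContDiff ℝ (⊤ : ℕ∞) G →
          (∀ x : ℝ, G x ≠ 0 → X ≤ x ∧ x ≤ 2 * X) →
          (∀ ν : ℕ, ∀ x : ℝ, ‖iteratedDeriv ν G x‖ ≤ κ ν * (X / Z) ^ (-(ν : ℝ))) →
          ‖∑' n : ℕ, if (n : ZMod q) = (a₀ : ZMod q) then
              G (n : ℝ) * heckeLambda k a (n : ℤ) else 0‖ ≤
            K * ((q : ℝ) * k * Z) ^ ε * (Z ^ 2 + (k : ℝ) ^ 2) * (q : ℝ) ^ ((1 : ℝ) / 2) := by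
  exact final_aux
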